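/- Let O = {x, y, z, α, β, γ}, let ≺_a be the strict partial order on O generated by γ ≺_a y ≺_a x and z ≺_a β ≺_a α, and let ≺_b be the strict partial order on O generated by x ≺_b z ≺_b y and α ≺_b γ ≺_b β. Then every infinite game with two players a and b, outcomes O, preferences ≺_a and ≺_b, played on a countable pruned tree T over a countable set Σ and whose outcome function v satisfies that v⁻¹({u}) is a quasi-difference set of [T] for every u ∈ O, has a subgame perfect equilibrium. -/

import Mathlib

/-! Basic setup: trees of finite sequences, their branches, the topology on the set of
branches, the Hausdorff difference hierarchy, quasi-difference sets, and infinite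
games in extensive form. -/

/-- `T` is a tree over `α`: a set of finite sequences closed under taking prefixes. -/
def IsTree {α : Type*} (T : Set (List α)) : Prop :=
  ∀ ⦃γ δ : List α⦄, γ <+: δ → δ ∈ T → γ ∈ T

/-- `succ(T, γ)`: the nodes of `T` extending `γ` and of length `|γ| + 1`. -/
def treeSucc {α : Type*} (T : Set (List α)) (γ : List α) : Set (List α) :=
  {δ | δ ∈ T ∧ γ <+: δ ∧ δ.length = γ.length + 1}

/-- `T` is pruned if every node has a successor. -/
def IsPruned {α : Type*} (T : Set (List α)) : Prop :=
  ∀ γ ∈ T, (treeSucc T γ).Nonempty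

/-- The finite prefix of length `n` of an infinite sequence `p`. -/
def playPrefix {α : Type*} (p : ℕ → α) (n : ℕ) : List α :=
  List.ofFn fun i : Fin n => p i

/-- `[T]`: the infinite sequences all of whose finite prefixes lie in `T`. -/
def Body {α : Type*} (T : Set (List α)) : Set (ℕ → α) :=
  {p | ∀ n : ℕ, playPrefix p n ∈ T}

/-- `γ[T_γ]`: the elements of `[T]` extending the node `γ`. -/
def cylinder {α : Type*} (T : Set (List α)) (γ : List α) : Set (ℕ → α) :=
  {p | p ∈ Body T ∧ playPrefix p γ.length = γ}

/-- Open subsets of `[T]`: the unions of basic sets `γ[T_γ]`, `γ ∈ T`. -/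
def IsOpenIn {α : Type*} (T : Set (List α)) (A : Set (ℕ → α)) : Prop :=
  ∃ S ⊆ T, A = ⋃ γ ∈ S, cylinder T γ

/-- Closed subsets of `[T]`: complements in `[T]` of open subsets of `[T]`. -/
def IsClosedIn {α : Type*} (T : Set (List α)) (A : Set (ℕ → α)) : Prop :=
  A ⊆ Body T ∧ IsOpenIn T (Body T \ A)

/-- Borel subsets of `[T]`: members of the σ-algebra generated by the open
subsets of `[T]` that are themselves included in `[T]`. -/
def IsBorelIn {α : Type*} (T : Set (List α)) (X : Set (ℕ → α)) : Prop :=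
  X ⊆ Body T ∧
    @MeasurableSet (ℕ → α) (MeasurableSpace.generateFrom {A | IsOpenIn T A}) X

/-- `D_θ((A_η)_{η<θ})`: the set of `x ∈ ⋃_{η<θ} A_η` such that the least `η < θ`
with `x ∈ A_η` has parity opposite to that of `θ`. -/
noncomputable def Dset {α : Type*} (θ : Ordinal.{0}) (A : Ordinal.{0} → Set (ℕ → α)) :
    Set (ℕ → α) :=
  {x | (∃ η < θ, x ∈ A η) ∧ sInf {η | η < θ ∧ x ∈ A η} % 2 ≠ θ % 2}

/-- `D_θ([T])`: all sets of the form `D_θ((A_η)_{η<θ})` for an `⊆`-increasing family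
of open subsets of `[T]`. -/
def Dclass {α : Type*} (T : Set (List α)) (θ : Ordinal.{0}) : Set (Set (ℕ → α)) :=
  {X | ∃ A : Ordinal.{0} → Set (ℕ → α),
        (∀ η < θ, IsOpenIn T (A η)) ∧
        (∀ η₁ η₂, η₁ ≤ η₂ → η₂ < θ → A η₁ ⊆ A η₂) ∧
        X = Dset θ A}

/-- The quasi-difference sets `𝒟([T])`: open sets, unions of quasi-difference sets
placed below pairwise `⊑`-incomparable nodes, and complements in `[T]`. -/
inductive QuasiDiff {α : Type*} (T : Set (List α)) : Set (ℕ → α) → Prop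
  | isOpen : ∀ A, IsOpenIn T A → QuasiDiff T A
  | iUnion : ∀ (S : Set (List α)) (D : List α → Set (ℕ → α)),
      S ⊆ T → (S.Pairwise fun γ δ => ¬ γ <+: δ) →
      (∀ γ ∈ S, QuasiDiff T (D γ)) →
      (∀ γ ∈ S, D γ ⊆ cylinder T γ) →
      QuasiDiff T (⋃ γ ∈ S, D γ)
  | compl : ∀ A, QuasiDiff T A → QuasiDiff T (Body T \ A)

/-- An infinite game in extensive form: a tree `T` of finite plays, an owner function `d`,
an outcome function `v` on infinite plays, and a preference relation for each player. -/
structure Game (α A O : Type*) where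
  T : Set (List α)
  d : List α → A
  v : (ℕ → α) → O
  pref : A → O → O → Prop

/-- The infinite sequence starting with `γ` and continuing with `p`. -/
def listExtend {α : Type*} (γ : List α) (p : ℕ → α) : ℕ → α :=
  fun n => if h : n < γ.length then γ.get ⟨n, h⟩ else p (n - γ.length)

/-- The subgame `g_γ` of `g` at a node `γ`. -/
def Game.sub {α A O : Type*} (g : Game α A O) (γ : List α) : Game α A O where
  T := {δ | γ ++ δ ∈ g.T}
  d := fun δ => g.d (γ ++ δ)
  v := fun p => g.v (listExtend γ p)
  pref := g.pref

/-- A strategy profile on `T`: it maps each node of `T` to a successor. -/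
def IsProfile {α : Type*} (T : Set (List α)) (s : List α → List α) : Prop :=
  ∀ γ ∈ T, s γ ∈ treeSucc T γ

/-- The sequence of nodes obtained from `γ` by repeatedly applying `s`. -/
def iterNode {α : Type*} (s : List α → List α) (γ : List α) : ℕ → List α
  | 0 => γ
  | n + 1 => s (iterNode s γ n)

/-- The play `p^ε(s)` induced by `s` at the root. -/
def inducedPlay {α : Type*} [Inhabited α] (s : List α → List α) : ℕ → α :=
  fun n => (iterNode s [] (n + 1)).getD n default

/-- The subprofile `s_γ`, defined by `γ s_γ(δ) = s(γδ)`. -/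
def subProfile {α : Type*} (γ : List α) (s : List α → List α) : List α → List α :=
  fun δ => (s (γ ++ δ)).drop γ.length

/-- `s` is a Nash equilibrium of `g`: no player `a` has a profitable deviation `s'`
differing from `s` only at nodes owned by `a`. -/
def IsNE {α A O : Type*} [Inhabited α] (g : Game α A O) (s : List α → List α) : Prop :=
  ¬ ∃ (a : A) (s' : List α → List α), IsProfile g.T s' ∧
      (∀ γ ∈ g.T, s γ ≠ s' γ → g.d γ = a) ∧
      g.pref a (g.v (inducedPlay s)) (g.v (inducedPlay s'))

/-- `s` is a subgame perfect equilibrium of `g`: `s_γ` is an NE of `g_γ` for all `γ ∈ T`. -/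
def IsSPE {α A O : Type*} [Inhabited α] (g : Game α A O) (s : List α → List α) : Prop :=
  ∀ γ ∈ g.T, IsNE (g.sub γ) (subProfile γ s)

/-- The outcomes occurring in `g`. -/
def OutcomesOf {α A O : Type*} (g : Game α A O) : Set O := g.v '' Body g.T

/-- `x ∈ Os` is Pareto-optimal in `Os`. -/
def ParetoOpt {A O : Type*} (pref : A → O → O → Prop) (Os : Set O) (x : O) : Prop :=
  x ∈ Os ∧ ∀ y ∈ Os, ∀ a, pref a x y → ∃ b, pref b y x

/-- The outcome induced by the subprofile `s_γ` in the subgame `g_γ`. -/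
def subOutcome {α A O : Type*} [Inhabited α] (g : Game α A O) (s : List α → List α)
    (γ : List α) : O :=
  (g.sub γ).v (inducedPlay (subProfile γ s))

/-- Global-Pareto SPE: an SPE inducing in every subgame an outcome that is
Pareto-optimal among the outcomes occurring in that subgame. -/
def IsGPSPE {α A O : Type*} [Inhabited α] (g : Game α A O) (s : List α → List α) : Prop :=
  IsSPE g s ∧ ∀ γ ∈ g.T, ParetoOpt g.pref (OutcomesOf (g.sub γ)) (subOutcome g s γ)

/-- An `x`-pseudo-leaf: a shortest node `γ ∈ T` such that only `x` occurs in `g_γ`. -/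
def IsPseudoLeaf {α A O : Type*} (g : Game α A O) (x : O) (γ : List α) : Prop :=
  γ ∈ g.T ∧ OutcomesOf (g.sub γ) = {x} ∧
    ∀ δ, δ <+: γ → δ ≠ γ → OutcomesOf (g.sub δ) ≠ {x}

/-- A strict weak order: irreflexive, transitive, with transitive complement. -/
def IsSWO {O : Type*} (r : O → O → Prop) : Prop :=
  (∀ x, ¬ r x x) ∧ (∀ x y z, r x y → r y z → r x z) ∧
  (∀ x y z, ¬ r x y → ¬ r y z → ¬ r x z)

/-- The SPE killer does not occur in the family of preferences `lt`. -/
def NoSPEKiller {A O : Type*} (lt : A → O → O → Prop) : Prop :=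
  ∀ a b : A, ∀ x y z : O, ¬ (lt a z y ∧ lt a y x ∧ lt b x z ∧ lt b z y)

/-- The strict partial order on `O = {x, y, z, α, β, γ} = {0, 1, 2, 3, 4, 5}` generated by
`γ ≺_a y ≺_a x` and `z ≺_a β ≺_a α`. -/
def Ra18 : Fin 6 → Fin 6 → Prop := fun u v =>
  (u = 5 ∧ v = 1) ∨ (u = 1 ∧ v = 0) ∨ (u = 5 ∧ v = 0) ∨
  (u = 2 ∧ v = 4) ∨ (u = 4 ∧ v = 3) ∨ (u = 2 ∧ v = 3)

/-- The strict partial order on `O = {x, y, z, α, β, γ} = {0, 1, 2, 3, 4, 5}` generated by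
`x ≺_b z ≺_b y` and `α ≺_b γ ≺_b β`. -/
def Rb18 : Fin 6 → Fin 6 → Prop := fun u v =>
  (u = 0 ∧ v = 2) ∨ (u = 2 ∧ v = 1) ∨ (u = 0 ∧ v = 1) ∨
  (u = 3 ∧ v = 5) ∨ (u = 5 ∧ v = 4) ∨ (u = 3 ∧ v = 4)


namespace S19
open Classical

universe u

/-- Collapsed outcomes. -/
inductive Oc where
  | X : Oc
  | Y : Bool → Oc
  | Z : Bool → Oc

/-- Arena: a pruned tree with owners and collapsed outcomes. -/
structure Ar (α : Type u) where
  T : Set (List α)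
  d : List α → Bool
  v : (ℕ → α) → Oc
  tree : ∀ h k : List α, h <+: k → k ∈ T → h ∈ T
  prn : ∀ h ∈ T, ∃ x, h ++ [x] ∈ T

variable {α : Type u}

theorem pre_length (p : ℕ → α) (n : ℕ) : (playPrefix p n).length = n := by
  simp [playPrefix]

theorem pre_succ (p : ℕ → α) (n : ℕ) : playPrefix p (n + 1) = playPrefix p n ++ [p n] := by
  unfold playPrefix
  rw [List.ofFn_succ', List.concat_eq_append]
  rfl

theorem pre_prefix (p : ℕ → α) {m n : ℕ} (h : m ≤ n) : playPrefix p m <+: playPrefix p n := by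
  induction n, h using Nat.le_induction with
  | base => exact List.prefix_rfl
  | succ n _ ih => rw [pre_succ]; exact ih.trans (List.prefix_append _ _)

/-- The play `p` passes through the node `h`. -/
def Pass (h : List α) (p : ℕ → α) : Prop := playPrefix p h.length = h

theorem pass_pre (p : ℕ → α) (n : ℕ) : Pass (playPrefix p n) p := by
  simp [Pass, pre_length]

theorem prefix_eq_of_len {a b c : List α} (h1 : a <+: c) (h2 : b <+: c)
    (h : a.length = b.length) : a = b :=
  (List.prefix_of_prefix_length_le h1 h2 h.le).eq_of_length h

theorem Pass.mono {h k : List α} {p : ℕ → α} (hp : Pass h p) (hk : k <+: h) : Pass k p := by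
  have h1 : playPrefix p k.length <+: h := by
    conv_rhs => rw [← hp]
    exact pre_prefix p hk.length_le
  exact prefix_eq_of_len h1 hk (pre_length _ _)

theorem Pass.preOf {h : List α} {p : ℕ → α} (hp : Pass h p) {n : ℕ} (hn : h.length ≤ n) :
    h <+: playPrefix p n := by
  have := pre_prefix p hn
  rwa [hp] at this

theorem Pass.next {h : List α} {p : ℕ → α} (hp : Pass h p) : Pass (h ++ [p h.length]) p := by
  have : playPrefix p (h.length + 1) = h ++ [p h.length] := by rw [pre_succ, hp]
  simpa [Pass] using this

theorem Pass.of_succ {h : List α} {x : α} {p : ℕ → α} (hp : Pass (h ++ [x]) p) :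
    Pass h p ∧ p h.length = x := by
  have h1 : Pass h p := hp.mono (List.prefix_append _ _)
  have h2 : playPrefix p (h.length + 1) = h ++ [x] := by simpa [Pass] using hp
  rw [pre_succ, h1] at h2
  exact ⟨h1, by simpa using h2⟩

/-- Induction along extensions of a node. -/
theorem ext_ind {e : List α} {P : List α → Prop} (h0 : P e)
    (hs : ∀ h x, e <+: h → P h → P (h ++ [x])) : ∀ h, e <+: h → P h := by
  rintro h ⟨l, rfl⟩
  induction l using List.reverseRecOn with
  | nil => simpa using h0
  | append_singleton l x ih =>
    rw [← List.append_assoc]; exact hs _ _ (List.prefix_append _ _) ih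

theorem prefix_succ {e h : List α} {x : α} (hk : e <+: h ++ [x]) : e = h ++ [x] ∨ e <+: h := by
  have := List.prefix_concat_iff (l₁ := e) (l₂ := h) (a := x)
  simpa using this.1 (by simpa using hk)

namespace Ar
variable (G : Ar α)

/-- valid profiles -/
def Val (s : List α → α) : Prop := ∀ h ∈ G.T, h ++ [s h] ∈ G.T

/-- players outside `F` follow `s` from `h` on -/
def Fol (F : Set Bool) (s : List α → α) (h : List α) (p : ℕ → α) : Prop :=
  ∀ n, h.length ≤ n → G.d (playPrefix p n) ∉ F → p n = s (playPrefix p n)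

/-- outcomes reachable from `h` when the players in `F` deviate from `s` -/
def D (F : Set Bool) (s : List α → α) (h : List α) (w : Oc) : Prop :=
  ∃ p, p ∈ Body G.T ∧ Pass h p ∧ G.Fol F s h p ∧ G.v p = w

/-- nodes on the path of a profile -/
def it (s : List α → α) (h : List α) : ℕ → List α
  | 0 => h
  | n + 1 => it s h n ++ [s (it s h n)]

/-- play induced by a profile -/
noncomputable def run (s : List α → α) (h : List α) : ℕ → α := fun n =>
  if hn : n < h.length then h[n] else s (it s h (n - h.length))

theorem pre_run (s : List α → α) (h : List α) (k : ℕ) :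
    playPrefix (run s h) (h.length + k) = it s h k := by
  induction k with
  | zero =>
    apply List.ext_getElem
    · simp [pre_length, it]
    · intro n h1 h2
      have : n < h.length := by simpa [it] using h2
      simp [playPrefix, run, it, this]
  | succ k ih =>
    rw [← add_assoc, pre_succ, ih]
    simp [it, run]

theorem pass_run (s : List α → α) (h : List α) : Pass h (run s h) := by
  exact pre_run s h 0

theorem it_mem {G : Ar α} {s : List α → α} (hs : G.Val s) {h : List α} (hh : h ∈ G.T) (k : ℕ) :
    it s h k ∈ G.T := by
  induction k with
  | zero => exact hh
  | succ k ih => exact hs _ ih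

theorem run_body {G : Ar α} {s : List α → α} (hs : G.Val s) {h : List α} (hh : h ∈ G.T) :
    run s h ∈ Body G.T := by
  intro n
  have := it_mem hs hh n
  rw [← pre_run] at this
  exact G.tree _ _ (pre_prefix _ (by omega)) this

theorem run_fol (F : Set Bool) (s : List α → α) (h : List α) : G.Fol F s h (run s h) := by
  intro n hn _
  obtain ⟨k, rfl⟩ := Nat.exists_eq_add_of_le hn
  rw [pre_run]
  simp [run]

noncomputable def o (s : List α → α) (h : List α) : Oc := G.v (run s h)

theorem run_unique {s : List α → α} {h : List α} {p : ℕ → α} (hp : Pass h p)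
    (hf : G.Fol ∅ s h p) : p = run s h := by
  have key : ∀ k, playPrefix p (h.length + k) = it s h k := by
    intro k
    induction k with
    | zero => exact hp
    | succ k ih =>
      rw [← add_assoc, pre_succ, hf _ (by omega) (by simp), ih]; rfl
  funext n
  have h1 := key (n + 1)
  rw [← pre_run] at h1
  have h2 : playPrefix p (n+1) = playPrefix (run s h) (n+1) := by
    have a1 := pre_prefix p (show n + 1 ≤ h.length + (n+1) by omega)
    have a2 := pre_prefix (run s h) (show n + 1 ≤ h.length + (n+1) by omega)
    rw [h1] at a1
    exact prefix_eq_of_len a1 a2 (by simp [pre_length])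
  rw [pre_succ, pre_succ] at h2
  have := List.append_inj_right' h2 rfl
  simpa using this

variable {G}

theorem D_empty {s : List α → α} (hs : G.Val s) {h : List α} (hh : h ∈ G.T) {w : Oc} :
    G.D ∅ s h w ↔ G.o s h = w := by
  constructor
  · rintro ⟨p, _, hp, hf, rfl⟩
    rw [G.run_unique hp hf]; rfl
  · rintro rfl
    exact ⟨run s h, run_body hs hh, pass_run s h, G.run_fol _ s h, rfl⟩

theorem D_o (F : Set Bool) {s : List α → α} (hs : G.Val s) {h : List α} (hh : h ∈ G.T) :
    G.D F s h (G.o s h) :=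
  ⟨run s h, run_body hs hh, pass_run s h, G.run_fol _ s h, rfl⟩

theorem D_congr {F : Set Bool} {s s' : List α → α} {h : List α}
    (hss : ∀ k, h <+: k → s k = s' k) {w : Oc} (hD : G.D F s h w) : G.D F s' h w := by
  obtain ⟨p, h1, h2, h3, h4⟩ := hD
  exact ⟨p, h1, h2, fun n hn hd => by rw [h3 n hn hd, hss _ (h2.preOf hn)], h4⟩

theorem o_congr {s s' : List α → α} (hs : G.Val s) (hs' : G.Val s') {h : List α} (hh : h ∈ G.T)
    (hss : ∀ k, h <+: k → s k = s' k) : G.o s h = G.o s' h :=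
  ((D_empty hs' hh).1 (D_congr hss ((D_empty hs hh).2 rfl))).symm

theorem D_child {F : Set Bool} {s : List α → α} {h : List α} {x : α} {w : Oc}
    (hx : G.d h ∈ F ∨ x = s h) (hD : G.D F s (h ++ [x]) w) : G.D F s h w := by
  obtain ⟨p, h1, h2, h3, h4⟩ := hD
  obtain ⟨h5, h6⟩ := h2.of_succ
  refine ⟨p, h1, h5, fun n hn hd => ?_, h4⟩
  rcases hn.eq_or_lt with rfl | hn
  · rw [h5] at hd ⊢
    rw [h6]; exact hx.resolve_left hd
  · exact h3 n (by simpa using hn) hd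

theorem D_step {F : Set Bool} {s : List α → α} {h : List α} {w : Oc} (hD : G.D F s h w) :
    ∃ x, h ++ [x] ∈ G.T ∧ (G.d h ∈ F ∨ x = s h) ∧ G.D F s (h ++ [x]) w := by
  obtain ⟨p, h1, h2, h3, h4⟩ := hD
  refine ⟨p h.length, ?_, ?_, p, h1, h2.next, fun n hn hd => h3 n ?_ hd, h4⟩
  · have := h1 (h.length + 1)
    rwa [pre_succ, h2] at this
  · by_cases hd : G.d h ∈ F
    · exact Or.inl hd
    · right
      have := h3 h.length le_rfl
      rw [h2] at this
      exact this hd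
  · simp at hn; omega

theorem D_mem {F : Set Bool} {s : List α → α} {h : List α} {w : Oc} (hD : G.D F s h w) :
    h ∈ G.T := by
  obtain ⟨p, h1, h2, h3, h4⟩ := hD
  rw [← h2]; exact h1 _

theorem o_child {s : List α → α} (hs : G.Val s) {h : List α} (hh : h ∈ G.T) :
    G.o s (h ++ [s h]) = G.o s h := by
  have := (D_empty hs (hs h hh)).2 rfl
  exact ((D_empty hs hh).1 (D_child (Or.inr rfl) this)).symm

/-- A default valid profile. -/
theorem exists_val (G : Ar α) [Nonempty α] : ∃ s, G.Val s := by
  have : ∀ h, ∃ x, h ∈ G.T → h ++ [x] ∈ G.T := by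
    intro h
    by_cases hh : h ∈ G.T
    · obtain ⟨x, hx⟩ := G.prn h hh; exact ⟨x, fun _ => hx⟩
    · exact ⟨Classical.arbitrary α, fun h => absurd h hh⟩
  choose s hs using this
  exact ⟨s, hs⟩

end Ar

end S19

namespace S19
open Classical

universe u
variable {α : Type u}

/-- `c` is reached from `h` by steps satisfying `P`. -/
def Via (P : List α → α → Prop) (h c : List α) : Prop :=
  h <+: c ∧ ∀ k x, h <+: k → k ++ [x] <+: c → P k x

theorem not_snoc_prefix (k : List α) (x : α) : ¬ k ++ [x] <+: k := fun h => by
  have := h.length_le; simp at this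

theorem Via.refl (P : List α → α → Prop) (h : List α) : Via P h h :=
  ⟨List.prefix_rfl, fun k x h1 h2 => absurd (h2.trans h1) (not_snoc_prefix k x)⟩

theorem Via.mono {P Q : List α → α → Prop} {h c : List α} (hv : Via P h c)
    (hpq : ∀ k x, P k x → Q k x) : Via Q h c :=
  ⟨hv.1, fun k x h1 h2 => hpq _ _ (hv.2 k x h1 h2)⟩

theorem Via.snoc {P : List α → α → Prop} {h k : List α} {x : α} (hv : Via P h k) (hx : P k x) :
    Via P h (k ++ [x]) := by
  refine ⟨hv.1.trans (List.prefix_append _ _), fun k' x' h1 h2 => ?_⟩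
  rcases prefix_succ h2 with h3 | h3
  · obtain ⟨rfl, h4⟩ := List.append_inj' h3 rfl
    simp at h4; subst h4; exact hx
  · exact hv.2 _ _ h1 h3

theorem Via.one {P : List α → α → Prop} {k : List α} {x : α} (hx : P k x) :
    Via P k (k ++ [x]) := (Via.refl P k).snoc hx

theorem Via.unsnoc {P : List α → α → Prop} {h k : List α} {x : α} (hv : Via P h (k ++ [x]))
    (hk : h <+: k) : Via P h k ∧ P k x :=
  ⟨⟨hk, fun _ _ h1 h2 => hv.2 _ _ h1 (h2.trans (List.prefix_append _ _))⟩,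
    hv.2 _ _ hk List.prefix_rfl⟩

theorem Via.trans {P : List α → α → Prop} {h k c : List α} (h1 : Via P h k) (h2 : Via P k c) :
    Via P h c := by
  refine ⟨h1.1.trans h2.1, fun l x h3 h4 => ?_⟩
  rcases List.prefix_or_prefix_of_prefix ((List.prefix_append l [x]).trans h4) h2.1 with h5 | h5
  · rcases List.prefix_or_prefix_of_prefix h4 h2.1 with h6 | h6
    · exact h1.2 _ _ h3 h6
    · rcases prefix_succ h6 with h7 | h7
      · subst h7; exact h1.2 _ _ h3 List.prefix_rfl
      · exact h2.2 _ _ h7 h4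
  · exact h2.2 _ _ h5 h4

theorem Via.tail {P : List α → α → Prop} {h k c : List α} (hv : Via P h c) (h1 : h <+: k)
    (h2 : k <+: c) : Via P k c := ⟨h2, fun _ _ h3 h4 => hv.2 _ _ (h1.trans h3) h4⟩

theorem Via.head {P : List α → α → Prop} {h k c : List α} (hv : Via P h c) (h1 : h <+: k)
    (h2 : k <+: c) : Via P h k := ⟨h1, fun _ _ h3 h4 => hv.2 _ _ h3 (h4.trans h2)⟩

theorem prefix_cases {h c : List α} (hv : h <+: c) : h = c ∨ ∃ x, h ++ [x] <+: c := by
  obtain ⟨l, rfl⟩ := hv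
  cases l with
  | nil => left; simp
  | cons x l => right; exact ⟨x, l, by simp⟩

theorem prefix_last {h c : List α} (hv : h <+: c) : h = c ∨ ∃ k x, h <+: k ∧ c = k ++ [x] := by
  obtain ⟨l, rfl⟩ := hv
  rcases List.eq_nil_or_concat l with rfl | ⟨l, x, rfl⟩
  · left; simp
  · right; exact ⟨h ++ l, x, List.prefix_append _ _, by simp⟩

theorem Via.cases {P : List α → α → Prop} {h c : List α} (hv : Via P h c) :
    h = c ∨ ∃ x, P h x ∧ Via P (h ++ [x]) c := by
  rcases prefix_cases hv.1 with h1 | ⟨x, h1⟩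
  · exact Or.inl h1
  · exact Or.inr ⟨x, hv.2 _ _ List.prefix_rfl h1, hv.tail (List.prefix_append _ _) h1⟩

theorem Via.cases_last {P : List α → α → Prop} {h c : List α} (hv : Via P h c) :
    h = c ∨ ∃ k x, c = k ++ [x] ∧ Via P h k ∧ P k x := by
  rcases prefix_last hv.1 with h1 | ⟨k, x, h1, rfl⟩
  · exact Or.inl h1
  · exact Or.inr ⟨k, x, rfl, hv.unsnoc h1⟩

/-- induction along a path, from the start -/
theorem Via.ind {P : List α → α → Prop} {h c : List α} (hv : Via P h c) {Q : List α → Prop}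
    (h0 : Q h) (hs : ∀ k x, h <+: k → k ++ [x] <+: c → Q k → P k x → Q (k ++ [x])) : Q c := by
  have : ∀ k, h <+: k → k <+: c → Q k := by
    apply ext_ind
    · exact fun _ => h0
    · intro k x hk ih hc
      exact hs k x hk hc (ih ((List.prefix_append _ _).trans hc)) (hv.2 _ _ hk hc)
  exact this c hv.1 List.prefix_rfl

/-- `h` extends `e` and everything from `e` to `h` is in `W` -/
def In (W : Set (List α)) (e h : List α) : Prop := e <+: h ∧ ∀ k, e <+: k → k <+: h → k ∈ W

/-- `c` is the first node outside `W` from `e` on -/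
def Exit (W : Set (List α)) (e c : List α) : Prop :=
  e <+: c ∧ c ∉ W ∧ ∀ k, e <+: k → k <+: c → k ≠ c → k ∈ W

theorem In.mem {W : Set (List α)} {e h : List α} (hi : In W e h) : h ∈ W :=
  hi.2 h hi.1 List.prefix_rfl

theorem In.start {W : Set (List α)} {e h : List α} (hi : In W e h) : e ∈ W :=
  hi.2 e List.prefix_rfl hi.1

theorem In.refl {W : Set (List α)} {e : List α} (hi : e ∈ W) : In W e e :=
  ⟨List.prefix_rfl, fun k h1 h2 => by
    have : k = e := (h2.eq_of_length_le h1.length_le)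
    rwa [this]⟩

theorem In.snoc {W : Set (List α)} {e h : List α} {x : α} (hi : In W e h) (hx : h ++ [x] ∈ W) :
    In W e (h ++ [x]) :=
  ⟨hi.1.trans (List.prefix_append _ _), fun k h1 h2 => by
    rcases prefix_succ h2 with rfl | h3
    · exact hx
    · exact hi.2 k h1 h3⟩

theorem In.exit {W : Set (List α)} {e h : List α} {x : α} (hi : In W e h) (hx : h ++ [x] ∉ W) :
    Exit W e (h ++ [x]) :=
  ⟨hi.1.trans (List.prefix_append _ _), hx, fun k h1 h2 h3 => by
    rcases prefix_succ h2 with rfl | h4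
    · exact absurd rfl h3
    · exact hi.2 k h1 h4⟩

theorem Exit.last {W : Set (List α)} {e c : List α} (hc : Exit W e c) (he : e ∈ W) :
    ∃ k x, c = k ++ [x] ∧ In W e k := by
  rcases prefix_last hc.1 with rfl | ⟨k, x, h1, rfl⟩
  · exact absurd he hc.2.1
  · refine ⟨k, x, rfl, h1, fun l h2 h3 => hc.2.2 l h2 (h3.trans (List.prefix_append _ _)) ?_⟩
    rintro rfl; exact not_snoc_prefix _ _ h3

theorem Exit.unique {W : Set (List α)} {e c c' h : List α} (h1 : Exit W e c) (h2 : Exit W e c')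
    (h3 : c <+: h) (h4 : c' <+: h) : c = c' := by
  by_contra hne
  rcases List.prefix_or_prefix_of_prefix h3 h4 with h5 | h5
  · exact h1.2.1 (h2.2.2 c h1.1 h5 hne)
  · exact h2.2.1 (h1.2.2 c' h2.1 h5 (Ne.symm hne))

theorem In.no_exit {W : Set (List α)} {e c h : List α} (hi : In W e h) (h1 : Exit W e c) :
    ¬ c <+: h := fun h2 => h1.2.1 (hi.2 c h1.1 h2)

theorem cover {W : Set (List α)} {e h : List α} (he : e <+: h) :
    In W e h ∨ ∃ c, Exit W e c ∧ c <+: h := by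
  revert h
  apply ext_ind
  · by_cases h : e ∈ W
    · exact Or.inl (In.refl h)
    · exact Or.inr ⟨e, ⟨List.prefix_rfl, h, fun k h1 h2 h3 =>
        absurd (h2.eq_of_length_le h1.length_le) h3⟩, List.prefix_rfl⟩
  · rintro h x he (hi | ⟨c, hc, hch⟩)
    · by_cases hx : h ++ [x] ∈ W
      · exact Or.inl (hi.snoc hx)
      · exact Or.inr ⟨_, hi.exit hx, List.prefix_rfl⟩
    · exact Or.inr ⟨c, hc, hch.trans (List.prefix_append _ _)⟩

/-- Region profile. -/
noncomputable def reg (W : Set (List α)) (e : List α) (g : List α → α)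
    (sol : List α → List α → α) (h : List α) : α :=
  if hc : ∃ c, Exit W e c ∧ c <+: h then sol hc.choose h else g h

theorem reg_exit {W : Set (List α)} {e c h : List α} {g : List α → α}
    {sol : List α → List α → α} (hc : Exit W e c) (hh : c <+: h) :
    reg W e g sol h = sol c h := by
  have hx : ∃ c, Exit W e c ∧ c <+: h := ⟨c, hc, hh⟩
  unfold reg
  rw [dif_pos hx, hx.choose_spec.1.unique hc hx.choose_spec.2 hh]

theorem reg_in {W : Set (List α)} {e h : List α} {g : List α → α}
    {sol : List α → List α → α} (hc : In W e h) : reg W e g sol h = g h := by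
  unfold reg
  rw [dif_neg]
  rintro ⟨c, h1, h2⟩
  exact hc.no_exit h1 h2

namespace Ar
variable {G : Ar α}

theorem reg_val {W : Set (List α)} {e : List α} {g : List α → α}
    {sol : List α → List α → α} (hg : G.Val g) (hsol : ∀ c ∈ G.T, Exit W e c → G.Val (sol c)) :
    G.Val (reg W e g sol) := by
  intro h hh
  unfold reg
  split_ifs with hc
  · exact hsol _ (G.tree _ _ hc.choose_spec.2 hh) hc.choose_spec.1 h hh
  · exact hg h hh

/-- play in `W` from `h` on, where players outside `F` follow `s` -/
def Stay (G : Ar α) (W : Set (List α)) (F : Set Bool) (s : List α → α) (h : List α) (w : Oc) : Prop :=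
  ∃ p, p ∈ Body G.T ∧ Pass h p ∧ G.Fol F s h p ∧ (∀ n, h.length ≤ n → playPrefix p n ∈ W) ∧ G.v p = w

/-- step relation -/
def Stp (G : Ar α) (W : Set (List α)) (F : Set Bool) (s : List α → α) (k : List α) (x : α) : Prop :=
  k ∈ W ∧ k ++ [x] ∈ G.T ∧ (G.d k ∈ F ∨ x = s k)

theorem decomp (W : Set (List α)) {F : Set Bool} {s : List α → α} {h : List α} {w : Oc}
    (hD : G.D F s h w) : G.Stay W F s h w ∨
      ∃ c, c ∈ G.T ∧ c ∉ W ∧ Via (G.Stp W F s) h c ∧ G.D F s c w := by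
  obtain ⟨p, h1, h2, h3, h4⟩ := hD
  by_cases hst : ∀ n, h.length ≤ n → playPrefix p n ∈ W
  · exact Or.inl ⟨p, h1, h2, h3, hst, h4⟩
  · right
    push Not at hst
    obtain ⟨hn1, hn2⟩ := Nat.find_spec hst
    have hmin : ∀ m, h.length ≤ m → m < Nat.find hst → playPrefix p m ∈ W := by
      intro m hm1 hm2
      have := Nat.find_min hst hm2
      push Not at this
      exact this hm1
    generalize Nat.find hst = N at *
    refine ⟨_, h1 N, hn2, ⟨h2.preOf hn1, fun k x hk hx => ?_⟩, p, h1, pass_pre _ _,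
      fun n hn hd => h3 n ?_ hd, h4⟩
    · have hx1 := (pass_pre p N).mono hx
      obtain ⟨hx2, hx3⟩ := hx1.of_succ
      have hkl : k.length < N := by
        have := hx.length_le; simp [pre_length] at this; omega
      refine ⟨?_, ?_, ?_⟩
      · have := hmin k.length hk.length_le hkl
        rwa [hx2] at this
      · rw [← hx1]; exact h1 _
      · by_cases hd : G.d k ∈ F
        · exact Or.inl hd
        · right
          have := h3 k.length hk.length_le
          rw [hx2, hx3] at this
          exact this hd
    · rw [pre_length] at hn; omega

theorem D_iff {F : Set Bool} {s s' : List α → α} {h : List α}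
    (hss : ∀ k, h <+: k → s k = s' k) {w : Oc} : G.D F s h w ↔ G.D F s' h w :=
  ⟨D_congr hss, D_congr fun k hk => (hss k hk).symm⟩

theorem D_via {F : Set Bool} {s : List α → α} {h c : List α} {w : Oc}
    (hv : Via (fun k x => G.d k ∈ F ∨ x = s k) h c) (hD : G.D F s c w) : G.D F s h w := by
  have : ∀ n, ∀ h, h <+: c → c.length - h.length ≤ n →
      Via (fun k x => G.d k ∈ F ∨ x = s k) h c → G.D F s h w := by
    intro n
    induction n with
    | zero =>
      intro h h1 h2 _
      have : h = c := h1.eq_of_length_le (by omega)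
      rwa [this]
    | succ n ih =>
      intro h h1 h2 hv
      rcases hv.cases with rfl | ⟨x, hx, hv⟩
      · exact hD
      · refine D_child hx (ih _ hv.1 ?_ hv)
        simp; omega
  exact this _ h hv.1 le_rfl hv

/-- end nodes available by moving with `mv` -/
def End (G : Ar α) (W : Set (List α)) (mv : List α → α → Prop) (h c : List α) : Prop :=
  c ∈ G.T ∧ c ∉ W ∧ Via (fun k x => k ∈ W ∧ k ++ [x] ∈ G.T ∧ mv k x) h c

theorem End.cons {W : Set (List α)} {mv : List α → α → Prop} {h c : List α} {x : α}
    (hE : G.End W mv (h ++ [x]) c) (h1 : h ∈ W) (h2 : h ++ [x] ∈ G.T) (h3 : mv h x) :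
    G.End W mv h c := ⟨hE.1, hE.2.1, (Via.one (P := fun k x => k ∈ W ∧ k ++ [x] ∈ G.T ∧ mv k x)
      ⟨h1, h2, h3⟩).trans hE.2.2⟩

/-- best end: minimal priority, then minimal length -/
theorem best_end {W : Set (List α)} {mv : List α → α → Prop} (prio : List α → ℕ) {h : List α}
    (hex : ∃ c, G.End W mv h c) :
    ∃ c, G.End W mv h c ∧ ∀ c', G.End W mv h c' →
      prio c < prio c' ∨ (prio c = prio c' ∧ c.length ≤ c'.length) := by
  have hwf := (WellFounded.prod_lex (ra := ((· < ·) : ℕ → ℕ → Prop)) (rb := ((· < ·) : ℕ → ℕ → Prop))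
    wellFounded_lt wellFounded_lt)
  obtain ⟨c, hc, hm⟩ := (InvImage.wf (fun c : List α => (prio c, c.length)) hwf).has_min
    {c | G.End W mv h c} hex
  refine ⟨c, hc, fun c' hc' => ?_⟩
  have := hm c' hc'
  simp only [InvImage, Prod.lex_def] at this
  omega

/-- choice of moves towards best ends -/
theorem choice (W : Set (List α)) (mv : List α → α → Prop) (prio : List α → ℕ)
    (g0 : List α → α) (hg0 : G.Val g0) (hmv : ∀ h ∈ W, h ∈ G.T → mv h (g0 h)) :
    ∃ g, G.Val g ∧ (∀ h ∈ W, h ∈ G.T → mv h (g h)) ∧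
      (∀ h, (¬ ∃ c, G.End W mv h c) → g h = g0 h) ∧
      (∀ h ∈ W, h ∈ G.T → (∃ c, G.End W mv h c) → ∀ p, Pass h p → G.Fol ∅ g h p →
        (∃ n, h.length ≤ n ∧ playPrefix p n ∉ W)) ∧
      (∀ h c, h ∈ W → h ∈ G.T → c ∈ G.T → c ∉ W → Via (G.Stp W ∅ g) h c →
        G.End W mv h c ∧ ∀ c', G.End W mv h c' → prio c ≤ prio c') := by
  have h1 : ∀ h, ∃ c, (∃ c, G.End W mv h c) → (G.End W mv h c ∧ ∀ c', G.End W mv h c' →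
      prio c < prio c' ∨ (prio c = prio c' ∧ c.length ≤ c'.length)) := by
    intro h
    by_cases hex : ∃ c, G.End W mv h c
    · obtain ⟨c, hc⟩ := best_end prio hex
      exact ⟨c, fun _ => hc⟩
    · exact ⟨h, fun h1 => absurd h1 hex⟩
  choose b hb using h1
  have h2 : ∀ h, ∃ x, ((h ∈ W ∧ ∃ c, G.End W mv h c) → (h ++ [x] ∈ G.T ∧ mv h x ∧
      Via (fun k x => k ∈ W ∧ k ++ [x] ∈ G.T ∧ mv k x) (h ++ [x]) (b h))) ∧
      (¬ (h ∈ W ∧ ∃ c, G.End W mv h c) → x = g0 h) := by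
    intro h
    by_cases hex : h ∈ W ∧ ∃ c, G.End W mv h c
    · obtain ⟨h3, h4⟩ := hb h hex.2
      rcases h3.2.2.cases with h5 | ⟨x, h5, h6⟩
      · exact absurd (h5 ▸ hex.1) h3.2.1
      · exact ⟨x, fun _ => ⟨h5.2.1, h5.2.2, h6⟩, fun h => absurd hex h⟩
    · exact ⟨g0 h, fun h => absurd h hex, fun _ => rfl⟩
  choose g hg1 hg2 using h2
  have hval : G.Val g := by
    intro h hh
    by_cases hex : h ∈ W ∧ ∃ c, G.End W mv h c
    · exact (hg1 h hex).1
    · rw [hg2 h hex]; exact hg0 h hh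
  have hgmv : ∀ h ∈ W, h ∈ G.T → mv h (g h) := by
    intro h hh hT
    by_cases hex : h ∈ W ∧ ∃ c, G.End W mv h c
    · exact (hg1 h hex).2.1
    · rw [hg2 h hex]; exact hmv h hh hT
  -- the pair stays constant along the moves
  have hstep : ∀ h, h ∈ W → (∃ c, G.End W mv h c) →
      G.End W mv (h ++ [g h]) (b h) := by
    intro h hW hex
    obtain ⟨a1, a2, a3⟩ := hg1 h ⟨hW, hex⟩
    exact ⟨(hb h hex).1.1, (hb h hex).1.2.1, a3⟩
  have hconst : ∀ h, h ∈ W → (∃ c, G.End W mv h c) → (∃ c, G.End W mv (h ++ [g h]) c) ∧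
      prio (b (h ++ [g h])) = prio (b h) ∧ (b (h ++ [g h])).length = (b h).length := by
    intro h hW hex
    obtain ⟨a1, a2, a3⟩ := hg1 h ⟨hW, hex⟩
    have e1 := hstep h hW hex
    have e2 := (hb _ ⟨_, e1⟩)
    have e3 := e2.2 _ e1
    have e4 := (hb h hex).2 _ (e2.1.cons hW a1 a2)
    refine ⟨⟨_, e1⟩, ?_⟩
    omega
  refine ⟨g, hval, hgmv, fun h hex => hg2 h (fun h => hex h.2), ?_, ?_⟩
  · intro h hW hT hex p hp hf
    by_contra hcon
    push Not at hcon
    have key : ∀ n, (∃ c, G.End W mv (playPrefix p (h.length + n)) c) ∧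
        (b (playPrefix p (h.length + n))).length = (b h).length := by
      intro n
      induction n with
      | zero =>
        have : playPrefix p (h.length + 0) = h := hp
        rw [this]; exact ⟨hex, rfl⟩
      | succ n ih =>
        have hn := hconst _ (hcon (h.length + n) (by omega)) ih.1
        have e : playPrefix p (h.length + (n + 1)) = playPrefix p (h.length + n) ++
            [g (playPrefix p (h.length + n))] := by
          rw [← add_assoc, pre_succ, hf _ (by omega) (by simp)]
        rw [e]
        exact ⟨hn.1, hn.2.2.trans ih.2⟩
    obtain ⟨k1, k2⟩ := key ((b h).length + 1)
    have := (hb _ k1).1.2.2.1.length_le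
    rw [k2, pre_length] at this
    omega
  · intro h c hW hT hcT hcW hv
    have hend : G.End W mv h c := by
      refine ⟨hcT, hcW, hv.1, fun k x hk hx => ?_⟩
      obtain ⟨a1, a2, a3⟩ := hv.2 k x hk hx
      have : x = g k := by simpa using a3
      subst this
      exact ⟨a1, a2, hgmv k a1 (G.tree _ _ (List.prefix_append _ _) a2)⟩
    refine ⟨hend, ?_⟩
    have key : (∃ c', G.End W mv c c') ∧ prio (b c) = prio (b h) := by
      apply hv.ind (Q := fun k => (∃ c', G.End W mv k c') ∧ prio (b k) = prio (b h))
      · exact ⟨⟨c, hend⟩, rfl⟩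
      · intro k x _ _ ih hs
        obtain ⟨a1, a2, a3⟩ := hs
        have : x = g k := by simpa using a3
        subst this
        have := hconst k a1 ih.1
        exact ⟨this.1, this.2.1.trans ih.2⟩
    have hbc : b c = c := by
      rcases (hb c key.1).1.2.2.cases with h5 | ⟨x, h5, h6⟩
      · exact h5.symm
      · exact absurd h5.1 hcW
    intro c' hc'
    have := (hb h ⟨c, hend⟩).2 c' hc'
    rw [hbc] at key
    omega

theorem _root_.S19.In.via_exit {W : Set (List α)} {e h c : List α} (hi : In W e h) (hc : c ∉ W)
    {P : List α → α → Prop} (hP : ∀ k x, P k x → k ∈ W) (hv : Via P h c) : Exit W e c := by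
  have hi' : ∀ k, h <+: k → k <+: c → k ≠ c → k ∈ W := by
    intro k h1 h2 h3
    rcases prefix_cases h2 with h4 | ⟨x, h4⟩
    · exact absurd h4 h3
    · exact hP _ _ (hv.2 _ _ h1 h4)
  refine ⟨hi.1.trans hv.1, hc, fun k h1 h2 h3 => ?_⟩
  rcases List.prefix_or_prefix_of_prefix h2 hv.1 with h4 | h4
  · exact hi.2 k h1 h4
  · exact hi' k h4 h2 h3

theorem _root_.S19.In.via_in {W : Set (List α)} {e h c : List α} (hi : In W e h) (hc : c ∈ W)
    {P : List α → α → Prop} (hP : ∀ k x, P k x → k ∈ W) (hv : Via P h c) : In W e c := by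
  have hi' : ∀ k, h <+: k → k <+: c → k ∈ W := by
    intro k h1 h2
    rcases prefix_cases h2 with h4 | ⟨x, h4⟩
    · exact h4 ▸ hc
    · exact hP _ _ (hv.2 _ _ h1 h4)
  refine ⟨hi.1.trans hv.1, fun k h1 h2 => ?_⟩
  rcases List.prefix_or_prefix_of_prefix h2 hv.1 with h4 | h4
  · exact hi.2 k h1 h4
  · exact hi' k h4 h2

/-- The combined region/choice construction. -/
structure IsRC (G : Ar α) (e : List α) (W : Set (List α)) (mv : List α → α → Prop)
    (prio : List α → ℕ) (g0 : List α → α) (sol : List α → List α → α) (s : List α → α) : Prop where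
  val : G.Val s
  ex : ∀ c k, Exit W e c → c <+: k → s k = sol c k
  mvs : ∀ h, In W e h → h ∈ G.T → mv h (s h)
  dec : ∀ F h w, In W e h → G.D F s h w → G.Stay W F s h w ∨
    ∃ c, c ∈ G.T ∧ Exit W e c ∧ Via (G.Stp W F s) h c ∧ G.D F (sol c) c w
  cho : ∀ h, In W e h → h ∈ G.T → (∃ c, G.End W mv h c) → ∃ c, Exit W e c ∧ G.End W mv h c ∧
    Via (G.Stp W ∅ s) h c ∧ (∀ c', G.End W mv h c' → prio c ≤ prio c') ∧ G.o s h = G.o (sol c) c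
  dflt : ∀ h, In W e h → (¬ ∃ c, G.End W mv h c) → s h = g0 h

theorem RC (e : List α) (W : Set (List α)) (mv : List α → α → Prop)
    (prio : List α → ℕ) (g0 : List α → α) (sol : List α → List α → α)
    (hg0 : G.Val g0) (hmv : ∀ h ∈ W, h ∈ G.T → mv h (g0 h))
    (hsol : ∀ c ∈ G.T, Exit W e c → G.Val (sol c)) :
    ∃ s, IsRC G e W mv prio g0 sol s := by
  obtain ⟨g, g1, g2, g3, g4, g5⟩ := choice W mv prio g0 hg0 hmv
  have hval := reg_val g1 hsol
  have hdec : ∀ F h w, In W e h → G.D F (reg W e g sol) h w → G.Stay W F (reg W e g sol) h w ∨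
    ∃ c, c ∈ G.T ∧ Exit W e c ∧ Via (G.Stp W F (reg W e g sol)) h c ∧ G.D F (sol c) c w := by
    intro F h w hi hD
    rcases decomp W hD with h1 | ⟨c, h1, h2, h3, h4⟩
    · exact Or.inl h1
    · have hex := hi.via_exit h2 (fun k x h => h.1) h3
      exact Or.inr ⟨c, h1, hex, h3, D_congr (fun k hk => reg_exit hex hk) h4⟩
  refine ⟨reg W e g sol, hval, fun c k h1 h2 => reg_exit h1 h2, fun h h1 h2 => ?_, hdec, ?_, ?_⟩
  · rw [reg_in h1]; exact g2 h h1.mem h2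
  · intro h hi hT hend
    rcases hdec ∅ h _ hi ((D_empty hval hT).2 rfl) with ⟨p, p1, p2, p3, p4, _⟩ | ⟨c, c1, c2, c3, c4⟩
    · exfalso
      obtain ⟨n, n1, n2⟩ := g4 h hi.mem hT hend p p2 (fun n hn hd => by
        rw [p3 n hn hd]
        apply reg_in
        refine ⟨hi.1.trans (p2.preOf hn), fun k k1 k2 => ?_⟩
        rcases List.prefix_or_prefix_of_prefix (p2.preOf hn) k2 with k3 | k3
        · have k4 := (pass_pre p n).mono k2
          rw [← k4]; exact p4 _ k3.length_le
        · exact hi.2 k k1 k3)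
      exact n2 (p4 n n1)
    · have hvia : Via (G.Stp W ∅ g) h c := ⟨c3.1, fun k x h1 h2 => by
        obtain ⟨a1, a2, a3⟩ := c3.2 k x h1 h2
        refine ⟨a1, a2, ?_⟩
        have hik : In W e k := by
          refine hi.via_in a1 (P := G.Stp W ∅ (reg W e g sol)) (fun k x h => h.1)
            (c3.head h1 ((List.prefix_append _ _).trans h2))
        rwa [reg_in hik] at a3⟩
      obtain ⟨e1, e2⟩ := g5 h c hi.mem hT c1 c2.2.1 hvia
      refine ⟨c, c2, e1, c3, e2, ?_⟩
      exact ((D_empty (hsol c c1 c2) c1).1 c4).symm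
  · intro h hi hn
    rw [reg_in hi]; exact g3 h hn

/-- one-step gluing -/
theorem graft {e : List α} (he : e ∈ G.T) (x0 : α) (hx0 : e ++ [x0] ∈ G.T)
    (sol : α → List α → α) (hsol : ∀ x, e ++ [x] ∈ G.T → G.Val (sol x)) :
    ∃ s, G.Val s ∧ s e = x0 ∧ (∀ x k, e ++ [x] <+: k → s k = sol x k) ∧
      G.o s e = G.o (sol x0) (e ++ [x0]) ∧
      (∀ F w, G.D F s e w → ∃ x, e ++ [x] ∈ G.T ∧ (G.d e ∈ F ∨ x = x0) ∧
        G.D F (sol x) (e ++ [x]) w) := by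
  have : Nonempty α := ⟨x0⟩
  obtain ⟨gd, hgd⟩ := exists_val G
  let g : List α → α := fun k => if k = e then x0 else gd k
  have hg : G.Val g := by
    intro k hk
    by_cases h : k = e
    · subst h; simpa [g] using hx0
    · simpa [g, h] using hgd k hk
  have hsol' : ∀ c ∈ G.T, Exit {e} e c → ∃ x, c = e ++ [x] := by
    intro c _ hc
    obtain ⟨k, x, rfl, hk⟩ := hc.last rfl
    have : k = e := hk.mem
    subst this
    exact ⟨x, rfl⟩
  have hie : In {e} e e := In.refl (Set.mem_singleton e)
  have hex : ∀ x, Exit {e} e (e ++ [x]) := fun x => hie.exit (by simp)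
  let sol' : List α → List α → α := fun c => sol (c.getLastD x0)
  have hs' : ∀ x, sol' (e ++ [x]) = sol x := by intro x; simp [sol']
  have hval := reg_val (e := e) (W := {e}) (sol := sol') hg (fun c hc h => by
    obtain ⟨x, rfl⟩ := hsol' c hc h
    rw [hs']; exact hsol x hc)
  have hse : reg {e} e g sol' e = x0 := by rw [reg_in hie]; simp [g]
  have hag : ∀ x k, e ++ [x] <+: k → reg {e} e g sol' k = sol x k := by
    intro x k hk
    rw [reg_exit (hex x) hk, hs']
  refine ⟨_, hval, hse, hag, ?_, ?_⟩
  · rw [← o_child hval he, hse]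
    exact o_congr hval (hsol _ hx0) hx0 (hag x0)
  · intro F w hD
    obtain ⟨x, h1, h2, h3⟩ := D_step hD
    rw [hse] at h2
    exact ⟨x, h1, h2, D_congr (hag x) h3⟩

end Ar
end S19

namespace S19
open Classical

universe u
variable {α : Type u}

theorem exists_min {β : Type*} (f : β → ℕ) {P : β → Prop} (h : ∃ x, P x) :
    ∃ x, P x ∧ ∀ y, P y → f x ≤ f y := by
  obtain ⟨x, hx, hm⟩ := (InvImage.wf f wellFounded_lt).has_min {x | P x} h
  exact ⟨x, hx, fun y hy => not_lt.1 (hm y hy)⟩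

/-- priority of outcomes -/
noncomputable def pri (w1 w2 w3 w : Oc) : ℕ :=
  if w = w1 then 0 else if w = w2 then 1 else if w = w3 then 2 else 3

namespace Ar
variable {G : Ar α}

def Cond (G : Ar α) (m : Bool) (s : List α → α) (h : List α) : Prop :=
  (G.o s h ≠ Oc.Y m → ¬ G.D {true} s h (Oc.Y m)) ∧
  (G.o s h ≠ Oc.Y !m → ¬ G.D {false} s h (Oc.Y !m))

/-- local condition at a node -/
def Loc (G : Ar α) (s : List α → α) (h : List α) : Prop :=
  ¬ G.D {true} s h Oc.X ∧ ∀ m, G.o s h = Oc.Z m → G.Cond m s h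

def Sol (G : Ar α) (e : List α) (s : List α → α) : Prop :=
  G.Val s ∧ ∀ h ∈ G.T, e <+: h → G.Loc s h

def K (G : Ar α) (m : Bool) (e : List α) : Prop := ∃ s, G.Sol e s ∧ G.Cond m s e

theorem Cond.congr {m : Bool} {s s' : List α → α} {h : List α} (hc : G.Cond m s h) (hs : G.Val s)
    (hs' : G.Val s') (hh : h ∈ G.T) (hss : ∀ k, h <+: k → s' k = s k) : G.Cond m s' h := by
  unfold Cond
  rw [o_congr hs' hs hh hss, D_iff hss, D_iff hss]
  exact hc

theorem Loc.congr {s s' : List α → α} {h : List α} (hc : G.Loc s h) (hs : G.Val s)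
    (hs' : G.Val s') (hh : h ∈ G.T) (hss : ∀ k, h <+: k → s' k = s k) : G.Loc s' h := by
  refine ⟨fun h => hc.1 ((D_iff hss).1 h), fun m hm => ?_⟩
  rw [o_congr hs' hs hh hss] at hm
  exact (hc.2 m hm).congr hs hs' hh hss

theorem Sol.congr {s s' : List α → α} {h : List α} (hc : G.Sol h s)
    (hs' : G.Val s') (hss : ∀ k, h <+: k → s' k = s k) : G.Sol h s' :=
  ⟨hs', fun k hk hhk => (hc.2 k hk hhk).congr hc.1 hs' hk fun _ hl => hss _ (hhk.trans hl)⟩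

theorem Sol.mono {s : List α → α} {e k : List α} (hc : G.Sol e s) (hk : e <+: k) : G.Sol k s :=
  ⟨hc.1, fun l hl hkl => hc.2 l hl (hk.trans hkl)⟩

theorem Sol.noX {s : List α → α} {e : List α} (hc : G.Sol e s) (he : e ∈ G.T) :
    ¬ G.D {true} s e Oc.X := (hc.2 e he List.prefix_rfl).1

theorem o_ne_X {s : List α → α} {e : List α} (hs : G.Val s) (he : e ∈ G.T)
    (h : ¬ G.D {true} s e Oc.X) : G.o s e ≠ Oc.X := fun h1 => by
  have := D_o {true} hs he
  rw [h1] at this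
  exact h this

theorem Sol.condZ {s : List α → α} {e : List α} (hc : G.Sol e s) (he : e ∈ G.T) {m : Bool}
    (h : G.o s e = Oc.Z m) : G.Cond m s e := (hc.2 e he List.prefix_rfl).2 m h

theorem IsRC.sol {e : List α} {W : Set (List α)} {mv : List α → α → Prop}
    {prio : List α → ℕ} {g0 : List α → α} {sol : List α → List α → α} {s : List α → α}
    (rc : IsRC G e W mv prio g0 sol s) (hsol : ∀ c ∈ G.T, Exit W e c → G.Sol c (sol c))
    (hin : ∀ h ∈ G.T, In W e h → G.Loc s h) : G.Sol e s := by
  refine ⟨rc.val, fun h hh heh => ?_⟩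
  rcases cover (W := W) heh with h1 | ⟨c, h1, h2⟩
  · exact hin h hh h1
  · have := (hsol c (G.tree _ _ h2 hh) h1).congr rc.val fun k hk => rc.ex c k h1 hk
    exact this.2 h hh h2

theorem sol_graft {e : List α} (he : e ∈ G.T) {s : List α → α} (hs : G.Val s)
    {sol : α → List α → α} (hss : ∀ x k, e ++ [x] <+: k → s k = sol x k)
    (hsol : ∀ x, e ++ [x] ∈ G.T → G.Sol (e ++ [x]) (sol x)) (hl : G.Loc s e) : G.Sol e s := by
  refine ⟨hs, fun h hh heh => ?_⟩
  rcases prefix_cases heh with rfl | ⟨x, hx⟩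
  · exact hl
  · exact ((hsol x (G.tree _ _ hx hh)).congr hs (hss x)).2 h hh hx

theorem notnot (m : Bool) : (!(!m)) = m := by cases m <;> rfl

theorem bool_cases (m m' : Bool) : m' = m ∨ m' = !m := by cases m <;> cases m' <;> simp

theorem oneA {m : Bool} {e : List α} (he : e ∈ G.T) (hd : G.d e = true)
    (hK : ∀ x, e ++ [x] ∈ G.T → G.K m (e ++ [x])) : G.K m e := by
  obtain ⟨x1, hx1⟩ := G.prn e he
  have : ∀ x, ∃ σ, e ++ [x] ∈ G.T → (G.Sol (e ++ [x]) σ ∧ G.Cond m σ (e ++ [x])) := by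
    intro x
    by_cases hx : e ++ [x] ∈ G.T
    · obtain ⟨σ, hσ⟩ := hK x hx; exact ⟨σ, fun _ => hσ⟩
    · exact ⟨fun _ => x, fun h => absurd h hx⟩
  choose sol hsol using this
  obtain ⟨x0, hx0, hmin⟩ := exists_min
    (fun x => pri (Oc.Y m) (Oc.Z m) (Oc.Y !m) (G.o (sol x) (e ++ [x])))
    (P := fun x => e ++ [x] ∈ G.T) ⟨x1, hx1⟩
  obtain ⟨s, s1, s2, s3, s4, s5⟩ := graft he x0 hx0 sol (fun x hx => (hsol x hx).1.1)
  have hne : ∀ x, e ++ [x] ∈ G.T → G.o (sol x) (e ++ [x]) ≠ Oc.X := fun x hx =>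
    o_ne_X (hsol x hx).1.1 hx ((hsol x hx).1.noX hx)
  have dA : ∀ w, G.D {true} s e w → ∃ x, e ++ [x] ∈ G.T ∧ G.D {true} (sol x) (e ++ [x]) w := by
    intro w h
    obtain ⟨x, h1, _, h3⟩ := s5 _ _ h
    exact ⟨x, h1, h3⟩
  have dB : ∀ w, G.D {false} s e w → G.D {false} (sol x0) (e ++ [x0]) w := by
    intro w h
    obtain ⟨x, h1, h2, h3⟩ := s5 _ _ h
    rw [hd] at h2
    simp at h2; subst h2; exact h3
  have cA : G.o s e ≠ Oc.Y m → ¬ G.D {true} s e (Oc.Y m) := by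
    intro h1 h2
    obtain ⟨x, hx, h3⟩ := dA _ h2
    refine (hsol x hx).2.1 (fun h4 => ?_) h3
    have := hmin x hx
    rw [s4] at h1
    simp only [pri, h4, if_true] at this
    rw [if_neg h1] at this
    split_ifs at this <;> omega
  have cB : G.o s e ≠ Oc.Y !m → ¬ G.D {false} s e (Oc.Y !m) := by
    intro h1 h2
    rw [s4] at h1
    exact (hsol x0 hx0).2.2 h1 (dB _ h2)
  refine ⟨s, sol_graft he s1 s3 (fun x hx => (hsol x hx).1) ⟨fun h => ?_, fun m' hm' => ?_⟩, cA, cB⟩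
  · obtain ⟨x, hx, h3⟩ := dA _ h
    exact (hsol x hx).1.noX hx h3
  · rcases bool_cases m m' with rfl | rfl
    · exact ⟨cA, cB⟩
    · rw [s4] at hm'
      have hall : ∀ x, e ++ [x] ∈ G.T → G.o (sol x) (e ++ [x]) = Oc.Z !m := by
        intro x hx
        have h1 := hmin x hx
        have h2 := hne x hx
        generalize G.o (sol x) (e ++ [x]) = w at *
        simp only [hm', pri] at h1
        cases w with
        | X => exact absurd rfl h2
        | Y m' => cases m <;> cases m' <;> simp at h1
        | Z m' => cases m <;> cases m' <;> simp at h1 ⊢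
      refine ⟨fun _ h => ?_, fun _ h => ?_⟩
      · obtain ⟨x, hx, h3⟩ := dA _ h
        exact ((hsol x hx).1.condZ hx (hall x hx)).1 (by rw [hall x hx]; simp) h3
      · exact ((hsol x0 hx0).1.condZ hx0 (hall x0 hx0)).2 (by rw [hall x0 hx0]; simp) (dB _ h)

theorem oneB {m : Bool} {e : List α} (he : e ∈ G.T) (hd : G.d e = false)
    (hK : ∀ x, e ++ [x] ∈ G.T → G.K m (e ++ [x])) : G.K m e := by
  obtain ⟨x1, hx1⟩ := G.prn e he
  have : ∀ x, ∃ σ, e ++ [x] ∈ G.T → (G.Sol (e ++ [x]) σ ∧ G.Cond m σ (e ++ [x])) := by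
    intro x
    by_cases hx : e ++ [x] ∈ G.T
    · obtain ⟨σ, hσ⟩ := hK x hx; exact ⟨σ, fun _ => hσ⟩
    · exact ⟨fun _ => x, fun h => absurd h hx⟩
  choose sol hsol using this
  obtain ⟨x0, hx0, hmin⟩ := exists_min
    (fun x => pri (Oc.Y !m) (Oc.Z m) (Oc.Y m) (G.o (sol x) (e ++ [x])))
    (P := fun x => e ++ [x] ∈ G.T) ⟨x1, hx1⟩
  obtain ⟨s, s1, s2, s3, s4, s5⟩ := graft he x0 hx0 sol (fun x hx => (hsol x hx).1.1)
  have hne : ∀ x, e ++ [x] ∈ G.T → G.o (sol x) (e ++ [x]) ≠ Oc.X := fun x hx =>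
    o_ne_X (hsol x hx).1.1 hx ((hsol x hx).1.noX hx)
  have dB : ∀ w, G.D {false} s e w → ∃ x, e ++ [x] ∈ G.T ∧ G.D {false} (sol x) (e ++ [x]) w := by
    intro w h
    obtain ⟨x, h1, _, h3⟩ := s5 _ _ h
    exact ⟨x, h1, h3⟩
  have dA : ∀ w, G.D {true} s e w → G.D {true} (sol x0) (e ++ [x0]) w := by
    intro w h
    obtain ⟨x, h1, h2, h3⟩ := s5 _ _ h
    rw [hd] at h2
    simp at h2; subst h2; exact h3
  have cB : G.o s e ≠ Oc.Y !m → ¬ G.D {false} s e (Oc.Y !m) := by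
    intro h1 h2
    obtain ⟨x, hx, h3⟩ := dB _ h2
    refine (hsol x hx).2.2 (fun h4 => ?_) h3
    have := hmin x hx
    rw [s4] at h1
    simp only [pri, h4, if_true] at this
    rw [if_neg h1] at this
    split_ifs at this <;> omega
  have cA : G.o s e ≠ Oc.Y m → ¬ G.D {true} s e (Oc.Y m) := by
    intro h1 h2
    rw [s4] at h1
    exact (hsol x0 hx0).2.1 h1 (dA _ h2)
  refine ⟨s, sol_graft he s1 s3 (fun x hx => (hsol x hx).1) ⟨fun h => ?_, fun m' hm' => ?_⟩, cA, cB⟩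
  · exact (hsol x0 hx0).1.noX hx0 (dA _ h)
  · rcases bool_cases m m' with rfl | rfl
    · exact ⟨cA, cB⟩
    · rw [s4] at hm'
      have hall : ∀ x, e ++ [x] ∈ G.T → G.o (sol x) (e ++ [x]) = Oc.Z !m := by
        intro x hx
        have h1 := hmin x hx
        have h2 := hne x hx
        generalize G.o (sol x) (e ++ [x]) = w at *
        simp only [hm', pri] at h1
        cases w with
        | X => exact absurd rfl h2
        | Y m' => cases m <;> cases m' <;> simp at h1
        | Z m' => cases m <;> cases m' <;> simp at h1 ⊢
      refine ⟨fun _ h => ?_, fun _ h => ?_⟩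
      · exact ((hsol x0 hx0).1.condZ hx0 (hall x0 hx0)).1 (by rw [hall x0 hx0]; simp) (dA _ h)
      · obtain ⟨x, hx, h3⟩ := dB _ h
        exact ((hsol x hx).1.condZ hx (hall x hx)).2 (by rw [hall x hx]; simp) h3

theorem oneK {m : Bool} {e : List α} (he : e ∈ G.T)
    (hK : ∀ x, e ++ [x] ∈ G.T → G.K m (e ++ [x])) : G.K m e := by
  cases hd : G.d e
  · exact oneB he hd hK
  · exact oneA he hd hK

/-- one step to a child with outcome `Y`. -/
theorem oneY {m i : Bool} {e : List α} (he : e ∈ G.T) (hd : G.d e = i)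
    (hS : ∀ x, e ++ [x] ∈ G.T → ∃ σ, G.Sol (e ++ [x]) σ) {x0 : α} (hx0 : e ++ [x0] ∈ G.T)
    {σ0 : List α → α} (h1 : G.Sol (e ++ [x0]) σ0) (h2 : G.Cond m σ0 (e ++ [x0]))
    (h3 : G.o σ0 (e ++ [x0]) = Oc.Y (if i then m else !m)) : G.K m e := by
  have : ∀ x, ∃ σ, e ++ [x] ∈ G.T → (G.Sol (e ++ [x]) σ ∧ (x = x0 → σ = σ0)) := by
    intro x
    by_cases hx : x = x0
    · subst hx; exact ⟨σ0, fun _ => ⟨h1, fun _ => rfl⟩⟩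
    · by_cases hx' : e ++ [x] ∈ G.T
      · obtain ⟨σ, hσ⟩ := hS x hx'; exact ⟨σ, fun _ => ⟨hσ, fun h => absurd h hx⟩⟩
      · exact ⟨fun _ => x, fun h => absurd h hx'⟩
  choose sol hsol using this
  have h0 : sol x0 = σ0 := (hsol x0 hx0).2 rfl
  obtain ⟨s, s1, s2, s3, s4, s5⟩ := graft he x0 hx0 sol (fun x hx => (hsol x hx).1.1)
  rw [h0, h3] at s4
  refine ⟨s, sol_graft he s1 s3 (fun x hx => (hsol x hx).1)
    ⟨fun h => ?_, fun m' hm' => by rw [s4] at hm'; simp at hm'⟩, fun h h' => ?_, fun h h' => ?_⟩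
  · obtain ⟨x, hx, _, h3⟩ := s5 _ _ h
    exact (hsol x hx).1.noX hx h3
  · obtain ⟨x, hx, hxx, h4⟩ := s5 _ _ h'
    rw [hd] at hxx
    cases i
    · simp at hxx
      subst hxx
      rw [h0] at h4
      exact h2.1 (by rw [h3]; simp) h4
    · rw [s4] at h; simp at h
  · obtain ⟨x, hx, hxx, h4⟩ := s5 _ _ h'
    rw [hd] at hxx
    cases i
    · rw [s4] at h; simp at h
    · simp at hxx
      subst hxx
      rw [h0] at h4
      exact h2.2 (by rw [h3]; simp) h4

end Ar
end S19

namespace S19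
open Classical

universe u
variable {α : Type u}

namespace Ar
variable {G : Ar α}

structure Piece (G : Ar α) (U : Set (List α)) (c : Oc) : Prop where
  sub : U ⊆ G.T
  next : ∀ h ∈ U, ∃ x, h ++ [x] ∈ U
  exK : ∀ h x, h ∈ U → h ++ [x] ∈ G.T → h ++ [x] ∉ U → ∀ m, G.K m (h ++ [x])
  cst : ∀ p ∈ Body G.T, ∀ n, (∀ k, n ≤ k → playPrefix p k ∈ U) → G.v p = c

theorem Piece.stay {U : Set (List α)} {c : Oc} (hp : G.Piece U c) {W : Set (List α)} (hW : W ⊆ U)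
    {F : Set Bool} {s : List α → α} {h : List α} {w : Oc} (hs : G.Stay W F s h w) : w = c := by
  obtain ⟨p, p1, p2, p3, p4, rfl⟩ := hs
  exact hp.cst p p1 h.length fun k hk => hW (p4 k hk)

theorem exists_stay {W : Set (List α)} (hW : W ⊆ G.T) (hn : ∀ h ∈ W, ∃ x, h ++ [x] ∈ W)
    {e : List α} (he : e ∈ W) : ∃ g, G.Val g ∧ ∀ h ∈ W, h ++ [g h] ∈ W := by
  obtain ⟨x, _⟩ := hn e he
  have : Nonempty α := ⟨x⟩
  obtain ⟨g0, hg0⟩ := exists_val G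
  have : ∀ h, ∃ x, (h ∈ W → h ++ [x] ∈ W) ∧ (h ∉ W → x = g0 h) := by
    intro h
    by_cases hh : h ∈ W
    · obtain ⟨x, hx⟩ := hn h hh
      exact ⟨x, fun _ => hx, fun h => absurd hh h⟩
    · exact ⟨g0 h, fun h => absurd h hh, fun _ => rfl⟩
  choose g h1 h2 using this
  refine ⟨g, fun h hh => ?_, h1⟩
  by_cases hW' : h ∈ W
  · exact hW (h1 h hW')
  · rw [h2 h hW']; exact hg0 h hh

theorem Stp.last {W : Set (List α)} {F : Set Bool} {s : List α → α} {e h c : List α}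
    (hi : In W e h) (hc : c ∉ W) (hv : Via (G.Stp W F s) h c) :
    ∃ k x, c = k ++ [x] ∧ In W e k ∧ h <+: k ∧ Via (G.Stp W F s) h k ∧ k ++ [x] ∈ G.T ∧
      (G.d k ∈ F ∨ x = s k) := by
  rcases hv.cases_last with rfl | ⟨k, x, rfl, h1, h2⟩
  · exact absurd hi.mem hc
  · exact ⟨k, x, rfl, hi.via_in h2.1 (fun _ _ h => h.1) h1, h1.1, h1, h2.2.1, h2.2.2⟩

theorem Stp.end_top {W : Set (List α)} {F : Set Bool} {s : List α → α} {h c : List α}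
    (hT : c ∈ G.T) (hc : c ∉ W) (hv : Via (G.Stp W F s) h c) :
    G.End W (fun _ _ => True) h c := ⟨hT, hc, hv.mono fun _ _ h => ⟨h.1, h.2.1, trivial⟩⟩

theorem IsRC.o_stay {e : List α} {W : Set (List α)} {mv : List α → α → Prop}
    {prio : List α → ℕ} {g0 : List α → α} {sol : List α → List α → α} {s : List α → α}
    (rc : IsRC G e W mv prio g0 sol s) {h : List α} (hi : In W e h) (hh : h ∈ G.T)
    (hn : ¬ ∃ c, G.End W mv h c) : G.Stay W ∅ s h (G.o s h) := by
  rcases rc.dec ∅ h _ hi ((D_empty rc.val hh).2 rfl) with h1 | ⟨c, c1, c2, c3, c4⟩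
  · exact h1
  · refine absurd ⟨c, c1, c2.2.1, c3.1, fun k x hk hx => ?_⟩ hn
    obtain ⟨a1, a2, a3⟩ := c3.2 k x hk hx
    have : x = s k := by simpa using a3
    subst this
    refine ⟨a1, a2, rc.mvs k ?_ (G.tree _ _ (List.prefix_append _ _) a2)⟩
    exact hi.via_in a1 (P := G.Stp W ∅ s) (fun _ _ h => h.1)
      (c3.head hk ((List.prefix_append _ _).trans hx))

theorem no_end_stay {W : Set (List α)} {h : List α} (hh : h ∈ W) :
    ¬ ∃ c, G.End W (fun k x => k ++ [x] ∈ W) h c := by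
  rintro ⟨c, c1, c2, c3⟩
  rcases c3.cases_last with rfl | ⟨k, x, rfl, _, h2⟩
  · exact c2 hh
  · exact c2 h2.2.2

theorem exists_labels [Nonempty α] (m : Bool) (G : Ar α) : ∃ L : List α → List α → α, ∀ c,
    G.K m c → G.Sol c (L c) ∧ G.Cond m (L c) c := by
  have : ∀ c, ∃ σ : List α → α, G.K m c → G.Sol c σ ∧ G.Cond m σ c := by
    intro c
    by_cases h : G.K m c
    · obtain ⟨σ, hσ⟩ := h; exact ⟨σ, fun _ => hσ⟩
    · exact ⟨fun _ => Classical.arbitrary α, fun h' => absurd h' h⟩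
  choose L hL using this
  exact ⟨L, hL⟩

theorem Piece.exitK {U : Set (List α)} {c : Oc} (hp : G.Piece U c) {e f : List α} (he : e ∈ U)
    (hf : f ∈ G.T) (hx : Exit U e f) (m : Bool) : G.K m f := by
  obtain ⟨k, x, rfl, hk⟩ := hx.last he
  exact hp.exK k x hk.mem hf hx.2.1 m

theorem Piece.baseY {U : Set (List α)} {m0 : Bool} (hp : G.Piece U (Oc.Y m0)) {e : List α}
    (he : e ∈ U) : ∃ s, G.Sol e s := by
  obtain ⟨x, _⟩ := hp.next e he
  have : Nonempty α := ⟨x⟩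
  obtain ⟨L, hL⟩ := exists_labels true G
  obtain ⟨g0, hg0, hg1⟩ := exists_stay hp.sub hp.next he
  have hsol : ∀ c ∈ G.T, Exit U e c → G.Sol c (L c) := fun c hc hx =>
    (hL c (hp.exitK he hc hx true)).1
  obtain ⟨s, rc⟩ := RC e U (fun k x => k ++ [x] ∈ U) (fun _ => 0) g0 L hg0
    (fun h hh _ => hg1 h hh) (fun c hc hx => (hsol c hc hx).1)
  refine ⟨s, rc.sol hsol fun h hh hi => ?_⟩
  have ho := hp.stay subset_rfl (rc.o_stay hi hh (no_end_stay hi.mem))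
  refine ⟨fun h1 => ?_, fun m hm => by rw [ho] at hm; simp at hm⟩
  rcases rc.dec _ _ _ hi h1 with h2 | ⟨c, c1, c2, c3, c4⟩
  · have := hp.stay subset_rfl h2; simp at this
  · exact (hsol c c1 c2).noX c1 c4

theorem Piece.baseZ {U : Set (List α)} {m0 : Bool} (hp : G.Piece U (Oc.Z m0)) {e : List α}
    (he : e ∈ U) : ∃ s, G.Sol e s := by
  obtain ⟨x, _⟩ := hp.next e he
  have : Nonempty α := ⟨x⟩
  obtain ⟨L, hL⟩ := exists_labels m0 G
  obtain ⟨g0, hg0, hg1⟩ := exists_stay hp.sub hp.next he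
  have hLL : ∀ c ∈ G.T, Exit U e c → G.Sol c (L c) ∧ G.Cond m0 (L c) c := fun c hc hx =>
    hL c (hp.exitK he hc hx m0)
  have hsol : ∀ c ∈ G.T, Exit U e c → G.Sol c (L c) := fun c hc hx => (hLL c hc hx).1
  obtain ⟨s, rc⟩ := RC e U (fun _ _ => True)
    (fun c => match G.o (L c) c with
      | Oc.X => 0 | Oc.Y _ => 0 | Oc.Z m => if m = m0 then 1 else 2) g0 L hg0
    (fun h hh _ => trivial) (fun c hc hx => (hsol c hc hx).1)
  refine ⟨s, rc.sol hsol fun h hh hi => ?_⟩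
  have hnX : ∀ c, Exit U e c → c ∈ G.T → G.o (L c) c ≠ Oc.X := fun c hx hc =>
    o_ne_X (hsol c hc hx).1 hc ((hsol c hc hx).noX hc)
  have hEx : ∀ c, G.End U (fun _ _ => True) h c → Exit U e c := fun c hc =>
    hi.via_exit hc.2.1 (fun _ _ h => h.1) hc.2.2
  refine ⟨fun h1 => ?_, fun m hm => ?_⟩
  · rcases rc.dec _ _ _ hi h1 with h2 | ⟨c, c1, c2, c3, c4⟩
    · have := hp.stay subset_rfl h2; simp at this
    · exact (hsol c c1 c2).noX c1 c4
  · -- all ends are good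
    have key : ∀ c, G.End U (fun _ _ => True) h c →
        G.Cond m (L c) c ∧ ∃ m', G.o (L c) c = Oc.Z m' := by
      intro c hc
      obtain ⟨c0, d1, d2, d3, d4, d5⟩ := rc.cho h hi hh ⟨c, hc⟩
      have h1 := d4 c hc
      rw [← d5, hm] at h1
      have h2 := hnX c (hEx c hc) hc.1
      rcases bool_cases m0 m with rfl | rfl
      · refine ⟨(hLL c hc.1 (hEx c hc)).2, ?_⟩
        cases hw : G.o (L c) c with
        | X => exact absurd hw h2
        | Y m' => rw [hw] at h1; simp at h1
        | Z m' => exact ⟨m', rfl⟩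
      · cases hw : G.o (L c) c with
        | X => exact absurd hw h2
        | Y m' => rw [hw] at h1; simp at h1
        | Z m' =>
          rw [hw] at h1
          have : m' = !m0 := by
            cases m0 <;> cases m' <;> simp at h1 ⊢
          subst this
          exact ⟨(hsol c hc.1 (hEx c hc)).condZ hc.1 hw, _, rfl⟩
    constructor
    · intro _ h1
      rcases rc.dec _ _ _ hi h1 with h2 | ⟨c, c1, c2, c3, c4⟩
      · have := hp.stay subset_rfl h2; simp at this
      · obtain ⟨k1, m', k2⟩ := key c (Stp.end_top c1 c2.2.1 c3)
        exact k1.1 (by rw [k2]; simp) c4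
    · intro _ h1
      rcases rc.dec _ _ _ hi h1 with h2 | ⟨c, c1, c2, c3, c4⟩
      · have := hp.stay subset_rfl h2; simp at this
      · obtain ⟨k1, m', k2⟩ := key c (Stp.end_top c1 c2.2.1 c3)
        exact k1.2 (by rw [k2]; simp) c4

theorem Piece.base {U : Set (List α)} {c : Oc} (hp : G.Piece U c) (hc : c ≠ Oc.X) {e : List α}
    (he : e ∈ U) : ∃ s, G.Sol e s := by
  cases c with
  | X => exact absurd rfl hc
  | Y m => exact hp.baseY he
  | Z m => exact hp.baseZ he

/-- context for the remaining argument about pieces -/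
structure RCtx (G : Ar α) (U : Set (List α)) (c : Oc) (m : Bool) (R : Set (List α))
    (L : List α → List α → α) : Prop where
  hp : G.Piece U c
  sub : R ⊆ U
  notK : ∀ e ∈ R, ¬ G.K m e
  next : ∀ h ∈ R, ∃ x, h ++ [x] ∈ R
  ex : ∀ h x, h ∈ R → h ++ [x] ∈ G.T → h ++ [x] ∉ R →
    G.Sol (h ++ [x]) (L (h ++ [x])) ∧ G.Cond m (L (h ++ [x])) (h ++ [x]) ∧
    (G.d h = true → G.o (L (h ++ [x])) (h ++ [x]) ≠ Oc.Y m) ∧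
    (G.d h = false → G.o (L (h ++ [x])) (h ++ [x]) ≠ Oc.Y !m)

theorem exists_rctx {U : Set (List α)} {c : Oc} (hp : G.Piece U c) (hc : c ≠ Oc.X) (m : Bool)
    [Nonempty α] : ∃ L, G.RCtx U c m {e | e ∈ U ∧ ¬ G.K m e} L := by
  obtain ⟨L, hL⟩ := exists_labels m G
  have hch : ∀ h x, h ∈ U → h ++ [x] ∈ G.T → ∃ σ, G.Sol (h ++ [x]) σ := by
    intro h x h1 h2
    by_cases h3 : h ++ [x] ∈ U
    · exact hp.base hc h3
    · obtain ⟨σ, hσ, _⟩ := hp.exK h x h1 h2 h3 true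
      exact ⟨σ, hσ⟩
  have hk : ∀ h x, h ∈ U → h ++ [x] ∈ G.T → h ++ [x] ∉ {e | e ∈ U ∧ ¬ G.K m e} →
      G.K m (h ++ [x]) := by
    intro h x h1 h2 h3
    by_contra h4
    by_cases h5 : h ++ [x] ∈ U
    · exact h3 ⟨h5, h4⟩
    · exact h4 (hp.exK h x h1 h2 h5 m)
  refine ⟨L, hp, fun e he => he.1, fun e he => he.2, fun h hh => ?_, fun h x hh hT hR => ?_⟩
  · by_contra hcon
    push Not at hcon
    exact hh.2 (oneK (hp.sub hh.1) fun x hx => hk h x hh.1 hx (hcon x))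
  · obtain ⟨l1, l2⟩ := hL _ (hk h x hh.1 hT hR)
    refine ⟨l1, l2, fun hd ho => hh.2 ?_, fun hd ho => hh.2 ?_⟩
    · exact oneY (hp.sub hh.1) hd (fun x hx => hch h x hh.1 hx) hT l1 l2 (by simpa using ho)
    · exact oneY (hp.sub hh.1) hd (fun x hx => hch h x hh.1 hx) hT l1 l2 (by simpa using ho)

namespace RCtx
variable {U R : Set (List α)} {c : Oc} {m : Bool} {L : List α → List α → α}

theorem exL (cx : G.RCtx U c m R L) {e f : List α} (he : e ∈ R) (hf : f ∈ G.T) (hx : Exit R e f) :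
    G.Sol f (L f) ∧ G.Cond m (L f) f := by
  obtain ⟨k, x, rfl, hk⟩ := hx.last he
  have := cx.ex k x hk.mem hf hx.2.1
  exact ⟨this.1, this.2.1⟩

/-- staying in the region -/
theorem stayA (cx : G.RCtx U c m R L) (hcX : c ≠ Oc.X) {e : List α} (he : e ∈ R) :
    ∃ s, G.Val s ∧ (∀ f k, Exit R e f → f <+: k → s k = L f k) ∧
      (∀ h ∈ G.T, In R e h → G.o s h = c ∧ ¬ G.D {true} s h Oc.X ∧ G.Cond m s h ∧
      ∀ F w, G.D F s h w → w = c ∨ ∃ f, f ∈ G.T ∧ Exit R e f ∧ G.End R (fun _ _ => True) h f ∧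
        G.D F (L f) f w) := by
  obtain ⟨g0, hg0, hg1⟩ := exists_stay (cx.sub.trans cx.hp.sub) cx.next he
  obtain ⟨s, rc⟩ := RC e R (fun k x => k ++ [x] ∈ R) (fun _ => 0) g0 L hg0
    (fun h hh _ => hg1 h hh) (fun f hf hx => (cx.exL he hf hx).1.1)
  refine ⟨s, rc.val, rc.ex, fun h hh hi => ?_⟩
  have ho := cx.hp.stay cx.sub (rc.o_stay hi hh (no_end_stay hi.mem))
  have hD : ∀ F w, G.D F s h w → w = c ∨ ∃ f, f ∈ G.T ∧ Exit R e f ∧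
        G.End R (fun _ _ => True) h f ∧ (∃ k x, f = k ++ [x] ∧ k ∈ R ∧ G.d k ∈ F) ∧
        G.D F (L f) f w := by
    intro F w h1
    rcases rc.dec _ _ _ hi h1 with h2 | ⟨f, c1, c2, c3, c4⟩
    · exact Or.inl (cx.hp.stay cx.sub h2)
    · refine Or.inr ⟨f, c1, c2, Stp.end_top c1 c2.2.1 c3, ?_, c4⟩
      obtain ⟨k, x, rfl, k1, k2, k3, k4, k5⟩ := Stp.last hi c2.2.1 c3
      refine ⟨k, x, rfl, k1.mem, ?_⟩
      rcases k5 with k5 | k5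
      · exact k5
      · subst k5
        exact absurd (rc.mvs k k1 (cx.hp.sub (cx.sub k1.mem))) c2.2.1
  refine ⟨ho, fun h1 => ?_, ⟨fun h1 h2 => ?_, fun h1 h2 => ?_⟩, fun F w h1 => ?_⟩
  · rcases hD _ _ h1 with h2 | ⟨f, c1, c2, c3, c4, c5⟩
    · exact hcX h2.symm
    · exact (cx.exL he c1 c2).1.noX c1 c5
  · rcases hD _ _ h2 with h3 | ⟨f, c1, c2, c3, ⟨k, x, rfl, c5, c6⟩, c7⟩
    · exact h1 (ho.trans h3.symm)
    · have := cx.ex k x c5 c1 c2.2.1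
      exact this.2.1.1 (this.2.2.1 (by simpa using c6)) c7
  · rcases hD _ _ h2 with h3 | ⟨f, c1, c2, c3, ⟨k, x, rfl, c5, c6⟩, c7⟩
    · exact h1 (ho.trans h3.symm)
    · have := cx.ex k x c5 c1 c2.2.1
      exact this.2.1.2 (this.2.2.2 (by simpa using c6)) c7
  · rcases hD _ _ h1 with h3 | ⟨f, c1, c2, c3, _, c7⟩
    · exact Or.inl h3
    · exact Or.inr ⟨f, c1, c2, c3, c7⟩

theorem glue (cx : G.RCtx U c m R L) {e : List α} (he : e ∈ R) {s : List α → α} (hs : G.Val s)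
    (hss : ∀ f k, Exit R e f → f <+: k → s k = L f k)
    (hl : ∀ h ∈ G.T, In R e h → G.Loc s h) (hc : G.Cond m s e) : False := by
  refine cx.notK e he ⟨s, ⟨hs, fun h hh heh => ?_⟩, hc⟩
  rcases cover (W := R) heh with h1 | ⟨f, h1, h2⟩
  · exact hl h hh h1
  · exact (((cx.exL he (G.tree _ _ h2 hh) h1).1).congr hs fun k hk => hss f k h1 hk).2 h hh h2

theorem easy (cx : G.RCtx U c m R L) (hcX : c ≠ Oc.X) (hcZ : c ≠ Oc.Z !m) {e : List α}
    (he : e ∈ R) : False := by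
  obtain ⟨s, s1, s2, s3⟩ := cx.stayA hcX he
  refine cx.glue he s1 s2 (fun h hh hi => ?_) (s3 e (cx.hp.sub (cx.sub he)) (In.refl he)).2.2.1
  obtain ⟨a1, a2, a3, _⟩ := s3 h hh hi
  refine ⟨a2, fun m' hm' => ?_⟩
  rcases bool_cases m m' with rfl | rfl
  · exact a3
  · exact absurd (a1.symm.trans hm') hcZ

/-- no end labelled `w` is reachable -/
def NE (G : Ar α) (R : Set (List α)) (L : List α → List α → α) (e : List α) (w : Oc) : Prop :=
  ∀ h, In R e h → ∀ f, G.End R (fun _ _ => True) h f → G.o (L f) f ≠ w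

theorem In.trans {W : Set (List α)} {e h k : List α} (h1 : In W e h) (h2 : In W h k) : In W e k :=
  ⟨h1.1.trans h2.1, fun l h3 h4 => by
    rcases List.prefix_or_prefix_of_prefix h4 h2.1 with h5 | h5
    · exact h1.2 l h3 h5
    · exact h2.2 l h5 h4⟩

theorem NE.mono {e e1 : List α} {w : Oc} (h : NE G R L e w) (hi : In R e e1) : NE G R L e1 w :=
  fun k hk f hf => h k (In.trans hi hk) f hf

theorem exists_NE (cx : G.RCtx U c m R L) {e : List α} {w : Oc}
    (h : ¬ ∀ h, In R e h → ∃ f, G.End R (fun _ _ => True) h f ∧ G.o (L f) f = w) :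
    ∃ e1, In R e e1 ∧ NE G R L e1 w := by
  push Not at h
  obtain ⟨e1, h1, h2⟩ := h
  refine ⟨e1, h1, fun k hk f hf => h2 f ⟨hf.1, hf.2.1, Via.trans ⟨hk.1, fun l x l1 l2 => ?_⟩ hf.2.2⟩⟩
  exact ⟨hk.2 l l1 ((List.prefix_append _ _).trans l2), 
    G.tree _ _ l2 (cx.hp.sub (cx.sub hk.mem)), trivial⟩

/-- driving towards ends labelled `w` -/
theorem driveA (cx : G.RCtx U c m R L) (hcX : c ≠ Oc.X) {e : List α} (he : e ∈ R) {w : Oc}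
    (hA : ∀ h, In R e h → ∃ f, G.End R (fun _ _ => True) h f ∧ G.o (L f) f = w) :
    ∃ s, G.Val s ∧ (∀ f k, Exit R e f → f <+: k → s k = L f k) ∧
      (∀ h ∈ G.T, In R e h → G.o s h = w ∧ ¬ G.D {true} s h Oc.X ∧
      ∀ F w', G.D F s h w' → w' = c ∨ ∃ k x, k ++ [x] ∈ G.T ∧ k ∈ R ∧ k ++ [x] ∉ R ∧
        Exit R e (k ++ [x]) ∧ G.End R (fun _ _ => True) h (k ++ [x]) ∧
        (G.d k ∈ F ∨ G.o (L (k ++ [x])) (k ++ [x]) = w) ∧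
        G.D F (L (k ++ [x])) (k ++ [x]) w') := by
  obtain ⟨g0, hg0, hg1⟩ := exists_stay (cx.sub.trans cx.hp.sub) cx.next he
  obtain ⟨s, rc⟩ := RC e R (fun _ _ => True) (fun f => if G.o (L f) f = w then 0 else 1) g0 L hg0
    (fun h hh _ => trivial) (fun f hf hx => (cx.exL he hf hx).1.1)
  have ho : ∀ h ∈ G.T, In R e h → G.o s h = w := by
    intro h hh hi
    obtain ⟨f0, f1, f2⟩ := hA h hi
    obtain ⟨f, d1, d2, d3, d4, d5⟩ := rc.cho h hi hh ⟨f0, f1⟩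
    have := d4 f0 f1
    rw [if_pos f2] at this
    rw [d5]
    by_contra hne
    rw [if_neg hne] at this
    omega
  refine ⟨s, rc.val, rc.ex, fun h hh hi => ⟨ho h hh hi, ?_⟩⟩
  have hD : ∀ F w', G.D F s h w' → w' = c ∨ ∃ k x, k ++ [x] ∈ G.T ∧ k ∈ R ∧ k ++ [x] ∉ R ∧
        Exit R e (k ++ [x]) ∧ G.End R (fun _ _ => True) h (k ++ [x]) ∧
        (G.d k ∈ F ∨ G.o (L (k ++ [x])) (k ++ [x]) = w) ∧
        G.D F (L (k ++ [x])) (k ++ [x]) w' := by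
    intro F w' h1
    rcases rc.dec _ _ _ hi h1 with h2 | ⟨f, c1, c2, c3, c4⟩
    · exact Or.inl (cx.hp.stay cx.sub h2)
    · obtain ⟨k, x, rfl, k1, k2, k3, k4, k5⟩ := Stp.last hi c2.2.1 c3
      refine Or.inr ⟨k, x, c1, k1.mem, c2.2.1, c2, Stp.end_top c1 c2.2.1 c3, ?_, c4⟩
      rcases k5 with k5 | k5
      · exact Or.inl k5
      · right
        have hkT := cx.hp.sub (cx.sub k1.mem)
        rw [← ho k hkT k1, ← o_child rc.val hkT, ← k5]
        exact (o_congr rc.val (cx.exL he c1 c2).1.1 c1 fun l hl => rc.ex _ l c2 hl).symm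
  refine ⟨fun h1 => ?_, hD⟩
  rcases hD _ _ h1 with h2 | ⟨k, x, c1, c2, c3, c4, c5, c6, c7⟩
  · exact hcX h2.symm
  · exact (cx.exL he c1 c4).1.noX c1 c7

theorem hard (cx : G.RCtx U (Oc.Z !m) m R L) {e : List α} (he : e ∈ R) : False := by
  have hcX : (Oc.Z !m) ≠ Oc.X := by simp
  -- step 1
  obtain ⟨e1, i1, n1⟩ : ∃ e1, In R e e1 ∧ NE G R L e1 (Oc.Y m) := by
    apply cx.exists_NE
    intro hA
    obtain ⟨s, s1, s2, s3⟩ := cx.driveA hcX he hA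
    refine cx.glue he s1 s2 (fun h hh hi => ?_) ?_
    · obtain ⟨a1, a2, a3⟩ := s3 h hh hi
      exact ⟨a2, fun m' hm' => by rw [a1] at hm'; simp at hm'⟩
    · obtain ⟨a1, a2, a3⟩ := s3 e (cx.hp.sub (cx.sub he)) (In.refl he)
      refine ⟨fun h => absurd a1 h, fun _ h => ?_⟩
      rcases a3 _ _ h with h2 | ⟨k, x, c1, c2, c3, c4, c5, c6, c7⟩
      · simp at h2
      · have := cx.ex k x c2 c1 c3
        refine this.2.1.2 ?_ c7
        rcases c6 with c6 | c6
        · exact this.2.2.2 (by simpa using c6)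
        · rw [c6]; simp
  -- step 2
  obtain ⟨e2, i2, n2⟩ : ∃ e2, In R e1 e2 ∧ NE G R L e2 (Oc.Y !m) := by
    have he := i1.mem
    apply cx.exists_NE
    intro hA
    obtain ⟨s, s1, s2, s3⟩ := cx.driveA hcX he hA
    refine cx.glue he s1 s2 (fun h hh hi => ?_) ?_
    · obtain ⟨a1, a2, a3⟩ := s3 h hh hi
      exact ⟨a2, fun m' hm' => by rw [a1] at hm'; simp at hm'⟩
    · obtain ⟨a1, a2, a3⟩ := s3 e1 (cx.hp.sub (cx.sub he)) (In.refl he)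
      refine ⟨fun _ h => ?_, fun h => absurd a1 h⟩
      rcases a3 _ _ h with h2 | ⟨k, x, c1, c2, c3, c4, c5, c6, c7⟩
      · simp at h2
      · have := cx.ex k x c2 c1 c3
        exact this.2.1.1 (n1 _ (In.refl he) _ c5) c7
  replace n1 := NE.mono n1 i2
  -- step 3
  obtain ⟨e3, i3, n3⟩ : ∃ e3, In R e2 e3 ∧ NE G R L e3 (Oc.Z m) := by
    have he := i2.mem
    apply cx.exists_NE
    intro hA
    obtain ⟨s, s1, s2, s3⟩ := cx.driveA hcX he hA
    have hcond : ∀ h ∈ G.T, In R e2 h → G.Cond m s h := by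
      intro h hh hi
      obtain ⟨a1, a2, a3⟩ := s3 h hh hi
      refine ⟨fun _ h => ?_, fun _ h => ?_⟩
      · rcases a3 _ _ h with h2 | ⟨k, x, c1, c2, c3, c4, c5, c6, c7⟩
        · simp at h2
        · exact (cx.ex k x c2 c1 c3).2.1.1 (n1 _ hi _ c5) c7
      · rcases a3 _ _ h with h2 | ⟨k, x, c1, c2, c3, c4, c5, c6, c7⟩
        · simp at h2
        · exact (cx.ex k x c2 c1 c3).2.1.2 (n2 _ hi _ c5) c7
    refine cx.glue he s1 s2 (fun h hh hi => ?_) (hcond _ (cx.hp.sub (cx.sub he)) (In.refl he))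
    obtain ⟨a1, a2, a3⟩ := s3 h hh hi
    refine ⟨a2, fun m' hm' => ?_⟩
    rw [a1] at hm'
    simp at hm'
    subst hm'
    exact hcond h hh hi
  replace n1 := NE.mono n1 i3
  replace n2 := NE.mono n2 i3
  have he := i3.mem
  obtain ⟨s, s1, s2, s3⟩ := cx.stayA hcX he
  refine cx.glue he s1 s2 (fun h hh hi => ?_) (s3 e3 (cx.hp.sub (cx.sub he)) (In.refl he)).2.2.1
  obtain ⟨a1, a2, a3, a4⟩ := s3 h hh hi
  refine ⟨a2, fun m' hm' => ?_⟩
  rw [a1] at hm'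
  have hmm : m' = !m := by injection hm' with h5; exact h5.symm
  subst hmm
  have hZ : ∀ f ∈ G.T, Exit R e3 f → G.End R (fun _ _ => True) h f → G.o (L f) f = Oc.Z !m := by
    intro f f1 f2 f3
    have b1 := n1 h hi f f3
    have b2 := n2 h hi f f3
    have b3 := n3 h hi f f3
    have b4 := o_ne_X (cx.exL he f1 f2).1.1 f1 ((cx.exL he f1 f2).1.noX f1)
    generalize G.o (L f) f = w at *
    cases w with
    | X => exact absurd rfl b4
    | Y m' => cases m <;> cases m' <;> simp at b1 b2
    | Z m' => cases m <;> cases m' <;> simp at b3 ⊢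
  refine ⟨fun _ h1 => ?_, fun _ h1 => ?_⟩
  · rcases a4 _ _ h1 with h2 | ⟨f, f1, f2, f3, f4⟩
    · simp at h2
    · have hz := hZ f f1 f2 f3
      exact ((cx.exL he f1 f2).1.condZ f1 hz).1 (by rw [hz]; simp) f4
  · rcases a4 _ _ h1 with h2 | ⟨f, f1, f2, f3, f4⟩
    · simp at h2
    · have hz := hZ f f1 f2 f3
      exact ((cx.exL he f1 f2).1.condZ f1 hz).2 (by rw [hz]; simp) f4

end RCtx

theorem Piece.allK {U : Set (List α)} {c : Oc} (hp : G.Piece U c) (hc : c ≠ Oc.X) {e : List α}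
    (he : e ∈ U) (m : Bool) : G.K m e := by
  by_contra hK
  obtain ⟨x, _⟩ := hp.next e he
  have : Nonempty α := ⟨x⟩
  obtain ⟨L, cx⟩ := exists_rctx hp hc m
  by_cases hz : c = Oc.Z !m
  · subst hz
    exact cx.hard (e := e) ⟨he, hK⟩
  · exact cx.easy hc hz (e := e) ⟨he, hK⟩

end Ar
end S19

namespace S19
open Classical

universe u
variable {α : Type u}

namespace Ar
variable {G : Ar α}

/-- a solution without any `Y` reachable by deviations -/
def Pure (G : Ar α) (f : List α) (σ : List α → α) : Prop :=
  G.Sol f σ ∧ (∃ m, G.o σ f = Oc.Z m) ∧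
    ∀ m, ¬ G.D {true} σ f (Oc.Y m) ∧ ¬ G.D {false} σ f (Oc.Y m)

/-- first nodes outside `U` -/
def Xit (G : Ar α) (U : Set (List α)) (f : List α) : Prop :=
  f ∈ G.T ∧ f ∉ U ∧ ∃ h x, f = h ++ [x] ∧ h ∈ U

structure XCtx (G : Ar α) (U : Set (List α)) (τ : List α → α)
    (L : Bool → List α → List α → α) : Prop where
  hp : G.Piece U Oc.X
  cvx : ∀ e h k, e ∈ U → k ∈ U → e <+: h → h <+: k → h ∈ U
  tv : G.Val τ
  tX : ∀ h ∈ G.T, ¬ G.D {true} τ h Oc.X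
  lv : ∀ m f, G.Val (L m f)
  lx : ∀ m f, G.Xit U f → G.Sol f (L m f) ∧ G.Cond m (L m f) f
  lp : ∀ m f, G.Xit U f → G.o (L m f) f = Oc.Z (!m) → G.Pure f (L m f) ∧ L (!m) f = L m f
  nopure : ∀ e ∈ U, ∃ f ∈ G.T, Exit U e f ∧ ¬ ∃ σ, G.Pure f σ

def RS (G : Ar α) (U : Set (List α)) (L : Bool → List α → List α → α) (m : Bool)
    (S : Set (List α)) : Prop :=
  S ⊆ U ∧ (∀ h ∈ S, G.d h = false → ∀ x, h ++ [x] ∈ G.T → (h ++ [x] ∈ U → h ++ [x] ∈ S) ∧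
    (h ++ [x] ∉ U → G.o (L m (h ++ [x])) (h ++ [x]) ≠ Oc.Y !m)) ∧
  ∀ h ∈ S, ∃ f ∈ G.T, f ∉ U ∧ Via (fun k x => k ∈ S ∧ k ++ [x] ∈ G.T) h f ∧
    (G.o (L m f) f = Oc.Y m ∨ G.o (L m f) f = Oc.Z m)

def Rm (G : Ar α) (U : Set (List α)) (L : Bool → List α → List α → α) (m : Bool) :
    Set (List α) := {h | ∃ S, G.RS U L m S ∧ h ∈ S}

theorem Rm_RS (G : Ar α) (U : Set (List α)) (L : Bool → List α → List α → α) (m : Bool) :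
    G.RS U L m (G.Rm U L m) := by
  refine ⟨fun h ⟨S, hS, hh⟩ => hS.1 hh, fun h ⟨S, hS, hh⟩ hd x hx => ⟨fun hU => ?_, fun hU => ?_⟩,
    fun h ⟨S, hS, hh⟩ => ?_⟩
  · exact ⟨S, hS, (hS.2.1 h hh hd x hx).1 hU⟩
  · exact (hS.2.1 h hh hd x hx).2 hU
  · obtain ⟨f, f1, f2, f3, f4⟩ := hS.2.2 h hh
    exact ⟨f, f1, f2, f3.mono fun k x hk => ⟨⟨S, hS, hk.1⟩, hk.2⟩, f4⟩

/-- condition of a plan at a node of the piece -/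
def Pnode (G : Ar α) (U : Set (List α)) (L : Bool → List α → List α → α) (σ : List α → α)
    (h : List α) : Prop :=
  ¬ G.D {true} σ h Oc.X ∧
    ∀ m, G.o σ h = Oc.Z m → h ∈ G.Rm U L m ∧ ¬ G.D {true} σ h (Oc.Y m)

/-- steps where the second player follows -/
def Ast (G : Ar α) (σ : List α → α) (k : List α) (x : α) : Prop := G.d k = true ∨ x = σ k

def Plan (G : Ar α) (U : Set (List α)) (L : Bool → List α → List α → α) (e : List α)
    (σ : List α → α) : Prop :=
  G.Val σ ∧ ∀ h ∈ G.T, Via (G.Ast σ) e h → (h ∈ U → G.Pnode U L σ h) ∧ (h ∉ U → G.Sol h σ)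

def NA (G : Ar α) (U : Set (List α)) (L : Bool → List α → List α → α) (m : Bool) (e : List α)
    (σ : List α → α) : Prop := G.Plan U L e σ ∧ ¬ G.D {true} σ e (Oc.Y m)

def Eh (G : Ar α) (U : Set (List α)) (L : Bool → List α → List α → α) (m : Bool) :
    Set (List α) := {e | e ∈ U ∧ ∃ σ, G.NA U L m e σ ∧ G.o σ e = Oc.Y !m}

variable {U : Set (List α)} {L : Bool → List α → List α → α} {τ : List α → α}

theorem Pnode.congr {s s' : List α → α} {h : List α} (hc : G.Pnode U L s h) (hs : G.Val s)
    (hs' : G.Val s') (hh : h ∈ G.T) (hss : ∀ k, h <+: k → s' k = s k) : G.Pnode U L s' h := by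
  refine ⟨fun h => hc.1 ((D_iff hss).1 h), fun m hm => ?_⟩
  rw [o_congr hs' hs hh hss] at hm
  exact ⟨(hc.2 m hm).1, fun h => (hc.2 m hm).2 ((D_iff hss).1 h)⟩

theorem Plan.congr {s s' : List α → α} {h : List α} (hc : G.Plan U L h s)
    (hs' : G.Val s') (hss : ∀ k, h <+: k → s' k = s k) : G.Plan U L h s' := by
  refine ⟨hs', fun k hk hv => ?_⟩
  have hv' : Via (G.Ast s) h k := ⟨hv.1, fun l x h1 h2 => by
    have := hv.2 l x h1 h2
    unfold Ast at this ⊢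
    rwa [hss l h1] at this⟩
  obtain ⟨h1, h2⟩ := hc.2 k hk hv'
  exact ⟨fun h => (h1 h).congr hc.1 hs' hk fun l hl => hss l (hv.1.trans hl),
    fun h => (h2 h).congr hs' fun l hl => hss l (hv.1.trans hl)⟩

theorem Plan.tail {s : List α → α} {h k : List α} (hc : G.Plan U L h s)
    (hv : Via (G.Ast s) h k) : G.Plan U L k s :=
  ⟨hc.1, fun l hl hv' => hc.2 l hl (hv.trans hv')⟩

theorem Plan.noX {s : List α → α} {h : List α} (hc : G.Plan U L h s) (hh : h ∈ G.T) :
    ¬ G.D {true} s h Oc.X := by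
  obtain ⟨h1, h2⟩ := hc.2 h hh (Via.refl _ _)
  by_cases hU : h ∈ U
  · exact (h1 hU).1
  · exact (h2 hU).noX hh

theorem XCtx.xit_below (cx : G.XCtx U τ L) {f : List α} (hf : G.Xit U f) {k : List α}
    (hk : f <+: k) : k ∉ U := by
  obtain ⟨h1, h2, h, x, rfl, h3⟩ := hf
  exact fun hU => h2 (cx.cvx h _ k h3 hU (List.prefix_append _ _) hk)

theorem XCtx.plan_xit (cx : G.XCtx U τ L) {f : List α} (hf : G.Xit U f) {σ : List α → α}
    (hs : G.Sol f σ) : G.Plan U L f σ :=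
  ⟨hs.1, fun _ _ hv => ⟨fun hU => absurd hU (cx.xit_below hf hv.1), fun _ => hs.mono hv.1⟩⟩

theorem XCtx.planL (cx : G.XCtx U τ L) {f : List α} (hf : G.Xit U f) (m : Bool) :
    G.Plan U L f (L m f) := cx.plan_xit hf (cx.lx m f hf).1

theorem XCtx.NAL (cx : G.XCtx U τ L) {f : List α} (hf : G.Xit U f) {m : Bool}
    (h : G.o (L m f) f ≠ Oc.Y m) : G.NA U L m f (L m f) :=
  ⟨cx.planL hf m, (cx.lx m f hf).2.1 h⟩

theorem XCtx.lcases (cx : G.XCtx U τ L) {f : List α} (hf : G.Xit U f) (m : Bool) :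
    G.o (L m f) f = Oc.Y m ∨ G.o (L m f) f = Oc.Y (!m) ∨ G.o (L m f) f = Oc.Z m ∨
      G.o (L m f) f = Oc.Z (!m) := by
  have := o_ne_X (cx.lv m f) hf.1 ((cx.lx m f hf).1.noX hf.1)
  generalize G.o (L m f) f = w at *
  cases w with
  | X => exact absurd rfl this
  | Y m' => cases m <;> cases m' <;> simp
  | Z m' => cases m <;> cases m' <;> simp

/-- plan from the region construction -/
theorem IsRC.plan {e : List α} {W : Set (List α)} {mv : List α → α → Prop}
    {prio : List α → ℕ} {g0 : List α → α} {sol : List α → List α → α} {s : List α → α}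
    (rc : IsRC G e W mv prio g0 sol s) (hW : W ⊆ U)
    (hsol : ∀ c ∈ G.T, Exit W e c → Via (G.Ast s) e c → G.Plan U L c (sol c))
    (hin : ∀ h ∈ G.T, In W e h → G.Pnode U L s h) : G.Plan U L e s := by
  refine ⟨rc.val, fun h hh hv => ?_⟩
  rcases cover (W := W) hv.1 with h1 | ⟨c, h1, h2⟩
  · exact ⟨fun _ => hin h hh h1, fun hU => absurd (hW h1.mem) hU⟩
  · have := (hsol c (G.tree _ _ h2 hh) h1 (hv.head h1.1 h2)).congr rc.val
      fun k hk => rc.ex c k h1 hk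
    exact this.2 h hh (hv.tail h1.1 h2)

/-- plan from the one step construction -/
theorem plan_graft {e : List α} (he : e ∈ U) {s : List α → α} (hs : G.Val s)
    {sol : α → List α → α} (hss : ∀ x k, e ++ [x] <+: k → s k = sol x k)
    (hsol : ∀ x, e ++ [x] ∈ G.T → G.Ast s e x → G.Plan U L (e ++ [x]) (sol x))
    (hl : G.Pnode U L s e) : G.Plan U L e s := by
  refine ⟨hs, fun h hh hv => ?_⟩
  rcases hv.cases with rfl | ⟨x, h1, h2⟩
  · exact ⟨fun _ => hl, fun hU => absurd he hU⟩
  · exact ((hsol x (G.tree _ _ h2.1 hh) h1).congr hs (hss x)).2 h hh h2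

/-- one step for no-`Y m` plans -/
theorem XCtx.stepNA (cx : G.XCtx U τ L) {m : Bool} {e : List α} (he : e ∈ U) {x0 : α}
    (hx0 : e ++ [x0] ∈ G.T) {σ0 : List α → α} (h0 : G.NA U L m (e ++ [x0]) σ0)
    (ha : G.d e = true → ∀ x, e ++ [x] ∈ G.T → ∃ σ, G.NA U L m (e ++ [x]) σ)
    (ho : G.o σ0 (e ++ [x0]) = Oc.Y (!m) ∨ (G.o σ0 (e ++ [x0]) = Oc.Z m ∧ e ∈ G.Rm U L m)) :
    ∃ σ, G.NA U L m e σ ∧ G.o σ e = G.o σ0 (e ++ [x0]) := by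
  have : ∀ x, ∃ σ, G.Val σ ∧ (x = x0 → σ = σ0) ∧
      (e ++ [x] ∈ G.T → (G.d e = true ∨ x = x0) → G.NA U L m (e ++ [x]) σ) := by
    intro x
    by_cases hx : x = x0
    · subst hx; exact ⟨σ0, h0.1.1, fun _ => rfl, fun _ _ => h0⟩
    · by_cases hx' : e ++ [x] ∈ G.T ∧ G.d e = true
      · obtain ⟨σ, hσ⟩ := ha hx'.2 x hx'.1
        exact ⟨σ, hσ.1.1, fun h => absurd h hx, fun _ _ => hσ⟩
      · exact ⟨τ, cx.tv, fun h => absurd h hx, fun h1 h2 =>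
          absurd ⟨h1, h2.resolve_right hx⟩ hx'⟩
  choose sol sv sx sna using this
  obtain ⟨s, s1, s2, s3, s4, s5⟩ := graft (cx.hp.sub he) x0 hx0 sol (fun x hx => sv x)
  rw [sx x0 rfl] at s4
  have dA : ∀ w, G.D {true} s e w → ∃ x, e ++ [x] ∈ G.T ∧ G.NA U L m (e ++ [x]) (sol x) ∧
      G.D {true} (sol x) (e ++ [x]) w := by
    intro w hw
    obtain ⟨x, h1, h2, h3⟩ := s5 _ _ hw
    exact ⟨x, h1, sna x h1 (by simpa using h2), h3⟩
  have hna : ¬ G.D {true} s e (Oc.Y m) := by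
    intro h
    obtain ⟨x, h1, h2, h3⟩ := dA _ h
    exact h2.2 h3
  refine ⟨s, ⟨plan_graft he s1 s3 (fun x hx h => ?_) ⟨fun h => ?_, fun m' hm' => ?_⟩, hna⟩, s4⟩
  · unfold Ast at h
    rw [s2] at h
    exact (sna x hx h).1
  · obtain ⟨x, h1, h2, h3⟩ := dA _ h
    exact h2.1.noX h1 h3
  · rw [s4] at hm'
    rcases ho with ho | ⟨ho, hR⟩
    · rw [ho] at hm'; simp at hm'
    · rw [ho] at hm'
      injection hm' with hm'
      subst hm'
      exact ⟨hR, hna⟩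

/-- plays that stay in a subset of the piece with the second player following `τ` are impossible -/
theorem XCtx.noStay (cx : G.XCtx U τ L) {W : Set (List α)} (hW : W ⊆ U) {e : List α}
    {s : List α → α} (hs : ∀ h ∈ G.T, In W e h → G.d h = false → s h = τ h) {h : List α}
    (hi : In W e h) {F : Set Bool} (hF : false ∉ F) {w : Oc} (hst : G.Stay W F s h w) : False := by
  have hw := cx.hp.stay hW hst
  subst hw
  obtain ⟨p, p1, p2, p3, p4, p5⟩ := hst
  refine cx.tX h (cx.hp.sub (hW hi.mem)) ⟨p, p1, p2, fun n hn hd => ?_, p5⟩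
  have hd' : G.d (playPrefix p n) = false := by simpa using hd
  rw [p3 n hn (by rw [hd']; exact hF)]
  refine hs _ (p1 n) ⟨hi.1.trans (p2.preOf hn), fun k k1 k2 => ?_⟩ hd'
  rcases List.prefix_or_prefix_of_prefix (p2.preOf hn) k2 with k3 | k3
  · have k4 := (pass_pre p n).mono k2
    rw [← k4]; exact p4 _ k3.length_le
  · exact hi.2 k k1 k3

/-- `mv`-paths for the choices of the first player -/
theorem Stp.end_mv {W : Set (List α)} {e h c : List α} {s : List α → α} {F : Set Bool}
    (hF : false ∉ F)
    (hs : ∀ h ∈ G.T, In W e h → G.d h = false → s h = τ h) (hi : In W e h)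
    (hT : c ∈ G.T) (hc : c ∉ W) (hv : Via (G.Stp W F s) h c) :
    G.End W (G.Ast τ) h c := by
  refine ⟨hT, hc, hv.1, fun k x h1 h2 => ?_⟩
  obtain ⟨a1, a2, a3⟩ := hv.2 k x h1 h2
  refine ⟨a1, a2, ?_⟩
  have hik : In W e k := hi.via_in a1 (P := G.Stp W F s) (fun _ _ h => h.1)
    (hv.head h1 ((List.prefix_append _ _).trans h2))
  cases hd : G.d k
  · right
    rw [hd] at a3
    rw [a3.resolve_left hF]
    exact hs k (G.tree _ _ (List.prefix_append _ _) a2) hik hd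
  · exact Or.inl hd

end Ar
end S19

namespace S19
open Classical

universe u
variable {α : Type u}

namespace Ar
variable {G : Ar α}
variable {U : Set (List α)} {L : Bool → List α → List α → α} {τ : List α → α}

theorem xit_mk {h : List α} {x : α} (h1 : h ∈ U) (h2 : h ++ [x] ∈ G.T) (h3 : h ++ [x] ∉ U) :
    G.Xit U (h ++ [x]) := ⟨h2, h3, h, x, rfl, h1⟩

theorem XCtx.lbad (cx : G.XCtx U τ L) {f : List α} (hf : G.Xit U f) {m : Bool}
    (h : G.o (L m f) f = Oc.Z !m) : G.o (L (!m) f) f = Oc.Z !m := by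
  rw [(cx.lp m f hf h).2]; exact h

theorem stp_end {W : Set (List α)} {F : Set Bool} {s : List α → α} {mv : List α → α → Prop}
    {prio : List α → ℕ} {g0 : List α → α} {sol : List α → List α → α} {e h : List α}
    (rc : IsRC G e W mv prio g0 sol s) (hW : W ⊆ G.T) (cx : G.XCtx U τ L) (hWU : W ⊆ U)
    (hmv : ∀ k x, mv k x → G.Ast τ k x) (hi : In W e h) : ∃ c, G.End W mv h c := by
  by_contra hn
  refine cx.noStay hWU (e := e) (s := s) (fun k hk hik hd => ?_) hi (F := ∅) (by simp)
    (rc.o_stay hi (hW hi.mem) hn)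
  have := hmv _ _ (rc.mvs k hik hk)
  unfold Ast at this
  simpa [hd] using this

theorem XCtx.zone (cx : G.XCtx U τ L) {m : Bool} {W : Set (List α)} {zz : Prop} (hW : W ⊆ U)
    (hb : ∀ h x, h ∈ W → G.d h = false → h ++ [x] ∈ G.T → h ++ [x] ∈ W ∨ (h ++ [x] ∉ U ∧
      (G.o (L m (h ++ [x])) (h ++ [x]) = Oc.Z !m ∨
        (zz ∧ G.o (L m (h ++ [x])) (h ++ [x]) = Oc.Z m))))
    (ha : ∀ h x, h ∈ W → G.d h = true → h ++ [x] ∈ G.T → h ++ [x] ∈ W ∨ h ++ [x] ∈ G.Eh U L m ∨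
      (h ++ [x] ∉ U ∧ G.o (L m (h ++ [x])) (h ++ [x]) ≠ Oc.Y m ∧
        (G.o (L m (h ++ [x])) (h ++ [x]) = Oc.Z m → zz)))
    (hz : zz → W ⊆ G.Rm U L m) {h : List α} (hh : h ∈ W) : ∃ σ, G.NA U L m h σ := by
  let N : Set (List α) := {h | h ∈ W ∧ ∃ σ, G.NA U L m h σ ∧
    (G.o σ h = Oc.Y (!m) ∨ (zz ∧ G.o σ h = Oc.Z m))}
  let Q : Set (List α) := W \ N
  by_cases hN : h ∈ N
  · obtain ⟨_, σ, hσ, _⟩ := hN; exact ⟨σ, hσ⟩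
  have hQU : Q ⊆ U := fun k hk => hW hk.1
  have hQT : Q ⊆ G.T := fun k hk => cx.hp.sub (hQU hk)
  -- good one step moves lead to N
  have step : ∀ k x, k ∈ Q → k ++ [x] ∈ G.T → (∃ σ, G.NA U L m (k ++ [x]) σ ∧
      (G.o σ (k ++ [x]) = Oc.Y (!m) ∨ (zz ∧ G.o σ (k ++ [x]) = Oc.Z m))) →
      (G.d k = true → ∀ x, k ++ [x] ∈ G.T → ∃ σ, G.NA U L m (k ++ [x]) σ) → False := by
    rintro k x hk hx ⟨σ, h1, h2⟩ h3
    obtain ⟨σ', s1, s2⟩ := cx.stepNA (hQU hk) hx h1 h3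
      (h2.imp id fun h => ⟨h.2, hz h.1 hk.1⟩)
    exact hk.2 ⟨hk.1, σ', s1, by rw [s2]; exact h2⟩
  -- classification of exits of Q
  have cls : ∀ k x, k ∈ Q → k ++ [x] ∈ G.T → k ++ [x] ∉ Q → ∃ σ, G.NA U L m (k ++ [x]) σ ∧
      ((G.o σ (k ++ [x]) = Oc.Y (!m) ∨ (zz ∧ G.o σ (k ++ [x]) = Oc.Z m)) ∨
       (k ++ [x] ∉ U ∧ G.o (L m (k ++ [x])) (k ++ [x]) = Oc.Z (!m) ∧ σ = L m (k ++ [x]))) := by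
    intro k x hk hx hQ
    have hW' : k ++ [x] ∈ W → k ++ [x] ∈ N := fun h => by
      by_contra h'; exact hQ ⟨h, h'⟩
    cases hd : G.d k
    · rcases hb k x hk.1 hd hx with h1 | ⟨h1, h2⟩
      · obtain ⟨_, σ, hσ, h2⟩ := hW' h1
        exact ⟨σ, hσ, Or.inl h2⟩
      · have hf := xit_mk (hQU hk) hx h1
        rcases h2 with h2 | ⟨h2, h3⟩
        · exact ⟨_, cx.NAL hf (by simp [h2]), Or.inr ⟨h1, h2, rfl⟩⟩
        · exact ⟨_, cx.NAL hf (by simp [h3]), Or.inl (Or.inr ⟨h2, h3⟩)⟩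
    · rcases ha k x hk.1 hd hx with h1 | h1 | ⟨h1, h2, h3⟩
      · obtain ⟨_, σ, hσ, h2⟩ := hW' h1
        exact ⟨σ, hσ, Or.inl h2⟩
      · obtain ⟨_, σ, hσ, h2⟩ := h1
        exact ⟨σ, hσ, Or.inl (Or.inl h2)⟩
      · have hf := xit_mk (hQU hk) hx h1
        rcases cx.lcases hf m with h4 | h4 | h4 | h4
        · exact absurd h4 h2
        · exact ⟨_, cx.NAL hf h2, Or.inl (Or.inl h4)⟩
        · exact ⟨_, cx.NAL hf h2, Or.inl (Or.inr ⟨h3 h4, h4⟩)⟩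
        · exact ⟨_, cx.NAL hf h2, Or.inr ⟨h1, h4, rfl⟩⟩
  have hQb : ∀ k x, k ∈ Q → G.d k = false → k ++ [x] ∈ G.T → k ++ [x] ∈ Q ∨
      (k ++ [x] ∉ U ∧ G.o (L m (k ++ [x])) (k ++ [x]) = Oc.Z (!m)) := by
    intro k x hk hd hx
    by_cases hQ : k ++ [x] ∈ Q
    · exact Or.inl hQ
    · obtain ⟨σ, h1, h2 | ⟨h2, h3, _⟩⟩ := cls k x hk hx hQ
      · exact (step k x hk hx ⟨σ, h1, h2⟩ (by simp [hd])).elim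
      · exact Or.inr ⟨h2, h3⟩
  have hQa : ∀ k, k ∈ Q → ∃ x, k ++ [x] ∈ G.T ∧ (k ++ [x] ∈ Q ∨
      (k ++ [x] ∉ U ∧ G.o (L m (k ++ [x])) (k ++ [x]) = Oc.Z (!m))) := by
    intro k hk
    by_contra hcon
    push Not at hcon
    have hall : ∀ x, k ++ [x] ∈ G.T → ∃ σ, G.NA U L m (k ++ [x]) σ ∧
        (G.o σ (k ++ [x]) = Oc.Y (!m) ∨ (zz ∧ G.o σ (k ++ [x]) = Oc.Z m)) := by
      intro x hx
      obtain ⟨h1, h2⟩ := hcon x hx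
      obtain ⟨σ, h3, h4 | ⟨h4, h5, _⟩⟩ := cls k x hk hx h1
      · exact ⟨σ, h3, h4⟩
      · exact absurd h5 (h2 h4)
    obtain ⟨x, hx⟩ := G.prn k (hQT hk)
    exact step k x hk hx (hall x hx) fun _ y hy => (hall y hy).imp fun σ h => h.1
  -- Q is contained in the other region
  have hRS : G.RS U L (!m) Q := by
    refine ⟨hQU, fun k hk hd x hx => ?_, fun k hk => ?_⟩
    · rcases hQb k x hk hd hx with h1 | ⟨h1, h2⟩
      · exact ⟨fun _ => h1, fun h => absurd (hQU h1) h⟩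
      · refine ⟨fun h => absurd h h1, fun _ => ?_⟩
        rw [cx.lbad (xit_mk (hQU hk) hx h1) h2]
        simp
    · have : ∀ k, ∃ x, (k ∈ Q ∧ G.d k = true → k ++ [x] ∈ G.T ∧ (k ++ [x] ∈ Q ∨
          (k ++ [x] ∉ U ∧ G.o (L m (k ++ [x])) (k ++ [x]) = Oc.Z (!m)))) ∧
          (¬ (k ∈ Q ∧ G.d k = true) → x = τ k) := by
        intro k
        by_cases hk : k ∈ Q ∧ G.d k = true
        · obtain ⟨x, hx⟩ := hQa k hk.1
          exact ⟨x, fun _ => hx, fun h => absurd hk h⟩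
        · exact ⟨τ k, fun h => absurd h hk, fun _ => rfl⟩
      choose g hg1 hg2 using this
      have hgv : G.Val g := by
        intro k hk
        by_cases h : k ∈ Q ∧ G.d k = true
        · exact (hg1 k h).1
        · rw [hg2 k h]; exact cx.tv k hk
      rcases decomp Q ((D_empty hgv (hQT hk)).2 rfl) with h1 | ⟨c, c1, c2, c3, _⟩
      · refine (cx.noStay hQU (e := k) (s := g) (fun l hl hil hd => hg2 l ?_) (In.refl hk)
          (F := ∅) (by simp) h1).elim
        simp [hd]
      · obtain ⟨l, x, rfl, l1, l2, l3, l4, l5⟩ := Stp.last (In.refl hk) c2 c3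
        have hx : x = g l := by simpa using l5
        have hbad : (l ++ [x] ∉ U ∧ G.o (L m (l ++ [x])) (l ++ [x]) = Oc.Z (!m)) := by
          cases hd : G.d l
          · exact (hQb l x l1.mem hd l4).resolve_left c2
          · have := (hg1 l ⟨l1.mem, hd⟩).2
            rw [← hx] at this
            exact this.resolve_left c2
        refine ⟨l ++ [x], c1, hbad.1, c3.mono fun k x h => ⟨h.1, h.2.1⟩, Or.inr ?_⟩
        exact cx.lbad (xit_mk (hQU l1.mem) l4 hbad.1) hbad.2
  have hRm : ∀ k ∈ Q, k ∈ G.Rm U L !m := fun k hk => ⟨Q, hRS, hk⟩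
  have hhQ : h ∈ Q := ⟨hh, hN⟩
  -- solutions at the exits
  have : ∀ c, ∃ σ, G.Val σ ∧ (c ∈ G.T → Exit Q h c → G.NA U L m c σ ∧
      ((G.o σ c = Oc.Y (!m) ∨ (zz ∧ G.o σ c = Oc.Z m)) ∨
       (G.Pure c σ ∧ G.o σ c = Oc.Z (!m)))) := by
    intro c
    by_cases hc : c ∈ G.T ∧ Exit Q h c
    · obtain ⟨k, x, rfl, hk⟩ := hc.2.last hhQ
      obtain ⟨σ, h1, h2⟩ := cls k x hk.mem hc.1 hc.2.2.1
      refine ⟨σ, h1.1.1, fun _ _ => ⟨h1, h2.imp id ?_⟩⟩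
      rintro ⟨h3, h4, rfl⟩
      exact ⟨(cx.lp m _ (xit_mk (hQU hk.mem) hc.1 h3) h4).1, h4⟩
    · exact ⟨τ, cx.tv, fun h1 h2 => absurd ⟨h1, h2⟩ hc⟩
  choose S Sv SN using this
  obtain ⟨s, rc⟩ := RC h Q (G.Ast τ) (fun c => pri (Oc.Y !m) (Oc.Z m) (Oc.Z !m) (G.o (S c) c)) τ S
    cx.tv (fun k _ _ => Or.inr rfl) (fun c _ _ => Sv c)
  have hs : ∀ k ∈ G.T, In Q h k → G.d k = false → s k = τ k := by
    intro k hk hi hd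
    have := rc.mvs k hi hk
    unfold Ast at this
    simpa [hd] using this
  have dA : ∀ k w, In Q h k → G.D {true} s k w → ∃ c, c ∈ G.T ∧ Exit Q h c ∧
      G.End Q (G.Ast τ) k c ∧ G.D {true} (S c) c w := by
    intro k w hi hD
    rcases rc.dec _ k w hi hD with h1 | ⟨c, c1, c2, c3, c4⟩
    · exact (cx.noStay hQU hs hi (by simp) h1).elim
    · exact ⟨c, c1, c2, Stp.end_mv (by simp) hs hi c1 c2.2.1 c3, c4⟩
  have hna : ∀ k, In Q h k → ¬ G.D {true} s k (Oc.Y m) := by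
    intro k hi hD
    obtain ⟨c, c1, c2, c3, c4⟩ := dA k _ hi hD
    exact (SN c c1 c2).1.2 c4
  refine ⟨s, rc.plan hQU (fun c c1 c2 _ => (SN c c1 c2).1.1) (fun k hk hi => ⟨fun hD => ?_,
    fun m' hm' => ?_⟩), hna h (In.refl hhQ)⟩
  · obtain ⟨c, c1, c2, c3, c4⟩ := dA k _ hi hD
    exact (SN c c1 c2).1.1.noX c1 c4
  · obtain ⟨c, c1, c2, c3, c4, c5⟩ := rc.cho k hi hk
      (stp_end (F := ∅) rc hQT cx hQU (fun _ _ h => h) hi)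
    rw [c5] at hm'
    obtain ⟨n1, n2⟩ := SN c c2.1 c1
    rcases bool_cases m m' with rfl | rfl
    · rcases n2 with (n2 | n2) | n2
      · rw [n2] at hm'; simp at hm'
      · exact ⟨hz n2.1 hi.mem.1, hna k hi⟩
      · rw [n2.2] at hm'; simp at hm'
    · refine ⟨hRm k hi.mem, fun hD => ?_⟩
      obtain ⟨f, f1, f2, f3, f4⟩ := dA k _ hi hD
      have := c4 f f3
      rw [hm'] at this
      rcases (SN f f1 f2).2 with (n | n) | n
      · rw [n] at this; simp [pri] at this
      · rw [n.2] at this; simp [pri] at this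
      · exact (n.1.2.2 _).1 f4

end Ar
end S19

namespace S19
open Classical

universe u
variable {α : Type u}

theorem In.via {W T : Set (List α)} {e h : List α} (hi : In W e h)
    (hT : ∀ h k : List α, h <+: k → k ∈ T → h ∈ T) (hh : h ∈ T) :
    Via (fun k x => k ∈ W ∧ k ++ [x] ∈ T) e h :=
  ⟨hi.1, fun k x h1 h2 => ⟨hi.2 k h1 ((List.prefix_append _ _).trans h2), hT _ _ h2 hh⟩⟩

theorem In.of_via {W T : Set (List α)} {e h : List α} (hh : h ∈ W)
    (hv : Via (fun k x => k ∈ W ∧ k ++ [x] ∈ T) e h) : In W e h := by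
  refine ⟨hv.1, fun k h1 h2 => ?_⟩
  rcases prefix_cases h2 with rfl | ⟨x, h3⟩
  · exact hh
  · exact (hv.2 k x h1 h3).1

namespace Ar
variable {G : Ar α}
variable {U : Set (List α)} {L : Bool → List α → List α → α} {τ : List α → α}

theorem XCtx.N1 (cx : G.XCtx U τ L) {m : Bool} {h : List α} (hU : h ∈ U)
    (hR : h ∉ G.Rm U L m) : h ∈ G.Eh U L m := by
  by_contra hE
  let S : Set (List α) := U \ G.Eh U L m
  apply hR
  have hSU : S ⊆ U := fun k hk => hk.1
  -- one step
  have st : ∀ k x, k ∈ S → k ++ [x] ∈ G.T →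
      (G.d k = true → ∀ x, k ++ [x] ∈ G.T → ∃ σ, G.NA U L m (k ++ [x]) σ) →
      (k ++ [x] ∈ U → k ++ [x] ∈ S) ∧
        (k ++ [x] ∉ U → G.o (L m (k ++ [x])) (k ++ [x]) ≠ Oc.Y !m) := by
    intro k x hk hx ha
    refine ⟨fun h1 => ⟨h1, ?_⟩, fun h1 h2 => ?_⟩
    · rintro ⟨_, σ, h2, h3⟩
      obtain ⟨σ', s1, s2⟩ := cx.stepNA hk.1 hx h2 ha (Or.inl h3)
      exact hk.2 ⟨hk.1, σ', s1, s2.trans h3⟩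
    · have hf := xit_mk hk.1 hx h1
      obtain ⟨σ', s1, s2⟩ := cx.stepNA hk.1 hx (cx.NAL hf (by rw [h2]; simp)) ha (Or.inl h2)
      exact hk.2 ⟨hk.1, σ', s1, s2.trans h2⟩
  have st1 : ∀ k x, k ∈ S → G.d k = false → k ++ [x] ∈ G.T → (k ++ [x] ∈ U → k ++ [x] ∈ S) ∧
      (k ++ [x] ∉ U → G.o (L m (k ++ [x])) (k ++ [x]) ≠ Oc.Y !m) :=
    fun k x hk hd hx => st k x hk hx (by simp [hd])
  refine ⟨S, ⟨hSU, fun k hk hd x hx => st1 k x hk hd hx, fun h0 hh0 => ?_⟩, hU, hE⟩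
  by_contra hcon
  push Not at hcon
  let W : Set (List α) := {h | In S h0 h}
  have hWS : W ⊆ S := fun k (hk : In S h0 k) => hk.mem
  have hex : ∀ k x, k ∈ W → k ++ [x] ∈ G.T → k ++ [x] ∉ U →
      G.o (L m (k ++ [x])) (k ++ [x]) ≠ Oc.Y m ∧ G.o (L m (k ++ [x])) (k ++ [x]) ≠ Oc.Z m := by
    intro k x hk hx hxU
    have hk' : In S h0 k := hk
    exact hcon _ hx hxU ((hk'.via G.tree (G.tree _ _ (List.prefix_append _ _) hx)).snoc
      ⟨hk'.mem, hx⟩)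
  have hz : ∀ k ∈ W, ∃ σ, G.NA U L m k σ := by
    intro k hk
    refine cx.zone (W := W) (zz := False) (fun k hk => hSU (hWS hk)) ?_ ?_ (by simp) hk
    · intro k x hk hd hx
      obtain ⟨h1, h2⟩ := st1 k x (hWS hk) hd hx
      by_cases hxU : k ++ [x] ∈ U
      · exact Or.inl (In.snoc hk (h1 hxU))
      · right
        refine ⟨hxU, Or.inl ?_⟩
        have h3 := hex k x hk hx hxU
        rcases cx.lcases (xit_mk (hSU (hWS hk)) hx hxU) m with h4 | h4 | h4 | h4
        · exact absurd h4 h3.1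
        · exact absurd h4 (h2 hxU)
        · exact absurd h4 h3.2
        · exact h4
    · intro k x hk hd hx
      by_cases hxU : k ++ [x] ∈ U
      · by_cases hxE : k ++ [x] ∈ G.Eh U L m
        · exact Or.inr (Or.inl hxE)
        · exact Or.inl (In.snoc hk ⟨hxU, hxE⟩)
      · have h3 := hex k x hk hx hxU
        exact Or.inr (Or.inr ⟨hxU, h3.1, fun h => absurd h h3.2⟩)
  have st2 : ∀ k x, k ∈ W → k ++ [x] ∈ G.T → (k ++ [x] ∈ U → k ++ [x] ∈ W) ∧
      (k ++ [x] ∉ U → G.o (L m (k ++ [x])) (k ++ [x]) = Oc.Z !m) := by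
    intro k x hk hx
    obtain ⟨h1, h2⟩ := st k x (hWS hk) hx fun hd y hy => by
      by_cases hyU : k ++ [y] ∈ U
      · by_cases hyE : k ++ [y] ∈ G.Eh U L m
        · obtain ⟨_, σ, hσ, _⟩ := hyE
          exact ⟨σ, hσ⟩
        · exact hz _ (In.snoc hk ⟨hyU, hyE⟩)
      · exact ⟨_, cx.NAL (xit_mk (hSU (hWS hk)) hy hyU) (hex k y hk hy hyU).1⟩
    refine ⟨fun h => In.snoc hk (h1 h), fun hxU => ?_⟩
    have h3 := hex k x hk hx hxU
    rcases cx.lcases (xit_mk (hSU (hWS hk)) hx hxU) m with h4 | h4 | h4 | h4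
    · exact absurd h4 h3.1
    · exact absurd h4 (h2 hxU)
    · exact absurd h4 h3.2
    · exact h4
  obtain ⟨f, f1, f2, f3⟩ := cx.nopure h0 hh0.1
  obtain ⟨k, x, rfl, hk⟩ := f2.last hh0.1
  have hkW : k ∈ W := by
    have hkT := G.tree _ _ (List.prefix_append _ _) f1
    refine (hk.via G.tree hkT).ind (Q := fun k => k ∈ W) (In.refl hh0) fun l y l1 l2 l3 l4 => ?_
    exact (st2 l y l3 l4.2).1 (hk.2 _ (l1.trans (List.prefix_append _ _)) l2)
  have h4 := (st2 k x hkW f1).2 f2.2.1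
  exact f3 ⟨_, (cx.lp m _ (xit_mk hk.mem f1 f2.2.1) h4).1⟩

theorem XCtx.N2 (cx : G.XCtx U τ L) {m : Bool} {e : List α} (he : e ∈ G.Rm U L m)
    (hn : ∀ f ∈ G.T, f ∉ U → Via (fun k x => k ∈ G.Rm U L m ∧ k ++ [x] ∈ G.T) e f →
      G.o (L m f) f ≠ Oc.Y m) : ∃ σ, G.NA U L m e σ := by
  have hRS := Rm_RS G U L m
  let W : Set (List α) := {h | In (G.Rm U L m) e h}
  have hWR : W ⊆ G.Rm U L m := fun k (hk : In _ e k) => hk.mem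
  have hex : ∀ k x, k ∈ W → k ++ [x] ∈ G.T → k ++ [x] ∉ U →
      G.o (L m (k ++ [x])) (k ++ [x]) ≠ Oc.Y m := by
    intro k x hk hx hxU
    have hk' : In _ e k := hk
    exact hn _ hx hxU ((hk'.via G.tree (G.tree _ _ (List.prefix_append _ _) hx)).snoc
      ⟨hk'.mem, hx⟩)
  refine cx.zone (W := W) (zz := True) (fun k hk => hRS.1 (hWR hk)) ?_ ?_ (fun _ => hWR) 
    (In.refl he)
  · intro k x hk hd hx
    obtain ⟨h1, h2⟩ := hRS.2.1 k (hWR hk) hd x hx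
    by_cases hxU : k ++ [x] ∈ U
    · exact Or.inl (In.snoc hk (h1 hxU))
    · refine Or.inr ⟨hxU, ?_⟩
      rcases cx.lcases (xit_mk (hRS.1 (hWR hk)) hx hxU) m with h4 | h4 | h4 | h4
      · exact absurd h4 (hex k x hk hx hxU)
      · exact absurd h4 (h2 hxU)
      · exact Or.inr ⟨trivial, h4⟩
      · exact Or.inl h4
  · intro k x hk hd hx
    by_cases hxU : k ++ [x] ∈ U
    · by_cases hxR : k ++ [x] ∈ G.Rm U L m
      · exact Or.inl (In.snoc hk hxR)
      · exact Or.inr (Or.inl (cx.N1 hxU hxR))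
    · exact Or.inr (Or.inr ⟨hxU, hex k x hk hx hxU, fun _ => trivial⟩)

theorem XCtx.FP (cx : G.XCtx U τ L) {e : List α} (he : e ∈ U) : ∃ σ, G.Plan U L e σ := by
  have hE : ∀ e ∈ U, ∀ m, e ∉ G.Rm U L m → ∃ σ, G.Plan U L e σ ∧ G.o σ e = Oc.Y !m := by
    intro e he m hR
    obtain ⟨_, σ, h1, h2⟩ := cx.N1 he hR
    exact ⟨σ, h1.1, h2⟩
  by_cases hR1 : ∃ m, e ∉ G.Rm U L m
  · obtain ⟨m, hm⟩ := hR1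
    obtain ⟨σ, hσ, _⟩ := hE e he m hm
    exact ⟨σ, hσ⟩
  push Not at hR1
  let W : Set (List α) := {h | ∀ m, h ∈ G.Rm U L m}
  have hWU : W ⊆ U := fun k hk => (Rm_RS G U L true).1 (hk true)
  have hWT : W ⊆ G.T := fun k hk => cx.hp.sub (hWU hk)
  have heW : e ∈ W := hR1
  have : ∀ c, ∃ σ, G.Val σ ∧ (c ∈ G.T → Exit W e c → G.Plan U L c σ ∧
      ((∃ i, G.o σ c = Oc.Y i) ∨ (G.Xit U c ∧ σ = L true c))) := by
    intro c
    by_cases hc : c ∈ G.T ∧ Exit W e c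
    · obtain ⟨k, x, rfl, hk⟩ := hc.2.last heW
      by_cases hxU : k ++ [x] ∈ U
      · have : ∃ m, k ++ [x] ∉ G.Rm U L m := by
          by_contra h'; push Not at h'; exact hc.2.2.1 h'
        obtain ⟨m, hm⟩ := this
        obtain ⟨σ, h1, h2⟩ := hE _ hxU m hm
        exact ⟨σ, h1.1, fun _ _ => ⟨h1, Or.inl ⟨_, h2⟩⟩⟩
      · have hf := xit_mk (hWU hk.mem) hc.1 hxU
        exact ⟨_, cx.lv _ _, fun _ _ => ⟨cx.planL hf true, Or.inr ⟨hf, rfl⟩⟩⟩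
    · exact ⟨τ, cx.tv, fun h1 h2 => absurd ⟨h1, h2⟩ hc⟩
  choose S Sv SN using this
  obtain ⟨s, rc⟩ := RC e W (G.Ast τ) (fun c => if ∃ i, G.o (S c) c = Oc.Y i then 0 else
    if G.o (S c) c = Oc.Z true then 1 else 2) τ S
    cx.tv (fun k _ _ => Or.inr rfl) (fun c _ _ => Sv c)
  have hs : ∀ k ∈ G.T, In W e k → G.d k = false → s k = τ k := by
    intro k hk hi hd
    have := rc.mvs k hi hk
    unfold Ast at this
    simpa [hd] using this
  have dA : ∀ k w, In W e k → G.D {true} s k w → ∃ c, c ∈ G.T ∧ Exit W e c ∧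
      G.End W (G.Ast τ) k c ∧ G.D {true} (S c) c w := by
    intro k w hi hD
    rcases rc.dec _ k w hi hD with h1 | ⟨c, c1, c2, c3, c4⟩
    · exact (cx.noStay hWU hs hi (by simp) h1).elim
    · exact ⟨c, c1, c2, Stp.end_mv (by simp) hs hi c1 c2.2.1 c3, c4⟩
  refine ⟨s, rc.plan hWU (fun c c1 c2 _ => (SN c c1 c2).1) (fun k hk hi => ⟨fun hD => ?_,
    fun m' hm' => ?_⟩)⟩
  · obtain ⟨c, c1, c2, c3, c4⟩ := dA k _ hi hD
    exact (SN c c1 c2).1.noX c1 c4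
  · obtain ⟨c, c1, c2, c3, c4, c5⟩ := rc.cho k hi hk
      (stp_end (F := ∅) rc hWT cx hWU (fun _ _ h => h) hi)
    rw [c5] at hm'
    refine ⟨hi.mem m', fun hD => ?_⟩
    obtain ⟨f, f1, f2, f3, f4⟩ := dA k _ hi hD
    have h1 := c4 f f3
    rw [hm'] at h1
    obtain ⟨_, ⟨i, hi'⟩ | ⟨hf, hS⟩⟩ := SN f f1 f2
    · rw [hi'] at h1
      cases m' <;> simp at h1
    · rw [hS] at h1 f4
      cases m'
      · rcases cx.lcases hf true with h4 | h4 | h4 | h4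
        · simp [h4] at h1
        · simp [h4] at h1
        · simp [h4] at h1
        · exact ((cx.lp true f hf h4).1.2.2 _).1 f4
      · by_cases h5 : G.o (L true f) f = Oc.Y true
        · simp [h5] at h1
        · exact (cx.lx true f hf).2.1 h5 f4

def RunC (G : Ar α) (U : Set (List α)) (L : Bool → List α → List α → α) (m : Bool) (h : List α)
    (σ : List α → α) : Prop :=
  ∀ k ∈ G.T, Via (fun k x => x = σ k) h k → (k ∈ U → k ∈ G.Rm U L m) ∧
    (k ∉ U → ¬ G.D {false} σ k (Oc.Y !m))

def Ent (G : Ar α) (U : Set (List α)) (L : Bool → List α → List α → α) (m : Bool) (c : List α)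
    (σ : List α → α) : Prop :=
  G.Plan U L c σ ∧ (c ∉ G.Rm U L m → ¬ G.D {true} σ c (Oc.Y m) ∧ G.o σ c = Oc.Y !m) ∧
  (c ∈ G.Rm U L m → G.RunC U L m c σ ∧
    (G.o σ c = Oc.Y m ∨ (G.o σ c = Oc.Z m ∧ ¬ G.D {true} σ c (Oc.Y m))))

theorem XCtx.pathPlan (cx : G.XCtx U τ L) {m : Bool} {c f : List α} (hc : c ∈ G.Rm U L m)
    (hfT : f ∈ G.T) (hfU : f ∉ U)
    (hv : Via (fun k x => k ∈ G.Rm U L m ∧ k ++ [x] ∈ G.T) c f)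
    (hS : ∀ k x, k ∈ G.Rm U L m → Via (fun k x => k ∈ G.Rm U L m ∧ k ++ [x] ∈ G.T) c k →
      k ++ [x] ∈ G.T → k ++ [x] ≠ f → ∃ σ, G.Plan U L (k ++ [x]) σ ∧
      (G.o (L m f) f ≠ Oc.Y m → ¬ G.D {true} σ (k ++ [x]) (Oc.Y m)))
    (ht : G.o (L m f) f = Oc.Y m ∨ G.o (L m f) f = Oc.Z m) :
    ∃ σ, G.Ent U L m c σ := by
  have hRU : G.Rm U L m ⊆ U := (Rm_RS G U L m).1
  let W : Set (List α) := {k | c <+: k ∧ k <+: f ∧ k ≠ f}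
  have hnx : ∀ k ∈ W, ∃ x, k ++ [x] <+: f := fun k hk =>
    (prefix_cases hk.2.1).resolve_left hk.2.2
  have hWR : W ⊆ G.Rm U L m := fun k hk => by
    obtain ⟨x, hx⟩ := hnx k hk
    exact (hv.2 k x hk.1 hx).1
  have hWU : W ⊆ U := hWR.trans hRU
  have hWT : W ⊆ G.T := hWU.trans cx.hp.sub
  have hcf : c ≠ f := by rintro rfl; exact hfU (hRU hc)
  have hcW : c ∈ W := ⟨List.prefix_rfl, hv.1, hcf⟩
  have hfW : f ∉ W := fun h => h.2.2 rfl
  have hXf : G.Xit U f := by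
    rcases hv.cases_last with h | ⟨k, x, rfl, _, h2⟩
    · exact absurd h hcf
    · exact xit_mk (hRU h2.1) hfT hfU
  have : ∀ k, ∃ x, (k ∈ W → k ++ [x] <+: f) ∧ (k ∉ W → x = τ k) := by
    intro k
    by_cases hk : k ∈ W
    · obtain ⟨x, hx⟩ := hnx k hk
      exact ⟨x, fun _ => hx, fun h => absurd hk h⟩
    · exact ⟨τ k, fun h => absurd h hk, fun _ => rfl⟩
  choose g0 hg1 hg2 using this
  have hg0 : G.Val g0 := by
    intro k hk
    by_cases h : k ∈ W
    · exact G.tree _ _ (hg1 k h) hfT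
    · rw [hg2 k h]; exact cx.tv k hk
  have : ∀ d, ∃ σ, G.Val σ ∧ (d = f → σ = L m f) ∧ (d ∈ G.T → Exit W c d → G.Plan U L d σ ∧
      (G.o (L m f) f ≠ Oc.Y m → ¬ G.D {true} σ d (Oc.Y m))) := by
    intro d
    by_cases hdf : d = f
    · subst hdf
      exact ⟨_, cx.lv _ _, fun _ => rfl, fun _ _ => ⟨cx.planL hXf m, (cx.lx m _ hXf).2.1⟩⟩
    by_cases hd : d ∈ G.T ∧ Exit W c d
    · obtain ⟨k, x, rfl, hk⟩ := hd.2.last hcW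
      obtain ⟨σ, hσ⟩ := hS k x (hWR hk.mem) (hv.head hk.1 hk.mem.2.1) hd.1 hdf
      exact ⟨σ, hσ.1.1, fun h => absurd h hdf, fun _ _ => hσ⟩
    · exact ⟨τ, cx.tv, fun h => absurd h hdf, fun h1 h2 => absurd ⟨h1, h2⟩ hd⟩
  choose S Sv Sf SN using this
  obtain ⟨s, rc⟩ := RC c W (fun k x => k ++ [x] <+: f) (fun _ => 0) g0 S hg0
    (fun k hk _ => hg1 k hk) (fun d _ _ => Sv d)
  have hpf : ∀ h d, In W c h → Via (fun k x => k ∈ W → k ++ [x] <+: f) h d → (d ∉ W) →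
      (∀ k, h <+: k → k <+: d → k ≠ d → k ∈ W) → d = f := by
    intro h d hi hvd hd hall
    have h1 : d <+: f := by
      rcases hvd.cases_last with rfl | ⟨k, x, rfl, k1, k2⟩
      · exact absurd hi.mem hd
      · exact k2 (hall k k1.1 (List.prefix_append _ _) (by simp))
    by_contra hne
    exact hd ⟨hi.1.trans hvd.1, h1, hne⟩
  have hend : ∀ h d, In W c h → G.End W (fun k x => k ++ [x] <+: f) h d → d = f := by
    intro h d hi hE
    refine hpf h d hi (hE.2.2.mono fun k x h _ => h.2.2) hE.2.1 fun k k1 k2 k3 => ?_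
    obtain ⟨x, hx⟩ := (prefix_cases k2).resolve_left k3
    exact (hE.2.2.2 k x k1 hx).1
  have hEnd : ∀ h, In W c h → G.End W (fun k x => k ++ [x] <+: f) h f := by
    intro h hi
    refine ⟨hfT, hfW, hi.mem.2.1, fun k x k1 k2 => ⟨⟨hi.1.trans k1, 
      (List.prefix_append _ _).trans k2, ?_⟩, G.tree _ _ k2 hfT, k2⟩⟩
    rintro rfl; exact not_snoc_prefix _ _ k2
  have ho : ∀ h, In W c h → G.o s h = G.o (L m f) f := by
    intro h hi
    obtain ⟨d, d1, d2, d3, d4, d5⟩ := rc.cho h hi (hWT hi.mem) ⟨f, hEnd h hi⟩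
    have := hend h d hi d2
    subst this
    rw [d5, Sf _ rfl]
  have dA : ∀ h F w, In W c h → G.D F s h w → ∃ d, d ∈ G.T ∧ Exit W c d ∧
      G.D F (S d) d w := by
    intro h F w hi hD
    rcases rc.dec _ h w hi hD with ⟨p, p1, p2, p3, p4, p5⟩ | ⟨d, d1, d2, d3, d4⟩
    · have := (p4 (h.length + f.length + 1) (by omega)).2.1.length_le
      rw [pre_length] at this
      omega
    · exact ⟨d, d1, d2, d4⟩
  have hna : ∀ h, In W c h → G.o (L m f) f ≠ Oc.Y m → ¬ G.D {true} s h (Oc.Y m) := by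
    intro h hi hne hD
    obtain ⟨d, d1, d2, d3⟩ := dA h _ _ hi hD
    exact (SN d d1 d2).2 hne d3
  have hcc := In.refl hcW
  refine ⟨s, ?_, fun h => absurd hc h, fun _ => ⟨fun k hk hvk => ?_, ?_⟩⟩
  · refine rc.plan hWU (fun d d1 d2 _ => (SN d d1 d2).1) (fun k hk hi => ⟨fun hD => ?_,
      fun m' hm' => ?_⟩)
    · obtain ⟨d, d1, d2, d3⟩ := dA k _ _ hi hD
      exact (SN d d1 d2).1.noX d1 d3
    · rw [ho k hi] at hm'
      rcases ht with ht | ht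
      · rw [ht] at hm'; simp at hm'
      · have := ht.symm.trans hm'
        injection this with this
        subst this
        exact ⟨hWR hi.mem, hna k hi (by rw [ht]; simp)⟩
  · rcases cover (W := W) hvk.1 with hi | ⟨d, d1, d2⟩
    · exact ⟨fun _ => hWR hi.mem, fun h => absurd (hWU hi.mem) h⟩
    · have hdf : d = f := by
        refine hpf c d hcc ⟨d1.1, fun l x l1 l2 l3 => ?_⟩ d1.2.1 d1.2.2
        rw [hvk.2 l x l1 (l2.trans d2)]
        refine rc.mvs l ⟨l1, fun a a1 a2 => ?_⟩ (hWT l3)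
        refine d1.2.2 a a1 (a2.trans ((List.prefix_append _ _).trans l2)) ?_
        rintro rfl
        exact not_snoc_prefix _ _ (l2.trans a2)
      subst hdf
      refine ⟨fun h => absurd h (cx.xit_below hXf d2), fun _ hD => ?_⟩
      refine (cx.lx m d hXf).2.2 (by rcases ht with ht | ht <;> rw [ht] <;> simp) ?_
      have : G.D {false} s d (Oc.Y !m) := D_via ((hvk.tail d1.1 d2).mono fun _ _ h => Or.inr h) hD
      have h2 : ∀ k, d <+: k → s k = L m d k := fun k hk => by rw [rc.ex d k d1 hk, Sf d rfl]
      exact D_congr h2 this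
  · rw [ho c hcc]
    rcases ht with ht | ht
    · exact Or.inl ht
    · exact Or.inr ⟨ht, hna c hcc (by rw [ht]; simp)⟩

theorem XCtx.ent (cx : G.XCtx U τ L) (m : Bool) {c : List α} (hc : c ∈ U) :
    ∃ σ, G.Ent U L m c σ := by
  by_cases hR : c ∈ G.Rm U L m
  · have hRU : G.Rm U L m ⊆ U := (Rm_RS G U L m).1
    by_cases hA : ∃ f ∈ G.T, f ∉ U ∧ Via (fun k x => k ∈ G.Rm U L m ∧ k ++ [x] ∈ G.T) c f ∧
        G.o (L m f) f = Oc.Y m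
    · obtain ⟨f, f1, f2, f3, f4⟩ := hA
      refine cx.pathPlan hR f1 f2 f3 (fun k x hk _ hx _ => ?_) (Or.inl f4)
      by_cases hxU : k ++ [x] ∈ U
      · obtain ⟨σ, hσ⟩ := cx.FP hxU
        exact ⟨σ, hσ, fun h => absurd f4 h⟩
      · exact ⟨_, cx.planL (xit_mk (hRU hk) hx hxU) true, fun h => absurd f4 h⟩
    · push Not at hA
      obtain ⟨f, f1, f2, f3, f4⟩ := (Rm_RS G U L m).2.2 c hR
      refine cx.pathPlan hR f1 f2 f3 (fun k x hk hvk hx _ => ?_) f4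
      have : ∃ σ, G.NA U L m (k ++ [x]) σ := by
        by_cases hxU : k ++ [x] ∈ U
        · by_cases hxR : k ++ [x] ∈ G.Rm U L m
          · refine cx.N2 hxR fun f' g1 g2 g3 => hA f' g1 g2 ((hvk.snoc ⟨hk, hx⟩).trans g3)
          · obtain ⟨_, σ, hσ, _⟩ := cx.N1 hxU hxR
            exact ⟨σ, hσ⟩
        · exact ⟨_, cx.NAL (xit_mk (hRU hk) hx hxU) (hA _ hx hxU (hvk.snoc ⟨hk, hx⟩))⟩
      obtain ⟨σ, hσ⟩ := this
      exact ⟨σ, hσ.1, fun _ => hσ.2⟩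
  · obtain ⟨_, σ, h1, h2⟩ := cx.N1 hc hR
    exact ⟨σ, h1.1, fun _ => ⟨h1.2, h2⟩, fun h => absurd h hR⟩

end Ar
end S19

namespace S19
open Classical

universe u
variable {α : Type u}

/-- state machines along the tree -/
noncomputable def mach {β : Type*} (e : List α) (i : β) (upd : β → List α → α → β) : List α → β
  | [] => i
  | x :: r => if (x :: r).reverse = e then i else upd (mach e i upd r) r.reverse x

theorem exists_mach {β : Type*} (e : List α) (i : β) (upd : β → List α → α → β) :
    ∃ st : List α → β, st e = i ∧ ∀ h x, e <+: h → st (h ++ [x]) = upd (st h) h x := by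
  refine ⟨fun h => mach e i upd h.reverse, ?_, fun h x hh => ?_⟩
  · rcases he : e.reverse with _ | ⟨y, r⟩
    · simp only [he]; rw [mach]
    · have : (y :: r).reverse = e := by rw [← he, List.reverse_reverse]
      simp only [he]; rw [mach, if_pos this]
  · have h1 : (h ++ [x]).reverse = x :: h.reverse := by simp
    have h2 : (x :: h.reverse).reverse = h ++ [x] := by simp
    have h3 : h ++ [x] ≠ e := by
      rintro rfl; exact not_snoc_prefix _ _ hh
    simp only [h1]
    rw [mach, h2, if_neg h3, List.reverse_reverse]

namespace Ar
variable {G : Ar α}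
variable {U : Set (List α)} {L : Bool → List α → List α → α} {τ : List α → α}

theorem Via.o_eq {σ : List α → α} (hσ : G.Val σ) {h k : List α} (hh : h ∈ G.T)
    (hv : Via (fun k x => x = σ k) h k) : k ∈ G.T ∧ G.o σ k = G.o σ h := by
  refine hv.ind (Q := fun k => k ∈ G.T ∧ G.o σ k = G.o σ h) ⟨hh, rfl⟩ ?_
  rintro k x _ _ ⟨h1, h2⟩ rfl
  exact ⟨hσ k h1, (o_child hσ h1).trans h2⟩

theorem Plan.runC {σ : List α → α} {h : List α} (hp : G.Plan U L h σ) (hh : h ∈ G.T) {m : Bool}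
    (ho : G.o σ h = Oc.Z m) : G.RunC U L m h σ := by
  intro k hk hv
  have h1 := (Via.o_eq hp.1 hh hv).2.trans ho
  obtain ⟨h2, h3⟩ := hp.2 k hk (hv.mono fun _ _ h => Or.inr h)
  exact ⟨fun hU => ((h2 hU).2 m h1).1, fun hU =>
    ((h3 hU).condZ hk h1).2 (by rw [h1]; simp)⟩

noncomputable def mst (G : Ar α) (σ : List α → α) (m : Bool) (h : List α) : Bool :=
  match G.o σ h with
  | Oc.Z m' => m'
  | _ => m

theorem XCtx.K (cx : G.XCtx U τ L) {e : List α} (he : e ∈ U) (m : Bool) : G.K m e := by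
  have : ∀ c m', ∃ σ, G.Val σ ∧ (c ∈ U → G.Ent U L m' c σ) ∧ (c ∉ U → σ = L m' c) := by
    intro c m'
    by_cases hc : c ∈ U
    · obtain ⟨σ, hσ⟩ := cx.ent m' hc
      exact ⟨σ, hσ.1.1, fun _ => hσ, fun h => absurd hc h⟩
    · exact ⟨_, cx.lv _ _, fun h => absurd h hc, fun _ => rfl⟩
  choose N Nv NU NL using this
  obtain ⟨st, st0, st1⟩ := exists_mach e ((N e m, m) : (List α → α) × Bool)
    (fun q h x => if h ∈ U ∧ G.d h = false ∧ x ≠ q.1 h then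
      (N (h ++ [x]) (G.mst q.1 q.2 h), G.mst q.1 q.2 h) else q)
  have stk : ∀ h x, e <+: h → ¬ (h ∈ U ∧ G.d h = false ∧ x ≠ (st h).1 h) → st (h ++ [x]) = st h :=
    fun h x hh hn => by rw [st1 h x hh, if_neg hn]
  have stc : ∀ h x, e <+: h → (h ∈ U ∧ G.d h = false ∧ x ≠ (st h).1 h) → st (h ++ [x]) =
      (N (h ++ [x]) (G.mst (st h).1 (st h).2 h), G.mst (st h).1 (st h).2 h) :=
    fun h x hh hn => by rw [st1 h x hh, if_pos hn]
  have below : ∀ h k, e <+: h → h ∉ U → h <+: k → k ∉ U := fun h k h1 h2 h3 h4 =>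
    h2 (cx.cvx e h k he h4 h1 h3)
  have heT := cx.hp.sub he
  -- invariant
  have inv : ∀ h, e <+: h → h ∈ G.T → G.Plan U L h (st h).1 := by
    apply ext_ind
    · intro _; rw [st0]; exact (NU e m he).1
    · intro h x hh ih hx
      have hT := G.tree _ _ (List.prefix_append _ _) hx
      by_cases hc : h ∈ U ∧ G.d h = false ∧ x ≠ (st h).1 h
      · rw [stc h x hh hc]
        by_cases hxU : h ++ [x] ∈ U
        · exact (NU _ _ hxU).1
        · simp only [NL _ _ hxU]
          exact cx.planL (xit_mk hc.1 hx hxU) _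
      · rw [stk h x hh hc]
        by_cases hU : h ∈ U
        · refine (ih hT).tail (Via.one ?_)
          unfold Ast
          cases hd : G.d h
          · right; by_contra h'; exact hc ⟨hU, hd, h'⟩
          · exact Or.inl rfl
        · refine ⟨(ih hT).1, fun k hk hv => ⟨fun h => ?_, fun _ => ?_⟩⟩
          · exact absurd h (below _ _ hh hU ((List.prefix_append _ _).trans hv.1))
          · exact (((ih hT).2 h hT (Via.refl _ _)).2 hU).mono
              ((List.prefix_append _ _).trans hv.1)
  -- states off the tree may be arbitrary, the profile is fixed there
  let s : List α → α := fun h => if e <+: h then (st h).1 h else τ h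
  have hs : ∀ h, e <+: h → s h = (st h).1 h := fun h hh => if_pos hh
  have sv : G.Val s := by
    intro h hT
    by_cases hh : e <+: h
    · rw [hs h hh]; exact (inv h hh hT).1 h hT
    · have : s h = τ h := if_neg hh
      rw [this]; exact cx.tv h hT
  have fol : ∀ F h w, false ∉ F → e <+: h → G.D F s h w → G.D F (st h).1 h w := by
    rintro F h w hF hh ⟨p, p1, p2, p3, p4⟩
    have key : ∀ n, h.length ≤ n → st (playPrefix p n) = st h := by
      intro n hn
      induction n, hn using Nat.le_induction with
      | base => rw [p2]
      | succ n hn ih =>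
        have h1 := hh.trans (p2.preOf hn)
        rw [pre_succ, stk _ _ h1, ih]
        rintro ⟨_, h3, h4⟩
        apply h4
        rw [p3 n hn (by rw [h3]; exact hF), hs _ h1]
    refine ⟨p, p1, p2, fun n hn hd => ?_, p4⟩
    rw [p3 n hn hd, hs _ (hh.trans (p2.preOf hn)), key n hn]
  have oeq : ∀ h, e <+: h → h ∈ G.T → G.o s h = G.o (st h).1 h := by
    intro h hh hT
    exact ((D_empty (inv h hh hT).1 hT).1 (fol ∅ h _ (by simp) hh ((D_empty sv hT).2 rfl))).symm
  have out : ∀ h, e <+: h → h ∉ U → ∀ k, h <+: k → s k = (st h).1 k := by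
    intro h hh hU
    have key : ∀ k, h <+: k → st k = st h := by
      apply ext_ind
      · rfl
      · intro k x hk ih
        rw [stk k x (hh.trans hk) (fun h' => below h k hh hU hk h'.1), ih]
    intro k hk
    rw [hs k (hh.trans hk), key k hk]
  -- deviations of the second player
  have dB : ∀ h m', e <+: h → h ∈ G.Rm U L m' → G.RunC U L m' h (st h).1 →
      G.mst (st h).1 (st h).2 h = m' → ¬ G.D {false} s h (Oc.Y !m') := by
    rintro h m' hh hR hrun hm ⟨p, p1, p2, p3, p4⟩
    have hRS := Rm_RS G U L m'
    have key : ∀ n, h.length ≤ n → playPrefix p n ∈ G.Rm U L m' ∧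
        G.RunC U L m' (playPrefix p n) (st (playPrefix p n)).1 ∧
        G.mst (st (playPrefix p n)).1 (st (playPrefix p n)).2 (playPrefix p n) = m' := by
      intro n hn
      induction n, hn using Nat.le_induction with
      | base => rw [p2]; exact ⟨hR, hrun, hm⟩
      | succ n hn ih =>
        obtain ⟨i1, i2, i3⟩ := ih
        have h1 := hh.trans (p2.preOf hn)
        have hx := p1 (n + 1)
        have hD : G.D {false} s (playPrefix p (n+1)) (Oc.Y !m') :=
          ⟨p, p1, pass_pre _ _, fun k hk hd => p3 k (by rw [pre_length] at hk; omega) hd, p4⟩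
        have hfol := p3 n hn
        rw [pre_succ] at hx hD ⊢
        generalize playPrefix p n = k at *
        generalize p n = x at *
        have hkT := G.tree _ _ (List.prefix_append _ _) hx
        have hkU := hRS.1 i1
        by_cases hc : k ∈ U ∧ G.d k = false ∧ x ≠ (st k).1 k
        · rw [stc k x h1 hc, i3]
          by_cases hxU : k ++ [x] ∈ U
          · have hxR := (hRS.2.1 k i1 hc.2.1 x hx).1 hxU
            obtain ⟨r1, r2⟩ := (NU _ m' hxU).2.2 hxR
            refine ⟨hxR, r1, ?_⟩
            unfold mst
            rcases r2 with r2 | ⟨r2, _⟩ <;> simp only [r2]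
          · exfalso
            have h4 := (hRS.2.1 k i1 hc.2.1 x hx).2 hxU
            have h5 := out _ (h1.trans (List.prefix_append k [x])) hxU
            rw [stc k x h1 hc, i3] at h5
            simp only [NL _ _ hxU] at h5
            exact (cx.lx m' _ (xit_mk hkU hx hxU)).2.2 h4 (D_congr h5 hD)
        · have hxs : x = (st k).1 k := by
            by_contra hne
            cases hd : G.d k
            · exact hc ⟨hkU, hd, hne⟩
            · apply hne
              rw [hfol (by simp [hd]), hs k h1]
          have hkk := stk k x h1 hc
          have hv : Via (fun l y => y = (st k).1 l) k (k ++ [x]) := Via.one hxs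
          obtain ⟨r1, r2⟩ := i2 _ hx hv
          by_cases hxU : k ++ [x] ∈ U
          · rw [hkk]
            refine ⟨r1 hxU, fun l hl hvl => i2 l hl (hv.trans hvl), ?_⟩
            rw [← i3]
            unfold mst
            rw [(Via.o_eq (inv k h1 hkT).1 hkT hv).2]
          · exfalso
            have h5 := out _ (h1.trans (List.prefix_append k [x])) hxU
            rw [hkk] at h5
            exact r2 hxU (D_congr h5 hD)
    have := cx.hp.cst p p1 h.length fun k hk => hRS.1 (key k hk).1
    rw [this] at p4
    simp at p4
  refine ⟨s, ⟨sv, fun h hT hh => ?_⟩, ?_⟩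
  · by_cases hU : h ∈ U
    · have hpn := ((inv h hh hT).2 h hT (Via.refl _ _)).1 hU
      refine ⟨fun hD => hpn.1 (fol _ h _ (by simp) hh hD), fun m' hm' => ⟨fun _ hD => ?_, fun _ => ?_⟩⟩
      · rw [oeq h hh hT] at hm'
        exact (hpn.2 m' hm').2 (fol _ h _ (by simp) hh hD)
      · rw [oeq h hh hT] at hm'
        refine dB h m' hh (hpn.2 m' hm').1 ((inv h hh hT).runC hT hm') ?_
        unfold mst
        simp only [hm']
    · exact (((inv h hh hT).2 h hT (Via.refl _ _)).2 hU).2 h hT List.prefix_rfl |>.congr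
        (inv h hh hT).1 sv hT (out h hh hU)
  · have h1 := NU e m he
    have h2 := oeq e List.prefix_rfl heT
    have h3 := fol {true} e (Oc.Y m) (by simp) List.prefix_rfl
    have h4 := dB e m List.prefix_rfl
    rw [st0] at h2 h3 h4
    simp only at h2 h3 h4
    unfold Cond
    rw [h2]
    by_cases hR : e ∈ G.Rm U L m
    · obtain ⟨r1, r2⟩ := h1.2.2 hR
      refine ⟨fun hne hD => ?_, fun _ => h4 hR r1 ?_⟩
      · rcases r2 with r2 | ⟨_, r2⟩
        · exact hne r2
        · exact r2 (h3 hD)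
      · unfold mst
        rcases r2 with r2 | ⟨r2, _⟩ <;> simp only [r2]
    · obtain ⟨r1, r2⟩ := h1.2.1 hR
      exact ⟨fun _ hD => r1 (h3 hD), fun hne => absurd r2 hne⟩

end Ar
end S19

namespace S19
open Classical

universe u
variable {α : Type u}

namespace Ar
variable {G : Ar α}
variable {U : Set (List α)} {τ : List α → α}

theorem Pure.cond {f : List α} {σ : List α → α} (h : G.Pure f σ) (m : Bool) : G.Cond m σ f :=
  ⟨fun _ => (h.2.2 m).1, fun _ => (h.2.2 !m).2⟩

theorem pure_of {f : List α} {σ : List α → α} {m : Bool} (hf : f ∈ G.T) (h : G.Sol f σ)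
    (hc : G.Cond m σ f) (ho : G.o σ f = Oc.Z !m) : G.Pure f σ := by
  have h2 := h.condZ hf ho
  unfold Cond at hc h2
  rw [ho] at hc h2
  simp at hc h2
  refine ⟨h, ⟨_, ho⟩, fun m' => ?_⟩
  rcases bool_cases m m' with rfl | rfl
  · exact ⟨hc.1, h2.2⟩
  · exact ⟨h2.1, hc.2⟩

theorem Piece.X_false (hp : G.Piece U Oc.X)
    (cvx : ∀ e h k, e ∈ U → k ∈ U → e <+: h → h <+: k → h ∈ U)
    (tv : G.Val τ) (tX : ∀ h ∈ G.T, ¬ G.D {true} τ h Oc.X)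
    (hbad : ∀ e ∈ U, ∃ k ∈ U, e <+: k ∧ ∃ m, ¬ G.K m k) {e : List α} (he : e ∈ U) : False := by
  have : ∀ f, ∃ M : Bool → List α → α, (∀ m, G.Val (M m)) ∧
      ((∃ σ, G.Pure f σ) → G.Pure f (M true) ∧ M false = M true) ∧
      ((¬ ∃ σ, G.Pure f σ) → ∀ m, G.K m f → G.Sol f (M m) ∧ G.Cond m (M m) f) := by
    intro f
    by_cases hP : ∃ σ, G.Pure f σ
    · obtain ⟨σ, hσ⟩ := hP
      exact ⟨fun _ => σ, fun _ => hσ.1.1, fun _ => ⟨hσ, rfl⟩, fun h => absurd ⟨σ, hσ⟩ h⟩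
    · have : ∀ m, ∃ σ, G.Val σ ∧ (G.K m f → G.Sol f σ ∧ G.Cond m σ f) := by
        intro m
        by_cases hK : G.K m f
        · obtain ⟨σ, h1, h2⟩ := hK
          exact ⟨σ, h1.1, fun _ => ⟨h1, h2⟩⟩
        · exact ⟨τ, tv, fun h => absurd h hK⟩
      choose M M1 M2 using this
      exact ⟨M, M1, fun h => absurd h hP, fun _ m => M2 m⟩
  choose M Mv MP MK using this
  have hMP : ∀ f m, (∃ σ, G.Pure f σ) → G.Pure f (M f m) ∧ M f (!m) = M f m := by
    intro f m h
    obtain ⟨h1, h2⟩ := MP f h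
    cases m
    · rw [h2]; exact ⟨h1, h2.symm ▸ rfl⟩
    · exact ⟨h1, h2⟩
  have hXK : ∀ f, G.Xit U f → ∀ m, G.K m f := by
    rintro f ⟨h1, h2, h, x, rfl, h3⟩ m
    exact hp.exK h x h3 h1 h2 m
  have cx : G.XCtx U τ (fun m f => M f m) := by
    refine ⟨hp, cvx, tv, tX, fun m f => Mv f m, fun m f hf => ?_, fun m f hf ho => ?_, ?_⟩
    · by_cases hP : ∃ σ, G.Pure f σ
      · exact ⟨(hMP f m hP).1.1, (hMP f m hP).1.cond m⟩
      · exact MK f hP m (hXK f hf m)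
    · by_cases hP : ∃ σ, G.Pure f σ
      · exact hMP f m hP
      · obtain ⟨h1, h2⟩ := MK f hP m (hXK f hf m)
        exact absurd ⟨_, pure_of hf.1 h1 h2 ho⟩ hP
    · intro e he
      by_contra hcon
      push Not at hcon
      obtain ⟨k, hk, hek, m, hK⟩ := hbad e he
      have hiek : In U e k := ⟨hek, fun l l1 l2 => cvx e l k he hk l1 l2⟩
      have hpure : ∀ f ∈ G.T, Exit U k f → G.Pure f (M f true) := by
        intro f hf hx
        refine (hMP f true (hcon f hf ?_)).1
        obtain ⟨l, x, rfl, hl⟩ := hx.last hk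
        exact (RCtx.In.trans hiek hl).exit hx.2.1
      obtain ⟨s, rc⟩ := RC k U (fun h x => x = τ h) (fun _ => 0) τ (fun f => M f true) tv
        (fun _ _ _ => rfl) (fun f _ _ => Mv f true)
      have hs : ∀ h, In U k h → s h = τ h := fun h hi => rc.mvs h hi (hp.sub hi.mem)
      have noA : ∀ h w, In U k h → ¬ G.Stay U {true} s h w := by
        rintro h w hi hst
        have hw := hp.stay le_rfl hst
        subst hw
        obtain ⟨p, p1, p2, p3, p4, p5⟩ := hst
        refine tX h (hp.sub hi.mem) ⟨p, p1, p2, fun n hn hd => ?_, p5⟩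
        rw [p3 n hn hd]
        refine hs _ ⟨hi.1.trans (p2.preOf hn), fun l l1 l2 => ?_⟩
        exact cvx k l _ hk (p4 n hn) l1 l2
      have hY : ∀ F h m, In U k h → (F = {true} ∨ F = {false}) → ¬ G.D F s h (Oc.Y m) := by
        intro F h m hi hF hD
        rcases rc.dec F h _ hi hD with h1 | ⟨c, c1, c2, c3, c4⟩
        · have := hp.stay le_rfl h1
          simp at this
        · rcases hF with rfl | rfl
          · exact ((hpure c c1 c2).2.2 m).1 c4
          · exact ((hpure c c1 c2).2.2 m).2 c4
      have hc : ∀ h m, In U k h → G.Cond m s h := fun h m hi =>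
        ⟨fun _ => hY _ h _ hi (Or.inl rfl), fun _ => hY _ h _ hi (Or.inr rfl)⟩
      refine hK ⟨s, rc.sol (fun c c1 c2 => (hpure c c1 c2).1) (fun h hh hi => ⟨fun hD => ?_,
        fun m' _ => hc h m' hi⟩), hc k m (In.refl hk)⟩
      rcases rc.dec _ h _ hi hD with h1 | ⟨c, c1, c2, c3, c4⟩
      · exact noA h _ hi h1
      · exact (hpure c c1 c2).1.noX c1 c4
  obtain ⟨k, hk, _, m, hK⟩ := hbad e he
  exact hK (cx.K hk m)

/-- Property: every nonempty pruned subtree has a node below which the outcome is constant. -/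
def Star (G : Ar α) : Prop := ∀ S : Set (List α), S ⊆ G.T → S.Nonempty →
  (∀ h k : List α, h <+: k → k ∈ S → h ∈ S) → (∀ h ∈ S, ∃ x, h ++ [x] ∈ S) →
  ∃ δ ∈ S, ∃ c, ∀ p ∈ Body S, Pass δ p → G.v p = c

theorem core (hst : G.Star) (tv : G.Val τ) (tX : ∀ h ∈ G.T, ¬ G.D {true} τ h Oc.X)
    {e : List α} (he : e ∈ G.T) (m : Bool) : G.K m e := by
  by_contra hK
  let U0 : Set (List α) := {h | h ∈ G.T ∧ ∃ k ∈ G.T, h <+: k ∧ ∃ m, ¬ G.K m k}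
  have hpr : ∀ h ∈ U0, ∃ x, h ++ [x] ∈ U0 := by
    rintro h ⟨hh, k, hk, hhk, m, hm⟩
    rcases prefix_cases hhk with rfl | ⟨x, hx⟩
    · by_contra hcon
      push Not at hcon
      refine hm (oneK hh fun x hx => ?_)
      by_contra hK
      exact hcon x ⟨hx, _, hx, List.prefix_rfl, m, hK⟩
    · exact ⟨x, G.tree _ _ hx hk, k, hk, hx, m, hm⟩
  obtain ⟨δ, hδ, c, hc⟩ := hst U0 (fun h hh => hh.1) ⟨e, he, e, he, List.prefix_rfl, m, hK⟩
    (fun h k hhk hk => ⟨G.tree _ _ hhk hk.1, by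
      obtain ⟨_, l, l1, l2, l3⟩ := hk
      exact ⟨l, l1, hhk.trans l2, l3⟩⟩) hpr
  let U : Set (List α) := {h | h ∈ U0 ∧ δ <+: h}
  have hU0 : ∀ h ∈ G.T, h ∉ U0 → ∀ m, G.K m h := by
    intro h hh hn m
    by_contra hK
    exact hn ⟨hh, h, hh, List.prefix_rfl, m, hK⟩
  have hp : G.Piece U c := by
    refine ⟨fun h hh => hh.1.1, fun h hh => ?_, fun h x hh hx hn m => ?_, fun p hp n hn => ?_⟩
    · obtain ⟨x, hx⟩ := hpr h hh.1
      exact ⟨x, hx, hh.2.trans (List.prefix_append _ _)⟩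
    · exact hU0 _ hx (fun h' => hn ⟨h', hh.2.trans (List.prefix_append _ _)⟩) m
    · refine hc p (fun k => ?_) ?_
      · have h1 := (hn (n + k) (by omega)).1
        obtain ⟨_, l, l1, l2, l3⟩ := h1
        exact ⟨hp k, l, l1, (pre_prefix p (by omega)).trans l2, l3⟩
      · exact (pass_pre p n).mono (hn n le_rfl).2
  have hδU : δ ∈ U := ⟨hδ, List.prefix_rfl⟩
  have hbad : ∀ e ∈ U, ∃ k ∈ U, e <+: k ∧ ∃ m, ¬ G.K m k := by
    rintro h ⟨⟨hh, k, hk, hhk, m, hm⟩, hd⟩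
    exact ⟨k, ⟨⟨hk, k, hk, List.prefix_rfl, m, hm⟩, hd.trans hhk⟩, hhk, m, hm⟩
  by_cases hcX : c = Oc.X
  · subst hcX
    refine hp.X_false (fun e h k h1 h2 h3 h4 => ?_) tv tX hbad hδU
    obtain ⟨⟨_, l, l1, l2, l3⟩, _⟩ := h2
    exact ⟨⟨G.tree _ _ (h4.trans l2) l1, l, l1, h4.trans l2, l3⟩, h1.2.trans h3⟩
  · obtain ⟨k, hk, _, m, hm⟩ := hbad δ hδU
    exact hm (hp.allK hcX hk m)

end Ar
end S19

namespace S19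
open Classical

universe u
variable {α : Type u}

/-- restriction of a tree to the nodes comparable with a node -/
def Cmp (S : Set (List α)) (δ : List α) : Set (List α) := {h | h ∈ S ∧ (h <+: δ ∨ δ <+: h)}

theorem body_cmp {S : Set (List α)} {δ : List α} {p : ℕ → α} (hp : p ∈ Body S) (hd : Pass δ p) :
    p ∈ Body (Cmp S δ) := by
  intro n
  refine ⟨hp n, ?_⟩
  rcases le_total n δ.length with h | h
  · left
    have := pre_prefix p h
    rwa [hd] at this
  · right; exact hd.preOf h

theorem cmp_tree {S : Set (List α)} {δ : List α} (hS : ∀ h k : List α, h <+: k → k ∈ S → h ∈ S) :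
    ∀ h k : List α, h <+: k → k ∈ Cmp S δ → h ∈ Cmp S δ := by
  rintro h k hk ⟨h1, h2⟩
  refine ⟨hS _ _ hk h1, ?_⟩
  rcases h2 with h2 | h2
  · exact Or.inl (hk.trans h2)
  · exact List.prefix_or_prefix_of_prefix hk h2

theorem cmp_prn {S : Set (List α)} {δ : List α} (hS : ∀ h k : List α, h <+: k → k ∈ S → h ∈ S)
    (hp : ∀ h ∈ S, ∃ x, h ++ [x] ∈ S) (hd : δ ∈ S) : ∀ h ∈ Cmp S δ, ∃ x, h ++ [x] ∈ Cmp S δ := by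
  rintro h ⟨h1, h2⟩
  have big : δ <+: h → ∃ x, h ++ [x] ∈ Cmp S δ := fun h3 => by
    obtain ⟨x, hx⟩ := hp h h1
    exact ⟨x, hx, Or.inr (h3.trans (List.prefix_append _ _))⟩
  rcases h2 with h2 | h2
  · rcases prefix_cases h2 with rfl | ⟨x, hx⟩
    · exact big List.prefix_rfl
    · exact ⟨x, hS _ _ hx hd, Or.inl hx⟩
  · exact big h2

/-- `A` is decided at `δ` in `S` -/
def Dec (S : Set (List α)) (A : Set (ℕ → α)) (δ : List α) : Prop :=
  (∀ p ∈ Body S, Pass δ p → p ∈ A) ∨ (∀ p ∈ Body S, Pass δ p → p ∉ A)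

theorem quasi_dec {T : Set (List α)} {A : Set (ℕ → α)} (hA : QuasiDiff T A) :
    ∀ S : Set (List α), S ⊆ T → S.Nonempty →
    (∀ h k : List α, h <+: k → k ∈ S → h ∈ S) → (∀ h ∈ S, ∃ x, h ++ [x] ∈ S) →
    ∃ δ ∈ S, Dec S A δ := by
  induction hA with
  | isOpen A hA =>
    intro S hST hne hcl hpr
    obtain ⟨S0, _, rfl⟩ := hA
    by_cases h : ∃ γ ∈ S0, γ ∈ S
    · obtain ⟨γ, h1, h2⟩ := h
      refine ⟨γ, h2, Or.inl fun p hp hpa => ?_⟩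
      simp only [Set.mem_iUnion]
      exact ⟨γ, h1, fun n => hST (hp n), hpa⟩
    · obtain ⟨δ, hδ⟩ := hne
      refine ⟨δ, hδ, Or.inr fun p hp _ hc => h ?_⟩
      simp only [Set.mem_iUnion] at hc
      obtain ⟨γ, h1, h2⟩ := hc
      refine ⟨γ, h1, ?_⟩
      rw [← h2.2]; exact hp _
  | iUnion S0 D hS0 hinc hq hsub ih =>
    intro S hST hne hcl hpr
    by_cases h : ∃ γ ∈ S0, γ ∈ S
    · obtain ⟨γ, h1, h2⟩ := h
      obtain ⟨δ, hδ, hdec⟩ := ih γ h1 (Cmp S γ) (fun _ hx => hST hx.1) ⟨γ, h2, Or.inl List.prefix_rfl⟩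
        (cmp_tree hcl) (cmp_prn hcl hpr h2)
      obtain ⟨ε, he, h3, h4⟩ : ∃ ε ∈ S, γ <+: ε ∧ δ <+: ε := by
        rcases hδ.2 with h | h
        · exact ⟨γ, h2, List.prefix_rfl, h⟩
        · exact ⟨δ, hδ.1, h, List.prefix_rfl⟩
      have key : ∀ p, Pass γ p → (p ∈ ⋃ γ ∈ S0, D γ) → p ∈ D γ := by
        intro p hp hc
        simp only [Set.mem_iUnion] at hc
        obtain ⟨γ', h5, h6⟩ := hc
        have h7 : Pass γ' p := (hsub γ' h5 h6).2
        by_cases heq : γ' = γ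
        · rwa [heq] at h6
        · exfalso
          rcases le_total γ.length γ'.length with hl | hl
          · apply hinc h1 h5 (Ne.symm heq)
            have := hp.preOf hl
            rwa [h7] at this
          · apply hinc h5 h1 heq
            have := h7.preOf hl
            rwa [hp] at this
      refine ⟨ε, he, ?_⟩
      rcases hdec with hd | hd
      · left
        intro p hp hpa
        simp only [Set.mem_iUnion]
        exact ⟨γ, h1, hd p (body_cmp hp (hpa.mono h3)) (hpa.mono h4)⟩
      · right
        intro p hp hpa hc
        exact hd p (body_cmp hp (hpa.mono h3)) (hpa.mono h4) (key p (hpa.mono h3) hc)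
    · obtain ⟨δ, hδ⟩ := hne
      refine ⟨δ, hδ, Or.inr fun p hp _ hc => h ?_⟩
      simp only [Set.mem_iUnion] at hc
      obtain ⟨γ, h1, h2⟩ := hc
      refine ⟨γ, h1, ?_⟩
      rw [← (hsub γ h1 h2).2]; exact hp _
  | compl A hA ih =>
    intro S hST hne hcl hpr
    obtain ⟨δ, hδ, hd⟩ := ih S hST hne hcl hpr
    refine ⟨δ, hδ, ?_⟩
    rcases hd with hd | hd
    · exact Or.inr fun p hp hpa hc => hc.2 (hd p hp hpa)
    · exact Or.inl fun p hp hpa => ⟨fun n => hST (hp n), hd p hp hpa⟩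

theorem quasi_dec_list {T : Set (List α)} {ι : Type} {A : ι → Set (ℕ → α)}
    (hA : ∀ i, QuasiDiff T (A i)) (l : List ι) :
    ∀ S : Set (List α), S ⊆ T → S.Nonempty →
    (∀ h k : List α, h <+: k → k ∈ S → h ∈ S) → (∀ h ∈ S, ∃ x, h ++ [x] ∈ S) →
    ∃ δ ∈ S, ∀ i ∈ l, Dec S (A i) δ := by
  intro S hST hne hcl hpr
  induction l with
  | nil =>
    obtain ⟨δ, hδ⟩ := hne
    exact ⟨δ, hδ, by simp⟩
  | cons i l ih =>
    obtain ⟨γ, h2, hγ⟩ := ih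
    obtain ⟨δ, hδ, hdec⟩ := quasi_dec (hA i) (Cmp S γ) (fun _ hx => hST hx.1)
      ⟨γ, h2, Or.inl List.prefix_rfl⟩ (cmp_tree hcl) (cmp_prn hcl hpr h2)
    obtain ⟨ε, he, h3, h4⟩ : ∃ ε ∈ S, γ <+: ε ∧ δ <+: ε := by
      rcases hδ.2 with h | h
      · exact ⟨γ, h2, List.prefix_rfl, h⟩
      · exact ⟨δ, hδ.1, h, List.prefix_rfl⟩
    refine ⟨ε, he, fun j hj => ?_⟩
    rcases List.mem_cons.1 hj with rfl | hj
    · rcases hdec with hd | hd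
      · exact Or.inl fun p hp hpa => hd p (body_cmp hp (hpa.mono h3)) (hpa.mono h4)
      · exact Or.inr fun p hp hpa => hd p (body_cmp hp (hpa.mono h3)) (hpa.mono h4)
    · rcases hγ j hj with hd | hd
      · exact Or.inl fun p hp hpa => hd p hp (hpa.mono h3)
      · exact Or.inr fun p hp hpa => hd p hp (hpa.mono h3)

/-- collapse of the outcomes -/
def col : Fin 6 → Oc := ![Oc.X, Oc.Y false, Oc.Z true, Oc.X, Oc.Y true, Oc.Z false]

theorem star_of_quasi (G : Ar α) (v : (ℕ → α) → Fin 6) (hv : ∀ p, G.v p = col (v p))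
    (hD : ∀ x, QuasiDiff G.T {p ∈ Body G.T | v p = x}) : G.Star := by
  intro S hST hne hcl hpr
  obtain ⟨δ, hδ, hd⟩ := quasi_dec_list hD (List.finRange 6) S hST hne hcl hpr
  refine ⟨δ, hδ, ?_⟩
  by_cases hx : ∃ x, ∀ p ∈ Body S, Pass δ p → v p = x
  · obtain ⟨x, hx⟩ := hx
    exact ⟨col x, fun p hp hpa => by rw [hv, hx p hp hpa]⟩
  · refine ⟨Oc.X, fun p hp hpa => ?_⟩
    exfalso
    rcases hd (v p) (List.mem_finRange _) with h | h
    · exact hx ⟨v p, fun q hq hqa => (h q hq hqa).2⟩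
    · exact h p hp hpa ⟨fun n => hST (hp n), rfl⟩

namespace Ar
variable {G : Ar α}

theorem D_inv {F : Set Bool} {s : List α → α} {h : List α} {I : List α → Prop} (h0 : I h)
    (hs : ∀ k x, k ∈ G.T → I k → k ++ [x] ∈ G.T → (G.d k ∈ F ∨ x = s k) → I (k ++ [x]))
    {p : ℕ → α} (hp : p ∈ Body G.T) (hpa : Pass h p) (hf : G.Fol F s h p) :
    ∀ n, h.length ≤ n → I (playPrefix p n) := by
  intro n hn
  induction n, hn using Nat.le_induction with
  | base => rwa [hpa]
  | succ n hn ih =>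
    have := hp (n + 1)
    rw [pre_succ] at this ⊢
    refine hs _ _ (hp n) ih this ?_
    by_cases hd : G.d (playPrefix p n) ∈ F
    · exact Or.inl hd
    · exact Or.inr (hf n hn hd)

/-- winning set of a player -/
def Pw (i : Bool) (w : Oc) : Prop := if i then w = Oc.X else w ≠ Oc.X

theorem Pw_or (w : Oc) : ∃ i, Pw i w := by
  by_cases h : w = Oc.X
  · exact ⟨true, by simp [Pw, h]⟩
  · exact ⟨false, by simp [Pw, h]⟩

def Gd (G : Ar α) (i : Bool) (s : List α → α) (h : List α) : Prop :=
  G.Val s ∧ ∀ w, G.D {!i} s h w → Pw i w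

def Wn (G : Ar α) (i : Bool) (h : List α) : Prop := ∃ s, G.Gd i s h

theorem Gd.step {i : Bool} {s : List α → α} {h : List α} (hg : G.Gd i s h) {x : α}
    (hx : G.d h ∈ ({!i} : Set Bool) ∨ x = s h) : G.Gd i s (h ++ [x]) :=
  ⟨hg.1, fun w hw => hg.2 w (D_child hx hw)⟩

theorem uniform [Nonempty α] (G : Ar α) (i : Bool) :
    ∃ s, G.Val s ∧ ∀ h, G.Wn i h → G.Gd i s h := by
  obtain ⟨t, ht⟩ := exists_val G
  have hpk : ∀ c, ∃ s, G.Val s ∧ (G.Wn i c → G.Gd i s c) := fun c => by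
    by_cases hc : G.Wn i c
    · obtain ⟨s, hs⟩ := hc
      exact ⟨s, hs.1, fun _ => hs⟩
    · exact ⟨t, ht, fun h => absurd h hc⟩
  choose pk hpv hpg using hpk
  obtain ⟨st, hst0, hst⟩ := exists_mach ([] : List α) (pk [])
    (fun σ h x => if G.Gd i σ (h ++ [x]) then σ else pk (h ++ [x]))
  have inv : ∀ h, G.Val (st h) ∧ (G.Wn i h → G.Gd i (st h) h) := by
    intro h
    refine ext_ind (e := []) (P := fun h => G.Val (st h) ∧ (G.Wn i h → G.Gd i (st h) h))
      ?_ ?_ h (List.nil_prefix)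
    · rw [hst0]; exact ⟨hpv _, hpg _⟩
    · intro h x hh ih
      rw [hst h x hh]
      split_ifs with hc
      · exact ⟨hc.1, fun _ => hc⟩
      · exact ⟨hpv _, hpg _⟩
  have hval : G.Val (fun h => st h h) := fun h hh => (inv h).1 h hh
  refine ⟨fun h => st h h, hval, fun h hh => ⟨hval, ?_⟩⟩
  rintro w ⟨p, h1, h2, h3, h4⟩
  have hg := (inv h).2 hh
  have key := D_inv (I := fun k => st k = st h ∧ G.Gd i (st h) k) ⟨rfl, hg⟩
    (by
      rintro k x - ⟨hk1, hk2⟩ - hx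
      have hx' : G.d k ∈ ({!i} : Set Bool) ∨ x = st h k := by
        rcases hx with hx | hx
        · exact Or.inl hx
        · right; rw [hx, hk1]
      have := hk2.step hx'
      refine ⟨?_, this⟩
      rw [hst k x List.nil_prefix, hk1, if_pos this]) h1 h2 h3
  refine hg.2 w ⟨p, h1, h2, fun n hn hd => ?_, h4⟩
  rw [h3 n hn hd]; exact congrFun (key n hn).1 _

theorem Wn.own [Nonempty α] {i : Bool} {h : List α} {x : α} (hx : G.Wn i (h ++ [x]))
    (hm : h ++ [x] ∈ G.T) (hd : G.d h = i) : G.Wn i h := by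
  obtain ⟨s, hs⟩ := hx
  have e1 : ∀ k, h ++ [x] <+: k → Function.update s h x k = s k := fun k hk => by
    apply Function.update_of_ne
    rintro rfl; exact not_snoc_prefix _ _ hk
  refine ⟨Function.update s h x, ?_, ?_⟩
  · intro k hk
    by_cases hkh : k = h
    · subst hkh; simpa using hm
    · rw [Function.update_of_ne hkh]; exact hs.1 k hk
  · intro w hw
    obtain ⟨y, _, hy, hw⟩ := D_step hw
    have : y = x := by
      rcases hy with hy | hy
      · rw [hd] at hy; cases i <;> simp at hy
      · simpa using hy
    subst this
    exact hs.2 w (D_congr e1 hw)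

theorem Wn.opp [Nonempty α] {i : Bool} {h : List α}
    (hx : ∀ x, h ++ [x] ∈ G.T → G.Wn i (h ++ [x])) : G.Wn i h := by
  obtain ⟨s, hs, hg⟩ := uniform G i
  refine ⟨s, hs, fun w hw => ?_⟩
  obtain ⟨x, hm, _, hw⟩ := D_step hw
  exact (hg _ (hx x hm)).2 w hw

theorem determined [Nonempty α] (hst : G.Star) {h0 : List α} (h0m : h0 ∈ G.T) :
    ∃ i, G.Wn i h0 := by
  by_contra hcon
  let Und : List α → Prop := fun k => k ∈ G.T ∧ ∀ i, ¬ G.Wn i k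
  have hch : ∀ h, Und h → ∃ x, Und (h ++ [x]) := by
    rintro h ⟨hh, hu⟩
    by_contra hc
    refine hu (!(G.d h)) (Wn.opp fun x hx => ?_)
    by_contra hn
    refine hc ⟨x, hx, fun i hi => ?_⟩
    by_cases hd : G.d h = i
    · exact hu i (hi.own hx hd)
    · have : i = !(G.d h) := by revert hd; cases i <;> cases G.d h <;> simp
      rw [this] at hi; exact hn hi
  obtain ⟨δ, ⟨hδ, k, hδk, hk⟩, c, hc⟩ := hst {h | h ∈ G.T ∧ ∃ k, h <+: k ∧ Und k}
    (fun _ h => h.1) ⟨h0, h0m, h0, List.prefix_rfl, h0m, fun i hi => hcon ⟨i, hi⟩⟩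
    (fun h k hk hm => ⟨G.tree _ _ hk hm.1, by
      obtain ⟨_, l, hl, hu⟩ := hm
      exact ⟨l, hk.trans hl, hu⟩⟩)
    (by
      rintro h ⟨hh, k, hhk, hk⟩
      rcases prefix_cases hhk with rfl | ⟨x, hx⟩
      · obtain ⟨x, hx⟩ := hch _ hk
        exact ⟨x, hx.1, _, List.prefix_rfl, hx⟩
      · exact ⟨x, G.tree _ _ hx hk.1, k, hx, hk⟩)
  obtain ⟨i, hi⟩ := Pw_or c
  obtain ⟨u, hu, hg⟩ := uniform G i
  have hq : ∀ h, ∃ x, h ++ [x] = h ++ [x] ∧ (Und h → Und (h ++ [x])) := fun h => by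
    by_cases hU : Und h
    · obtain ⟨x, hx⟩ := hch h hU; exact ⟨x, rfl, fun _ => hx⟩
    · exact ⟨u h, rfl, fun hh => absurd hh hU⟩
  choose q _ hq using hq
  let s : List α → α := fun h => if Und h then q h else u h
  have sv : G.Val s := by
    intro h hh
    simp only [s]
    split_ifs with hU
    · exact (hq h hU).1
    · exact hu h hh
  refine hk.2 i ⟨s, sv, ?_⟩
  rintro w ⟨p, h1, h2, h3, h4⟩
  have wstep : ∀ k x, G.Wn i k → (G.d k ∈ ({!i} : Set Bool) ∨ x = s k) → G.Wn i (k ++ [x]) := by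
    intro k x hk hx
    refine ⟨u, (hg k hk).step ?_⟩
    have : ¬ Und k := fun hU => hU.2 i hk
    simpa only [s, if_neg this] using hx
  have key := D_inv (I := fun k => Und k ∨ G.Wn i k) (Or.inl hk)
    (by
      rintro k x hkm (hk | hk) hm hx
      · by_cases hd : G.d k = i
        · left
          rcases hx with hx | hx
          · rw [hd] at hx; cases i <;> simp at hx
          · rw [hx]; simp only [s, if_pos hk]; exact hq k hk
        · by_cases hW : G.Wn i (k ++ [x])
          · exact Or.inr hW
          · refine Or.inl ⟨hm, fun j hj => ?_⟩
            by_cases hji : j = i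
            · subst hji; exact hW hj
            · have : G.d k = j := by
                revert hd hji; cases i <;> cases j <;> cases G.d k <;> simp
              exact hk.2 j (hj.own hm this)
      · exact Or.inr (wstep k x hk hx)) h1 h2 h3
  by_cases hW : ∃ n, k.length ≤ n ∧ G.Wn i (playPrefix p n)
  · obtain ⟨n, hn, hW⟩ := hW
    have f3 : G.Fol {!i} s (playPrefix p n) p := fun m hm hd =>
      h3 m (hn.trans (by simpa [pre_length] using hm)) hd
    have k2 := D_inv (I := fun k => G.Wn i k) hW (fun k x _ hk _ hx => wstep k x hk hx) h1
      (pass_pre p n) f3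
    refine (hg _ hW).2 w ⟨p, h1, pass_pre p n, fun m hm hd => ?_, h4⟩
    rw [f3 m hm hd]
    have : ¬ Und (playPrefix p m) := fun hU => hU.2 i (k2 m hm)
    simp only [s, if_neg this]
  · rw [← h4, hc p ?_ (h2.mono hδk)]
    · exact hi
    · intro n
      refine ⟨h1 n, playPrefix p (n + k.length), pre_prefix p (by omega), ?_⟩
      rcases key (n + k.length) (by omega) with h | h
      · exact h
      · exact absurd ⟨_, by omega, h⟩ hW

theorem exclusive {h : List α} (hh : h ∈ G.T) (ha : G.Wn true h) (hb : G.Wn false h) : False := by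
  obtain ⟨s, sv, hs⟩ := ha
  obtain ⟨t, tv, ht⟩ := hb
  let r : List α → α := fun k => if G.d k = true then s k else t k
  have rv : G.Val r := by
    intro k hk
    simp only [r]
    split_ifs
    · exact sv k hk
    · exact tv k hk
  have h1 : G.D {!true} s h (G.o r h) := by
    refine ⟨run r h, run_body rv hh, pass_run r h, fun n hn hd => ?_, rfl⟩
    rw [G.run_fol ∅ r h n hn (by simp)]
    have : G.d (playPrefix (run r h) n) = true := by simpa using hd
    simp only [r, if_pos this]
  have h2 : G.D {!false} t h (G.o r h) := by
    refine ⟨run r h, run_body rv hh, pass_run r h, fun n hn hd => ?_, rfl⟩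
    rw [G.run_fol ∅ r h n hn (by simp)]
    have : ¬ G.d (playPrefix (run r h) n) = true := by simpa using hd
    simp only [r, if_neg this]
  have := hs _ h1
  have := ht _ h2
  simp_all [Pw]

end Ar
end S19

namespace S19
open Classical

universe u
variable {α : Type u}

namespace Ar
variable {G : Ar α}

/-- nodes where `b` can avoid `X` -/
def Bs (G : Ar α) : Set (List α) := {h | h ∈ G.T ∧ G.Wn false h}

theorem Bs_true {h : List α} {x : α} (hh : h ∈ G.Bs) (hd : G.d h = true)
    (hm : h ++ [x] ∈ G.T) : h ++ [x] ∈ G.Bs := by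
  obtain ⟨_, s, hs⟩ := hh
  exact ⟨hm, s, hs.step (Or.inl (by simp [hd]))⟩

/-- sub-arena at `e` -/
def subAr (G : Ar α) (b : List α → α) (bv : G.Val b) (bg : ∀ h, G.Wn false h → G.Gd false b h)
    (e : List α) (he : e ∈ G.Bs) : Ar α where
  T := {h | h <+: e ∨ In G.Bs e h}
  d := G.d
  v := G.v
  tree := by
    rintro h k hk (h1 | h1)
    · exact Or.inl (hk.trans h1)
    · rcases List.prefix_or_prefix_of_prefix hk h1.1 with h2 | h2
      · exact Or.inl h2
      · exact Or.inr ⟨h2, fun l h3 h4 => h1.2 l h3 (h4.trans hk)⟩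
  prn := by
    have big : ∀ h, In G.Bs e h → ∃ x, h ++ [x] <+: e ∨ In G.Bs e (h ++ [x]) := by
      intro h hi
      have hm := bv h hi.mem.1
      refine ⟨b h, Or.inr (hi.snoc ⟨hm, b, (bg h hi.mem.2).step (Or.inr rfl)⟩)⟩
    rintro h (h1 | h1)
    · rcases prefix_cases h1 with rfl | ⟨x, hx⟩
      · exact big _ (In.refl he)
      · exact ⟨x, Or.inl hx⟩
    · exact big _ h1

theorem subAr_sub {b : List α → α} {bv : G.Val b} {bg : ∀ h, G.Wn false h → G.Gd false b h}
    {e : List α} {he : e ∈ G.Bs} : (G.subAr b bv bg e he).T ⊆ G.T := by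
  rintro h (h1 | h1)
  · exact G.tree _ _ h1 he.1
  · exact h1.mem.1

theorem subAr_sol (hst : G.Star) {b : List α → α} {bv : G.Val b}
    {bg : ∀ h, G.Wn false h → G.Gd false b h}
    {e : List α} {he : e ∈ G.Bs} : ∃ s, (G.subAr b bv bg e he).Sol e s := by
  have st' : (G.subAr b bv bg e he).Star := fun S hS h1 h2 h3 =>
    hst S (hS.trans subAr_sub) h1 h2 h3
  have hq : ∀ h, ∃ x, h ++ [x] = h ++ [x] ∧ (e <+: h → x = b h) ∧
      (h ∈ (G.subAr b bv bg e he).T → h ++ [x] ∈ (G.subAr b bv bg e he).T) := by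
    intro h
    by_cases h1 : e <+: h
    · refine ⟨b h, rfl, fun _ => rfl, fun hm => ?_⟩
      have hi : In G.Bs e h := by
        rcases hm with hm | hm
        · have : h = e := hm.eq_of_length_le h1.length_le
          subst this; exact In.refl he
        · exact hm
      exact Or.inr (hi.snoc ⟨bv h hi.mem.1, b, (bg h hi.mem.2).step (Or.inr rfl)⟩)
    · by_cases hm : h ∈ (G.subAr b bv bg e he).T
      · obtain ⟨x, hx⟩ := (G.subAr b bv bg e he).prn h hm
        exact ⟨x, rfl, fun h2 => absurd h2 h1, fun _ => hx⟩
      · exact ⟨b h, rfl, fun _ => rfl, fun h2 => absurd h2 hm⟩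
  choose τ _ hτ1 hτ2 using hq
  have tX : ∀ h ∈ (G.subAr b bv bg e he).T, ¬ (G.subAr b bv bg e he).D {true} τ h Oc.X := by
    rintro h hh ⟨p, h1, h2, h3, h4⟩
    have hpe : Pass e p := by
      rcases h1 e.length with h5 | h5
      · exact h5.eq_of_length (pre_length _ _)
      · exact (h5.1.eq_of_length (pre_length _ _).symm).symm
    obtain ⟨k, hk, h5, h6, h7⟩ : ∃ k, k ∈ G.Bs ∧ e <+: k ∧ h <+: k ∧ Pass k p := by
      rcases hh with hh | hh
      · exact ⟨e, he, List.prefix_rfl, hh, hpe⟩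
      · exact ⟨h, hh.mem, hh.1, List.prefix_rfl, h2⟩
    have : G.D {!false} b k Oc.X := by
      refine ⟨p, fun n => subAr_sub (h1 n), h7, fun n hn hd => ?_, h4⟩
      rw [h3 n (h6.length_le.trans hn) hd]
      exact hτ1 _ (h5.trans (h7.preOf hn))
    have := (bg k hk.2).2 _ this
    simp [Pw] at this
  obtain ⟨s, hs, _⟩ := core st' (fun h hh => hτ2 h hh) tX (e := e) (Or.inl List.prefix_rfl) true
  exact ⟨s, hs⟩

theorem nodes [Nonempty α] (hst : G.Star) : ∃ s, G.Val s ∧ ∀ h ∈ G.T,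
    (G.o s h = Oc.X → ∀ w, G.D {false} s h w → w = Oc.X) ∧
    (G.o s h ≠ Oc.X → ¬ G.D {true} s h Oc.X) ∧
    ∀ m, G.o s h = Oc.Z m → ¬ G.D {true} s h (Oc.Y m) ∧ ¬ G.D {false} s h (Oc.Y !m) := by
  obtain ⟨a, av, ag⟩ := uniform G true
  obtain ⟨b, bv, bg⟩ := uniform G false
  have hA : ∀ h ∈ G.T, h ∉ G.Bs → G.Wn true h := by
    intro h hh hn
    obtain ⟨i, hi⟩ := determined hst hh
    cases i
    · exact absurd ⟨hh, hi⟩ hn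
    · exact hi
  have hA' : ∀ h, h ∈ G.T → G.Wn true h → h ∉ G.Bs := fun h hh h1 h2 => exclusive hh h1 h2.2
  have hsol : ∀ e, ∃ s : List α → α, ∀ he : e ∈ G.Bs, (G.subAr b bv bg e he).Sol e s := by
    intro e
    by_cases he : e ∈ G.Bs
    · obtain ⟨s, hs⟩ := subAr_sol hst (bv := bv) (bg := bg) (he := he)
      exact ⟨s, fun _ => hs⟩
    · exact ⟨b, fun h => absurd h he⟩
  choose S hS using hsol
  obtain ⟨st, st0, stx⟩ := exists_mach ([] : List α) ([] : List α)
    (fun e h x => if h ∈ G.Bs then e else h ++ [x])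
  have stIn : ∀ h, h ∈ G.Bs → In G.Bs (st h) h := by
    intro h
    refine ext_ind (e := []) (P := fun h => h ∈ G.Bs → In G.Bs (st h) h) ?_ ?_ h List.nil_prefix
    · intro h; rw [st0]; exact In.refl h
    · intro h x hh ih hm
      rw [stx h x hh]
      split_ifs with hc
      · exact (ih hc).snoc hm
      · exact In.refl hm
  let s : List α → α := fun h => if h ∈ G.Bs then S (st h) h else a h
  have sB : ∀ h, h ∈ G.Bs → h ++ [s h] ∈ G.Bs := by
    intro h hh
    have hi := stIn h hh
    have := (hS _ hi.start).1 h (Or.inr hi)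
    simp only [s, if_pos hh]
    rcases this with h1 | h1
    · exact absurd (h1.trans hi.1) (not_snoc_prefix _ _)
    · exact h1.mem
  have sA : ∀ h x, h ∈ G.T → h ∉ G.Bs → h ++ [x] ∈ G.T →
      (G.d h ∈ ({false} : Set Bool) ∨ x = s h) → h ++ [x] ∉ G.Bs := by
    intro h x hh hn hm hx
    refine hA' _ hm ⟨a, (ag h (hA h hh hn)).step ?_⟩
    simpa only [s, if_neg hn, Bool.not_true] using hx
  have sv : G.Val s := by
    intro h hh
    by_cases hb : h ∈ G.Bs
    · exact (sB h hb).1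
    · simp only [s, if_neg hb]; exact av h hh
  have DA : ∀ h ∈ G.T, h ∉ G.Bs → ∀ w, G.D {false} s h w → w = Oc.X := by
    rintro h hh hn w ⟨p, h1, h2, h3, h4⟩
    have key := D_inv (I := fun k => k ∉ G.Bs) hn (fun k x hk hi hm hx => sA k x hk hi hm hx)
      h1 h2 h3
    have : G.D {!true} a h w := by
      refine ⟨p, h1, h2, fun n hn hd => ?_, h4⟩
      rw [h3 n hn hd]
      simp only [s, if_neg (key n hn)]
    have := (ag h (hA h hh hn)).2 w this
    simpa [Pw] using this
  have oA : ∀ h ∈ G.T, h ∉ G.Bs → G.o s h = Oc.X := fun h hh hn => DA h hh hn _ (D_o _ sv hh)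
  refine ⟨s, sv, fun h hh => ?_⟩
  by_cases hb : h ∈ G.Bs
  swap
  · have := oA h hh hb
    exact ⟨fun _ => DA h hh hb, fun h1 => absurd this h1, fun m h1 => by rw [this] at h1; cases h1⟩
  have hi := stIn h hb
  obtain ⟨e, he⟩ : ∃ e, st h = e := ⟨_, rfl⟩
  rw [he] at hi
  have hs := hS e hi.start
  have hmem : h ∈ (G.subAr b bv bg e hi.start).T := Or.inr hi
  have loc := hs.2 h hmem hi.1
  -- transfer of a play staying in the region
  have trans : ∀ (F : Set Bool) p, p ∈ Body G.T → Pass h p → G.Fol F s h p →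
      (∀ n, h.length ≤ n → In G.Bs e (playPrefix p n) ∧ st (playPrefix p n) = e) →
      (G.subAr b bv bg e hi.start).D F (S e) h (G.v p) := by
    intro F p h1 h2 h3 key
    refine ⟨p, fun n => ?_, h2, fun n hn hd => ?_, rfl⟩
    · exact (G.subAr b bv bg e hi.start).tree _ _ (pre_prefix p (Nat.le_add_right n h.length))
        (Or.inr (key (n + h.length) (by omega)).1)
    · rw [h3 n hn hd]
      simp only [s, if_pos (key n hn).1.mem, (key n hn).2]
  have stp : ∀ k x, In G.Bs e k → st k = e → k ++ [x] ∈ G.Bs →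
      In G.Bs e (k ++ [x]) ∧ st (k ++ [x]) = e := by
    intro k x h1 h2 h3
    refine ⟨h1.snoc h3, ?_⟩
    rw [stx k x List.nil_prefix, if_pos h1.mem, h2]
  have DT : ∀ F : Set Bool, F ⊆ {true} → ∀ w, G.D F s h w →
      (G.subAr b bv bg e hi.start).D F (S e) h w := by
    rintro F hF w ⟨p, h1, h2, h3, rfl⟩
    refine trans F p h1 h2 h3 (D_inv (I := fun k => In G.Bs e k ∧ st k = e) ⟨hi, he⟩ ?_ h1 h2 h3)
    rintro k x hk ⟨h4, h5⟩ hm hx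
    refine stp k x h4 h5 ?_
    rcases hx with hx | rfl
    · exact Bs_true h4.mem (hF hx) hm
    · exact sB k h4.mem
  have DF : ∀ w, G.D {false} s h w → w = Oc.X ∨
      (G.subAr b bv bg e hi.start).D {false} (S e) h w := by
    rintro w ⟨p, h1, h2, h3, rfl⟩
    have key := D_inv (I := fun k => (In G.Bs e k ∧ st k = e) ∨ (k ∈ G.T ∧ k ∉ G.Bs))
      (Or.inl ⟨hi, he⟩) (by
        rintro k x hk (⟨h4, h5⟩ | ⟨h4, h5⟩) hm hx
        · by_cases hc : k ++ [x] ∈ G.Bs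
          · exact Or.inl (stp k x h4 h5 hc)
          · exact Or.inr ⟨hm, hc⟩
        · exact Or.inr ⟨hm, sA k x hk h5 hm hx⟩) h1 h2 h3
    by_cases hc : ∃ n, h.length ≤ n ∧ playPrefix p n ∉ G.Bs
    · left
      obtain ⟨n, hn, hc⟩ := hc
      refine DA _ (h1 n) hc _ ⟨p, h1, pass_pre p n, fun m hm hd => h3 m ?_ hd, rfl⟩
      rw [pre_length] at hm; omega
    · right
      refine trans _ p h1 h2 h3 fun n hn => ?_
      rcases key n hn with h5 | h5
      · exact h5
      · exact absurd ⟨n, hn, h5.2⟩ hc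
  have oe : (G.subAr b bv bg e hi.start).o (S e) h = G.o s h :=
    (D_empty hs.1 hmem).1 (DT ∅ (by simp) _ ((D_empty sv hh).2 rfl))
  have nX : ¬ G.D {true} s h Oc.X := fun h1 => loc.1 (DT _ subset_rfl _ h1)
  refine ⟨fun h1 => absurd h1 (o_ne_X sv hh nX), fun _ => nX, fun m hm => ?_⟩
  have hc := loc.2 m (oe.trans hm)
  unfold Cond at hc
  rw [oe, hm] at hc
  refine ⟨fun h1 => hc.1 (by simp) (DT _ subset_rfl _ h1), fun h1 => ?_⟩
  rcases DF _ h1 with h2 | h2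
  · cases h2
  · exact hc.2 (by simp) h2

end Ar
end S19

namespace S19
open Classical

universe u
variable {α : Type u}

theorem snoc_of_succ {T : Set (List α)} {γ δ : List α} (h : δ ∈ treeSucc T γ) :
    ∃ x, δ = γ ++ [x] := by
  obtain ⟨_, ⟨l, rfl⟩, h3⟩ := h
  have : l.length = 1 := by simpa using h3
  obtain ⟨x, rfl⟩ := List.length_eq_one_iff.1 this
  exact ⟨x, rfl⟩

theorem iter_mem {T : Set (List α)} {s : List α → List α} (hs : IsProfile T s)
    (h0 : [] ∈ T) (n : ℕ) : iterNode s [] n ∈ T := by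
  induction n with
  | zero => exact h0
  | succ n ih => exact (hs _ ih).1

theorem iter_len {T : Set (List α)} {s : List α → List α} (hs : IsProfile T s)
    (h0 : [] ∈ T) (n : ℕ) : (iterNode s [] n).length = n := by
  induction n with
  | zero => rfl
  | succ n ih =>
    have := (hs _ (iter_mem hs h0 n)).2.2
    rw [ih] at this; exact this

theorem iter_succ [Inhabited α] {T : Set (List α)} {s : List α → List α} (hs : IsProfile T s)
    (h0 : [] ∈ T) (n : ℕ) :
    s (iterNode s [] n) = iterNode s [] n ++ [inducedPlay s n] := by
  obtain ⟨x, hx⟩ := snoc_of_succ (hs _ (iter_mem hs h0 n))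
  have hl := iter_len hs h0 n
  have : inducedPlay s n = x := by
    simp only [inducedPlay, iterNode]
    rw [hx, List.getD_append_right _ _ _ _ hl.le]
    simp [hl]
  rw [hx, this]

theorem pre_induced [Inhabited α] {T : Set (List α)} {s : List α → List α} (hs : IsProfile T s)
    (h0 : [] ∈ T) (n : ℕ) : playPrefix (inducedPlay s) n = iterNode s [] n := by
  induction n with
  | zero => simp [playPrefix, iterNode]
  | succ n ih => rw [pre_succ, ih, ← iter_succ hs h0 n]; rfl

theorem listExtend_add (γ : List α) (q : ℕ → α) (n : ℕ) : listExtend γ q (γ.length + n) = q n := by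
  simp [listExtend]

theorem pre_listExtend (γ : List α) (q : ℕ → α) (n : ℕ) :
    playPrefix (listExtend γ q) (γ.length + n) = γ ++ playPrefix q n := by
  induction n with
  | zero =>
    apply List.ext_getElem
    · simp [pre_length]
    · intro n h1 h2
      have : n < γ.length := by simpa [pre_length] using h1
      simp [playPrefix, listExtend, this]
  | succ n ih => rw [← add_assoc, pre_succ, ih, listExtend_add, pre_succ, List.append_assoc]

/-- profile of a node strategy -/
def prof (σ : List α → α) : List α → List α := fun γ => γ ++ [σ γ]

theorem sub_prof (σ : List α → α) (γ δ : List α) :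
    subProfile γ (prof σ) δ = δ ++ [σ (γ ++ δ)] := by
  simp [subProfile, prof]

theorem dev [Inhabited α] (g : Game α Bool (Fin 6)) (G : Ar α) (hGT : G.T = g.T) (hGd : G.d = g.d)
    (hGv : ∀ p, G.v p = col (g.v p)) (σ : List α → α) (F : Set Bool) {γ : List α} (hγ : γ ∈ g.T)
    {s : List α → List α} (hs : IsProfile (g.sub γ).T s)
    (hF : ∀ δ ∈ (g.sub γ).T, subProfile γ (prof σ) δ ≠ s δ → (g.sub γ).d δ ∈ F) :
    G.D F σ γ (col ((g.sub γ).v (inducedPlay s))) := by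
  have h0 : [] ∈ (g.sub γ).T := by
    change γ ++ [] ∈ g.T
    simpa using hγ
  refine ⟨listExtend γ (inducedPlay s), fun n => ?_, ?_, fun n hn hd => ?_, hGv _⟩
  · refine G.tree _ _ (pre_prefix _ (Nat.le_add_left n γ.length)) ?_
    rw [pre_listExtend, pre_induced hs h0, hGT]
    exact iter_mem hs h0 n
  · have := pre_listExtend γ (inducedPlay s) 0
    simpa [Pass, playPrefix] using this
  · obtain ⟨k, rfl⟩ := Nat.exists_eq_add_of_le hn
    rw [pre_listExtend, pre_induced hs h0] at hd ⊢
    rw [listExtend_add]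
    by_contra hne
    rw [hGd] at hd
    refine hd (hF _ (iter_mem hs h0 k) fun h1 => hne ?_)
    rw [sub_prof, iter_succ hs h0] at h1
    have := List.append_cancel_left h1
    simp at this
    exact this.symm

end S19

/-- every two-player game with preferences `≺_a` and `≺_b`, on a countable
pruned tree over a countable alphabet, whose outcome fibers are quasi-difference sets,
has a subgame perfect equilibrium. Players: `true = a`, `false = b`. -/
theorem stmt19 {α : Type*} [Inhabited α] [Countable α] (g : Game α Bool (Fin 6))
    (hT : IsTree g.T) (hne : g.T.Nonempty) (hpr : IsPruned g.T) (hTc : g.T.Countable)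
    (hpa : g.pref true = Ra18) (hpb : g.pref false = Rb18)
    (hD : ∀ x : Fin 6, QuasiDiff g.T {p ∈ Body g.T | g.v p = x}) :
    ∃ s, IsProfile g.T s ∧ IsSPE g s := by
  let G : S19.Ar α :=
    { T := g.T
      d := g.d
      v := fun p => S19.col (g.v p)
      tree := fun h k hk hm => hT hk hm
      prn := fun h hh => by
        obtain ⟨δ, hδ⟩ := hpr h hh
        obtain ⟨x, rfl⟩ := S19.snoc_of_succ hδ
        exact ⟨x, hδ.1⟩ }
  have hst : G.Star := S19.star_of_quasi G g.v (fun _ => rfl) hD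
  obtain ⟨σ, sv, hn⟩ := S19.Ar.nodes hst
  have hprof : IsProfile g.T (S19.prof σ) := fun γ hγ =>
    ⟨sv γ hγ, List.prefix_append _ _, by simp [S19.prof]⟩
  refine ⟨S19.prof σ, hprof, fun γ hγ => ?_⟩
  rintro ⟨i, s', h1, h2, h3⟩
  have hsub : IsProfile (g.sub γ).T (subProfile γ (S19.prof σ)) := by
    intro δ hδ
    rw [S19.sub_prof]
    refine ⟨?_, List.prefix_append _ _, by simp⟩
    change γ ++ (δ ++ [σ (γ ++ δ)]) ∈ g.T
    rw [← List.append_assoc]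
    exact sv _ hδ
  have d0 := S19.dev g G rfl rfl (fun _ => rfl) σ ∅ hγ hsub (fun _ _ h => absurd rfl h)
  have d1 := S19.dev g G rfl rfl (fun _ => rfl) σ {i} hγ h1 (fun δ hδ h => h2 δ hδ h)
  rw [S19.Ar.D_empty sv hγ] at d0
  obtain ⟨n1, n2, n3⟩ := hn γ hγ
  rw [d0] at n1 n2 n3
  revert h3 d1 n1 n2 n3
  generalize (g.sub γ).v (inducedPlay s') = w
  generalize (g.sub γ).v (inducedPlay (subProfile γ (S19.prof σ))) = u
  intro h3 d1 n1 n2 n3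
  cases i
  · change g.pref false u w at h3
    rw [hpb] at h3
    rcases h3 with h | h | h | h | h | h <;> obtain ⟨rfl, rfl⟩ := h
    · exact absurd (n1 rfl _ d1) (by simp [S19.col])
    · exact (n3 true rfl).2 d1
    · exact absurd (n1 rfl _ d1) (by simp [S19.col])
    · exact absurd (n1 rfl _ d1) (by simp [S19.col])
    · exact (n3 false rfl).2 d1
    · exact absurd (n1 rfl _ d1) (by simp [S19.col])
  · change g.pref true u w at h3
    rw [hpa] at h3
    rcases h3 with h | h | h | h | h | h <;> obtain ⟨rfl, rfl⟩ := h
    · exact (n3 false rfl).1 d1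
    · exact n2 (by simp [S19.col]) d1
    · exact n2 (by simp [S19.col]) d1
    · exact (n3 true rfl).1 d1
    · exact n2 (by simp [S19.col]) d1
    · exact n2 (by simp [S19.col]) d1
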